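/- Let p ∈ (1, 2) and let X be an infinite-dimensional real Banach space which is an 𝓛_p-space: there exists λ ≥ 1 such that every finite-dimensional linear subspace E of X is contained in a finite-dimensional linear subspace F of X for which there exist n ∈ ℕ and a linear isomorphism T from F onto ℝ^n equipped with the ℓ_p-norm satisfying ‖T‖·‖T⁻¹‖ ≤ λ. Suppose there exists a map f : X → ℓ_p which is weakly sequentially continuous, coarse, and satisfies Property (*). Then X is linearly isomorphic to ℓ_p: there exists a bounded linear bijection from X onto ℓ_p with bounded inverse. -/

import Mathlib

open Filter

/-- A map between normed spaces is *coarse* if points at distance at most `t`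
are mapped to points at uniformly bounded distance. -/
def Coarse {X Y : Type*} [NormedAddCommGroup X] [NormedAddCommGroup Y]
    (f : X → Y) : Prop :=
  ∀ t : ℝ, 0 ≤ t → ∃ C : ℝ, ∀ x y : X, ‖x - y‖ ≤ t → ‖f x - f y‖ ≤ C

/-- Property (*): there are `0 < α < β` and `b > 0` such that points at distance
in `[α, β]` are mapped to points at distance at least `b`. -/
def PropertyStar {X Y : Type*} [NormedAddCommGroup X] [NormedAddCommGroup Y]
    (f : X → Y) : Prop :=
  ∃ α β b : ℝ, 0 < α ∧ α < β ∧ 0 < b ∧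
    ∀ x y : X, α ≤ ‖x - y‖ → ‖x - y‖ ≤ β → b ≤ ‖f x - f y‖

/-- A map is weakly sequentially continuous if it sends weakly convergent
sequences to weakly convergent sequences. -/
def WeakSeqCont {X Y : Type*} [NormedAddCommGroup X] [NormedSpace ℝ X]
    [NormedAddCommGroup Y] [NormedSpace ℝ Y] (f : X → Y) : Prop :=
  ∀ (x : ℕ → X) (x₀ : X),
    (∀ φ : X →L[ℝ] ℝ, Tendsto (fun n => φ (x n)) atTop (nhds (φ x₀))) →
    ∀ ψ : Y →L[ℝ] ℝ, Tendsto (fun n => ψ (f (x n))) atTop (nhds (ψ (f x₀)))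

/-- The modulus of asymptotic uniform convexity `δ̄_Y(t)`. -/
noncomputable def AUCmod (Y : Type*) [NormedAddCommGroup Y] [NormedSpace ℝ Y] (t : ℝ) : ℝ :=
  sInf { r : ℝ | ∃ x : Y, ‖x‖ = 1 ∧
    r = sSup { s : ℝ | ∃ E : Subspace ℝ Y, IsClosed (E : Set Y) ∧
      FiniteDimensional ℝ (Y ⧸ E) ∧
      s = sInf { u : ℝ | ∃ y : Y, y ∈ E ∧ ‖y‖ = 1 ∧ u = ‖x + t • y‖ - 1 } } }

/-- `(e_n)` in `S` is a spreading model of the bounded sequence `(x_n)` in `X`. -/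
def IsSpreadingModel {X S : Type*} [NormedAddCommGroup X] [NormedSpace ℝ X]
    [NormedAddCommGroup S] [NormedSpace ℝ S] (x : ℕ → X) (e : ℕ → S) : Prop :=
  ∀ ε : ℝ, 0 < ε → ∀ k : ℕ, ∃ ℓ : ℕ, ∀ n : Fin k → ℕ,
    StrictMono n → (∀ i, ℓ ≤ n i) → ∀ a : Fin k → ℝ, (∀ i, |a i| ≤ 1) →
      |‖∑ i, a i • x (n i)‖ - ‖∑ i, a i • e (i : ℕ)‖| ≤ ε

namespace LpModel

section

/-- The derivative of `t ↦ |t| ^ p / p`. -/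
noncomputable def signedPow (p a : ℝ) : ℝ := |a| ^ (p - 2) * a

/-- The second order gap `(a² + b²)^{p/2} - |a|^p`. -/
noncomputable def gap (p a b : ℝ) : ℝ := (a ^ 2 + b ^ 2) ^ (p / 2) - |a| ^ p

section Scalar

variable {p : ℝ}

lemma abs_rpow_eq_sq_rpow (a : ℝ) : |a| ^ p = (a ^ 2) ^ (p / 2) := by
  rw [← sq_abs, ← Real.rpow_natCast, ← Real.rpow_mul (abs_nonneg a)]
  congr 1
  push_cast
  ring

lemma gap_nonneg (hp : 0 < p) (a b : ℝ) : 0 ≤ gap p a b := by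
  rw [gap, abs_rpow_eq_sq_rpow, sub_nonneg]
  exact Real.rpow_le_rpow (sq_nonneg a) (by nlinarith [sq_nonneg b]) (by positivity)

lemma gap_neg (a b : ℝ) : gap p a (-b) = gap p a b := by simp [gap]

lemma gap_neg_left (a b : ℝ) : gap p (-a) b = gap p a b := by simp [gap]

lemma gap_mul (t a b : ℝ) : gap p (t * a) (t * b) = |t| ^ p * gap p a b := by
  have h : (t * a) ^ 2 + (t * b) ^ 2 = t ^ 2 * (a ^ 2 + b ^ 2) := by ring
  rw [gap, gap, h, Real.mul_rpow (sq_nonneg t) (by positivity), ← abs_rpow_eq_sq_rpow, abs_mul,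
    Real.mul_rpow (abs_nonneg t) (abs_nonneg a)]
  ring

lemma signedPow_neg (a : ℝ) : signedPow p (-a) = -signedPow p a := by simp [signedPow]

lemma signedPow_of_nonneg (hp : 1 < p) {a : ℝ} (ha : 0 ≤ a) : signedPow p a = a ^ (p - 1) := by
  rcases ha.eq_or_lt with rfl | h
  · simp [signedPow, Real.zero_rpow (by linarith : p - 1 ≠ 0)]
  · rw [signedPow, abs_of_pos h, ← Real.rpow_add_one h.ne']
    congr 1
    ring

lemma abs_signedPow (hp : 1 < p) (a : ℝ) : |signedPow p a| = |a| ^ (p - 1) := by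
  rw [← signedPow_of_nonneg hp (abs_nonneg a), signedPow, signedPow, abs_mul, abs_abs,
    abs_of_nonneg (by positivity)]

/-- Tangent line bound for the concave power `x ↦ x ^ s`. -/
lemma mul_le_rpow_add_sub_rpow {s x t : ℝ} (hs0 : 0 ≤ s) (hs1 : s ≤ 1) (hx : 0 ≤ x) (ht : 0 < t) :
    s * t * (x + t) ^ (s - 1) ≤ (x + t) ^ s - x ^ s := by
  have hxt : 0 < x + t := by linarith
  have h := rpow_one_add_le_one_add_mul_self (s := -t / (x + t)) (p := s)
    (by rw [le_div_iff₀ hxt]; linarith) hs0 hs1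
  have e : 1 + -t / (x + t) = x / (x + t) := by field_simp; ring
  rw [e, Real.div_rpow hx hxt.le, div_le_iff₀ (by positivity)] at h
  rw [Real.rpow_sub_one hxt.ne']
  have : (1 + s * (-t / (x + t))) * (x + t) ^ s
      = (x + t) ^ s - s * t * ((x + t) ^ s / (x + t)) := by ring
  linarith

lemma signedPow_add_sub_le (hp1 : 1 < p) (hp2 : p < 2) (a : ℝ) {t : ℝ} (ht : 0 < t) :
    signedPow p (a + t) - signedPow p a ≤ 2 * t ^ (p - 1) := by
  have hs0 : 0 ≤ p - 1 := by linarith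
  have hs1 : p - 1 ≤ 1 := by linarith
  have htp : 0 ≤ t ^ (p - 1) := by positivity
  rcases le_total 0 a with ha | ha
  · rw [signedPow_of_nonneg hp1 ha, signedPow_of_nonneg hp1 (by linarith)]
    have := Real.rpow_add_le_add_rpow ha ht.le hs0 hs1
    linarith
  · have ea : signedPow p a = -(-a) ^ (p - 1) := by
      rw [← signedPow_of_nonneg hp1 (by linarith : 0 ≤ -a), signedPow_neg, neg_neg]
    rcases le_total 0 (a + t) with hat | hat
    · rw [ea, signedPow_of_nonneg hp1 hat]
      have h1 : (a + t) ^ (p - 1) ≤ t ^ (p - 1) := Real.rpow_le_rpow hat (by linarith) hs0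
      have h2 : (-a) ^ (p - 1) ≤ t ^ (p - 1) :=
        Real.rpow_le_rpow (by linarith) (by linarith) hs0
      linarith
    · have eat : signedPow p (a + t) = -(-(a + t)) ^ (p - 1) := by
        rw [← signedPow_of_nonneg hp1 (by linarith : 0 ≤ -(a + t)), signedPow_neg, neg_neg]
      have := Real.rpow_add_le_add_rpow (by linarith : 0 ≤ -(a + t)) ht.le hs0 hs1
      rw [show -(a + t) + t = -a by ring] at this
      rw [ea, eat]
      linarith

lemma le_signedPow_add_sub (hp1 : 1 < p) (hp2 : p < 2) (a : ℝ) {t : ℝ} (ht : 0 < t) :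
    (p - 1) / 2 * (t * (a ^ 2 + t ^ 2) ^ (p / 2 - 1)) ≤ signedPow p (a + t) - signedPow p a := by
  have hs0 : 0 ≤ p - 1 := by linarith
  have hs1 : p - 1 ≤ 1 := by linarith
  have hr : p / 2 - 1 ≤ 0 := by linarith
  have hat2 : 0 < a ^ 2 + t ^ 2 := by positivity
  have key : ∀ x : ℝ, 0 < x → (x ^ 2) ^ (p / 2 - 1) = x ^ (p - 1 - 1) := by
    intro x hx
    rw [← Real.rpow_natCast, ← Real.rpow_mul hx.le]
    congr 1
    push_cast
    ring
  rcases le_total 0 a with ha | ha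
  · rw [signedPow_of_nonneg hp1 ha, signedPow_of_nonneg hp1 (by linarith)]
    refine le_trans ?_ (mul_le_rpow_add_sub_rpow hs0 hs1 ha ht)
    have h1 : ((2:ℝ) * (a ^ 2 + t ^ 2)) ^ (p / 2 - 1) ≤ (a + t) ^ (p - 1 - 1) := by
      rw [← key _ (by linarith)]
      exact Real.rpow_le_rpow_of_nonpos (by positivity) (by nlinarith [sq_nonneg (a - t)]) hr
    rw [Real.mul_rpow (by norm_num) hat2.le] at h1
    have h2 : (1:ℝ) / 2 ≤ 2 ^ (p / 2 - 1) := by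
      rw [show (1:ℝ) / 2 = 2 ^ (-1 : ℝ) by rw [Real.rpow_neg_one]; norm_num]
      exact Real.rpow_le_rpow_of_exponent_le (by norm_num) (by linarith)
    have h3 : 1 / 2 * (a ^ 2 + t ^ 2) ^ (p / 2 - 1) ≤ (a + t) ^ (p - 1 - 1) :=
      le_trans (by gcongr) h1
    calc _ = (p - 1) * t * (1 / 2 * (a ^ 2 + t ^ 2) ^ (p / 2 - 1)) := by ring
      _ ≤ _ := by gcongr
  · have ea : signedPow p a = -(-a) ^ (p - 1) := by
      rw [← signedPow_of_nonneg hp1 (by linarith : 0 ≤ -a), signedPow_neg, neg_neg]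
    have hpos : 0 ≤ (a ^ 2 + t ^ 2) ^ (p / 2 - 1) := by positivity
    rcases lt_or_ge 0 (a + t) with hat | hat
    · rw [ea, signedPow_of_nonneg hp1 hat.le]
      have h1 := Real.rpow_add_le_add_rpow hat.le (by linarith : 0 ≤ -a) hs0 hs1
      rw [show a + t + -a = t by ring] at h1
      have h2 : (a ^ 2 + t ^ 2) ^ (p / 2 - 1) ≤ t ^ (p - 1 - 1) := by
        rw [← key _ ht]
        exact Real.rpow_le_rpow_of_nonpos (by positivity) (by nlinarith [sq_nonneg a]) hr
      have h3 : t * t ^ (p - 1 - 1) = t ^ (p - 1) := by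
        rw [Real.rpow_sub_one ht.ne']; field_simp
      have h4 : t * (a ^ 2 + t ^ 2) ^ (p / 2 - 1) ≤ t ^ (p - 1) := by
        rw [← h3]; gcongr
      have h5 : (p - 1) / 2 * (t * (a ^ 2 + t ^ 2) ^ (p / 2 - 1))
          ≤ 1 * (t * (a ^ 2 + t ^ 2) ^ (p / 2 - 1)) := by
        gcongr; linarith
      linarith
    · have eat : signedPow p (a + t) = -(-(a + t)) ^ (p - 1) := by
        rw [← signedPow_of_nonneg hp1 (by linarith : 0 ≤ -(a + t)), signedPow_neg, neg_neg]
      have h1 := mul_le_rpow_add_sub_rpow hs0 hs1 (by linarith : 0 ≤ -(a + t)) ht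
      rw [show -(a + t) + t = -a by ring] at h1
      have h2 : (a ^ 2 + t ^ 2) ^ (p / 2 - 1) ≤ (-a) ^ (p - 1 - 1) := by
        rw [← key _ (by linarith)]
        exact Real.rpow_le_rpow_of_nonpos (by nlinarith) (by nlinarith [sq_nonneg t]) hr
      have h3 : (p - 1) / 2 * (t * (a ^ 2 + t ^ 2) ^ (p / 2 - 1))
          ≤ (p - 1) * t * (-a) ^ (p - 1 - 1) := by
        calc _ ≤ (p - 1) * (t * (a ^ 2 + t ^ 2) ^ (p / 2 - 1)) := by gcongr; linarith
          _ ≤ (p - 1) * (t * (-a) ^ (p - 1 - 1)) := by gcongr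
          _ = _ := by ring
      rw [ea, eat]
      linarith

lemma hasDerivAt_abs_add_rpow (hp1 : 1 < p) (a t : ℝ) :
    HasDerivAt (fun t => |a + t| ^ p) (p * signedPow p (a + t)) t := by
  have h := hasDerivAt_abs_rpow (a + t) hp1
  have := h.comp t ((hasDerivAt_id t).const_add a)
  refine (this.congr_deriv ?_)
  rw [signedPow]
  ring

private lemma continuous_abs_add_rpow (hp1 : 1 < p) (a : ℝ) :
    Continuous (fun t : ℝ => |a + t| ^ p) :=
  continuous_iff_continuousAt.2 fun t => (hasDerivAt_abs_add_rpow hp1 a t).continuousAt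

private lemma abs_add_rpow_le_of_nonneg (hp1 : 1 < p) (hp2 : p < 2) (a : ℝ) {b : ℝ} (hb : 0 ≤ b) :
    |a + b| ^ p ≤ |a| ^ p + p * signedPow p a * b + 2 * b ^ p := by
  have hmono : MonotoneOn (fun t => 2 * t ^ p + p * signedPow p a * t - |a + t| ^ p)
      (Set.Ici (0:ℝ)) := by
    have hd : ∀ t : ℝ, 0 < t → HasDerivAt
        (fun t => 2 * t ^ p + p * signedPow p a * t - |a + t| ^ p)
        (2 * (p * t ^ (p - 1)) + p * signedPow p a - p * signedPow p (a + t)) t := by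
      intro t ht
      have h1 := (Real.hasDerivAt_rpow_const (x := t) (p := p) (Or.inl ht.ne')).const_mul 2
      have h2 := (hasDerivAt_id t).const_mul (p * signedPow p a)
      rw [mul_one] at h2
      exact (h1.add h2).sub (hasDerivAt_abs_add_rpow hp1 a t)
    refine monotoneOn_of_deriv_nonneg (convex_Ici 0) ?_ ?_ ?_
    · have h1 : Continuous (fun t : ℝ => t ^ p) := Real.continuous_rpow_const (by linarith)
      have h2 := continuous_abs_add_rpow hp1 a
      exact (((h1.const_mul 2).add (continuous_id.const_mul _)).sub h2).continuousOn
    · intro t ht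
      rw [interior_Ici] at ht
      exact (hd t ht).differentiableAt.differentiableWithinAt
    · intro t ht
      rw [interior_Ici] at ht
      rw [(hd t ht).deriv]
      nlinarith [signedPow_add_sub_le hp1 hp2 a ht]
  have := hmono (Set.mem_Ici.2 le_rfl) (Set.mem_Ici.2 hb) hb
  simp only [Real.zero_rpow (by linarith : p ≠ 0), mul_zero, add_zero] at this
  linarith

private lemma le_abs_add_rpow_of_nonneg (hp1 : 1 < p) (hp2 : p < 2) (a : ℝ) {b : ℝ} (hb : 0 ≤ b) :
    |a| ^ p + p * signedPow p a * b + (p - 1) / 2 * gap p a b ≤ |a + b| ^ p := by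
  have hmono : MonotoneOn (fun t => |a + t| ^ p - p * signedPow p a * t
      - (p - 1) / 2 * (a ^ 2 + t ^ 2) ^ (p / 2)) (Set.Ici (0:ℝ)) := by
    have hd : ∀ t : ℝ, 0 < t → HasDerivAt (fun t => |a + t| ^ p - p * signedPow p a * t
          - (p - 1) / 2 * (a ^ 2 + t ^ 2) ^ (p / 2))
        (p * signedPow p (a + t) - p * signedPow p a
          - (p - 1) / 2 * (p * (t * (a ^ 2 + t ^ 2) ^ (p / 2 - 1)))) t := by
      intro t ht
      have h2 := (hasDerivAt_id t).const_mul (p * signedPow p a)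
      rw [mul_one] at h2
      have h3 : HasDerivAt (fun t : ℝ => a ^ 2 + t ^ 2) (2 * t) t := by
        simpa using (hasDerivAt_pow 2 t).const_add (a ^ 2)
      have h4 := (h3.rpow_const (p := p / 2) (Or.inl (by positivity))).const_mul ((p - 1) / 2)
      refine (((hasDerivAt_abs_add_rpow hp1 a t).sub h2).sub h4).congr_deriv ?_
      ring
    refine monotoneOn_of_deriv_nonneg (convex_Ici 0) ?_ ?_ ?_
    · have h1 : Continuous (fun t : ℝ => (a ^ 2 + t ^ 2) ^ (p / 2)) :=
        (Real.continuous_rpow_const (by linarith)).comp (by fun_prop)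
      have h2 := continuous_abs_add_rpow hp1 a
      exact ((h2.sub (continuous_id.const_mul _)).sub (h1.const_mul _)).continuousOn
    · intro t ht
      rw [interior_Ici] at ht
      exact (hd t ht).differentiableAt.differentiableWithinAt
    · intro t ht
      rw [interior_Ici] at ht
      rw [(hd t ht).deriv]
      nlinarith [le_signedPow_add_sub hp1 hp2 a ht]
  have := hmono (Set.mem_Ici.2 le_rfl) (Set.mem_Ici.2 hb) hb
  simp only [mul_zero, add_zero, ne_eq, OfNat.ofNat_ne_zero, not_false_eq_true, zero_pow,
    ← abs_rpow_eq_sq_rpow] at this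
  rw [gap]
  linarith

theorem abs_add_rpow_le (hp1 : 1 < p) (hp2 : p < 2) (a b : ℝ) :
    |a + b| ^ p ≤ |a| ^ p + p * signedPow p a * b + 2 * |b| ^ p := by
  rcases le_total 0 b with hb | hb
  · rw [abs_of_nonneg hb]
    exact abs_add_rpow_le_of_nonneg hp1 hp2 a hb
  · have h := abs_add_rpow_le_of_nonneg hp1 hp2 (-a) (neg_nonneg.2 hb)
    rw [← neg_add, abs_neg, abs_neg, signedPow_neg] at h
    rw [abs_of_nonpos hb]
    linarith

theorem le_abs_add_rpow (hp1 : 1 < p) (hp2 : p < 2) (a b : ℝ) :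
    |a| ^ p + p * signedPow p a * b + (p - 1) / 2 * gap p a b ≤ |a + b| ^ p := by
  rcases le_total 0 b with hb | hb
  · exact le_abs_add_rpow_of_nonneg hp1 hp2 a hb
  · have h := le_abs_add_rpow_of_nonneg hp1 hp2 (-a) (neg_nonneg.2 hb)
    rw [← neg_add, abs_neg, abs_neg, signedPow_neg, gap_neg, gap_neg_left] at h
    linarith

/-- Increments of a concave power decrease. -/
lemma rpow_add_add_le {r x s t : ℝ} (hr0 : 0 ≤ r) (hr1 : r ≤ 1) (hx : 0 ≤ x) (hs : 0 ≤ s)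
    (ht : 0 ≤ t) : (x + s + t) ^ r + x ^ r ≤ (x + s) ^ r + (x + t) ^ r := by
  rcases (add_nonneg hs ht).eq_or_lt with h | h
  · obtain rfl : s = 0 := by linarith
    obtain rfl : t = 0 := by linarith
    simp
  have hc := Real.concaveOn_rpow hr0 hr1
  have hst : s / (s + t) + t / (s + t) = 1 := by rw [← add_div, div_self h.ne']
  have hs' : 0 ≤ s / (s + t) := by positivity
  have ht' : 0 ≤ t / (s + t) := by positivity
  have hm : x + s + t ∈ Set.Ici (0:ℝ) := Set.mem_Ici.2 (by linarith)
  have h1 := hc.2 hm (Set.mem_Ici.2 hx) hs' ht' hst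
  have h2 := hc.2 hm (Set.mem_Ici.2 hx) ht' hs' (by rw [add_comm]; exact hst)
  simp only [smul_eq_mul] at h1 h2
  have e1 : s / (s + t) * (x + s + t) + t / (s + t) * x = x + s := by field_simp; ring
  have e2 : t / (s + t) * (x + s + t) + s / (s + t) * x = x + t := by field_simp; ring
  rw [e1] at h1
  rw [e2] at h2
  have h3 : (s / (s + t) + t / (s + t)) * ((x + s + t) ^ r + x ^ r)
      = (s / (s + t) * (x + s + t) ^ r + t / (s + t) * x ^ r)
        + (t / (s + t) * (x + s + t) ^ r + s / (s + t) * x ^ r) := by ring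
  rw [hst, one_mul] at h3
  linarith

lemma sq_add_sum_rpow_le (hp0 : 0 < p) (hp2 : p < 2) (a : ℝ) {α : Type*} (b : α → ℝ) :
    ∀ l : List α, (a ^ 2 + (l.map fun y => b y ^ 2).sum) ^ (p / 2)
      ≤ |a| ^ p + (l.map fun y => gap p a (b y)).sum
  | [] => by simp [abs_rpow_eq_sq_rpow]
  | y :: l => by
    have ih := sq_add_sum_rpow_le hp0 hp2 a b l
    have hl : 0 ≤ (l.map fun y => b y ^ 2).sum :=
      List.sum_nonneg (by simp only [List.mem_map]; rintro _ ⟨z, -, rfl⟩; positivity)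
    have h := rpow_add_add_le (r := p / 2) (by linarith) (by linarith) (sq_nonneg a)
      (sq_nonneg (b y)) hl
    simp only [List.map_cons, List.sum_cons]
    rw [← abs_rpow_eq_sq_rpow] at h
    rw [gap, ← add_assoc]
    linarith

lemma rpow_midpoint_le {r x y : ℝ} (hr0 : 0 ≤ r) (hr1 : r ≤ 1) (hx : 0 ≤ x) (hy : 0 ≤ y) :
    (x ^ r + y ^ r) / 2 ≤ ((x + y) / 2) ^ r := by
  have := (Real.concaveOn_rpow hr0 hr1).2 (Set.mem_Ici.2 hx) (Set.mem_Ici.2 hy)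
    (by norm_num : (0:ℝ) ≤ 1 / 2) (by norm_num : (0:ℝ) ≤ 1 / 2) (by norm_num)
  simp only [smul_eq_mul] at this
  rw [show (x + y) / 2 = 1 / 2 * x + 1 / 2 * y by ring]
  linarith

end Scalar

end

section

section Ultralimit

variable {ι : Type*} (U : Ultrafilter ι)

lemma exists_tendsto_of_bounded {u : ι → ℝ} {C : ℝ} (h : ∀ᶠ i in (U : Filter ι), |u i| ≤ C) :
    ∃ a, Tendsto u U (nhds a) := by
  have hm : ((U.map u : Ultrafilter ℝ) : Filter ℝ) ≤ Filter.principal (Set.Icc (-C) C) := by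
    rw [Filter.le_principal_iff, Ultrafilter.coe_map, Filter.mem_map]
    exact h.mono fun i hi => abs_le.1 hi
  obtain ⟨a, -, ha⟩ := (isCompact_Icc (a := -C) (b := C)).ultrafilter_le_nhds _ hm
  exact ⟨a, ha⟩

/-- The limit of a bounded real family along an ultrafilter. -/
noncomputable def ulim (u : ι → ℝ) : ℝ := limUnder (U : Filter ι) u

lemma tendsto_ulim {u : ι → ℝ} {C : ℝ} (h : ∀ᶠ i in (U : Filter ι), |u i| ≤ C) :
    Tendsto u U (nhds (ulim U u)) := tendsto_nhds_limUnder (exists_tendsto_of_bounded U h)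

end Ultralimit

section SignAverage

variable {X : Type*} [AddCommGroup X]

/-- The average of `F` over all signed sums of the vectors of a list. -/
noncomputable def signAvg : List X → (X → ℝ) → ℝ
  | [], F => F 0
  | y :: l, F => signAvg l fun z => (F (z + y) + F (z - y)) / 2

lemma signAvg_mono (l : List X) {F G : X → ℝ} (h : ∀ z, F z ≤ G z) :
    signAvg l F ≤ signAvg l G := by
  induction l generalizing F G with
  | nil => exact h 0
  | cons y l ih => exact ih fun z => by linarith [h (z + y), h (z - y)]

lemma signAvg_add_const (l : List X) (F : X → ℝ) (c : ℝ) :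
    signAvg l (fun z => F z + c) = signAvg l F + c := by
  induction l generalizing F with
  | nil => rfl
  | cons y l ih =>
    simp only [signAvg]
    rw [← ih]
    congr 1
    ext z
    ring

lemma signAvg_const_mul (l : List X) (F : X → ℝ) (c : ℝ) :
    signAvg l (fun z => c * F z) = c * signAvg l F := by
  induction l generalizing F with
  | nil => rfl
  | cons y l ih =>
    simp only [signAvg]
    rw [← ih]
    congr 1
    ext z
    ring

lemma tendsto_signAvg {ι : Type*} {𝓕 : Filter ι} (l : List X) {F : ι → X → ℝ} {G : X → ℝ}
    (h : ∀ z, Tendsto (fun i => F i z) 𝓕 (nhds (G z))) :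
    Tendsto (fun i => signAvg l (F i)) 𝓕 (nhds (signAvg l G)) := by
  induction l generalizing F G with
  | nil => exact h 0
  | cons y l ih => exact ih fun z => ((h (z + y)).add (h (z - y))).div_const 2

lemma signAvg_sum_rpow_le [Module ℝ X] {r : ℝ} (hr0 : 0 ≤ r) (hr1 : r ≤ 1) {κ : Type*} [Fintype κ]
    (t : X →ₗ[ℝ] (κ → ℝ)) (l : List X) (A : κ → ℝ) (hA : ∀ i, 0 ≤ A i) :
    signAvg l (fun z => ∑ i, (A i + t z i ^ 2) ^ r)
      ≤ ∑ i, (A i + (l.map fun y => t y i ^ 2).sum) ^ r := by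
  induction l generalizing A with
  | nil => simp [signAvg]
  | cons y l ih =>
    refine le_trans (signAvg_mono l (G := fun z => ∑ i, ((A i + t y i ^ 2) + t z i ^ 2) ^ r) ?_) ?_
    · intro z
      rw [← Finset.sum_add_distrib, Finset.sum_div]
      refine Finset.sum_le_sum fun i _ => ?_
      refine (rpow_midpoint_le hr0 hr1 (add_nonneg (hA i) (sq_nonneg _))
        (add_nonneg (hA i) (sq_nonneg _))).trans (le_of_eq ?_)
      congr 1
      simp only [map_add, map_sub, Pi.add_apply, Pi.sub_apply]
      ring
    · refine (ih _ fun i => add_nonneg (hA i) (sq_nonneg _)).trans (le_of_eq ?_)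
      simp [add_assoc]

end SignAverage

/-- A family of finite-dimensional `ℓ_p` coordinate systems adapted to the finite subsets of `X`:
`coord s` is a `lam`-isomorphism on the span of `s`, inverted there by the contraction `lift s`. -/
structure LocalCoord (p lam : ℝ) (X : Type*) [NormedAddCommGroup X] [NormedSpace ℝ X] where
  dim : Finset X → ℕ
  coord : ∀ s, X →ₗ[ℝ] (Fin (dim s) → ℝ)
  lift : ∀ s, (Fin (dim s) → ℝ) →ₗ[ℝ] X
  norm_le : ∀ s : Finset X, ∀ x ∈ Submodule.span ℝ (s : Set X), ‖x‖ ^ p ≤ ∑ i, |coord s x i| ^ p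
  sum_le : ∀ s : Finset X, ∀ x ∈ Submodule.span ℝ (s : Set X),
    ∑ i, |coord s x i| ^ p ≤ lam ^ p * ‖x‖ ^ p
  norm_lift : ∀ s y, ‖lift s y‖ ^ p ≤ ∑ i, |y i| ^ p
  lift_coord : ∀ s : Finset X, ∀ x ∈ Submodule.span ℝ (s : Set X), lift s (coord s x) = x

/-- A `p`-homogeneous equivalent of `‖·‖ ^ p` with two sided second order expansions and the
square function estimates of `L_p`. -/
structure SmoothModel (p : ℝ) (X : Type*) [NormedAddCommGroup X] [NormedSpace ℝ X] where
  Φ : X → ℝ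
  Ω : X → X → ℝ
  deriv : X → X →L[ℝ] ℝ
  bound : ℝ
  norm_le : ∀ x, ‖x‖ ^ p ≤ Φ x
  le_norm : ∀ x, Φ x ≤ bound * ‖x‖ ^ p
  upper : ∀ x h, Φ (x + h) ≤ Φ x + deriv x h + 2 * Φ h
  lower : ∀ x h, Φ x + deriv x h + (p - 1) / 2 * Ω x h ≤ Φ (x + h)
  gap_nonneg : ∀ x h, 0 ≤ Ω x h
  signAvg_le : ∀ u l, signAvg l Φ ≤ Φ u + (l.map (Ω u)).sum
  pow_mul_le : ∀ (k : ℕ) m h, (k : ℝ) ^ (p / 2) * Φ h ≤ Φ m + k * Ω m h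
  Φ_smul : ∀ (t : ℝ) x, Φ (t • x) = |t| ^ p * Φ x
  Ω_smul : ∀ (t : ℝ) x h, Ω (t • x) (t • h) = |t| ^ p * Ω x h

variable {X : Type*} [NormedAddCommGroup X] [NormedSpace ℝ X]

/-- An ultrafilter on the finite subsets of `X` containing all the sets `{s | x ∈ s}`. -/
noncomputable def finsetUltra (X : Type*) : Ultrafilter (Finset X) :=
  Ultrafilter.of (atTop : Filter (Finset X))

lemma eventually_mem_finsetUltra {Y : Type*} (x : Y) :
    ∀ᶠ s in (finsetUltra Y : Filter (Finset Y)), x ∈ s := by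
  classical
  refine Ultrafilter.of_le (atTop : Filter (Finset Y)) ?_
  exact (eventually_ge_atTop {x}).mono fun s hs => hs (Finset.mem_singleton_self x)

namespace LocalCoord

variable {p lam : ℝ} (𝒞 : LocalCoord p lam X)

lemma eventually_mem_span (x : X) : ∀ᶠ s : Finset X in finsetUltra X,
    x ∈ Submodule.span ℝ (s : Set X) :=
  (eventually_mem_finsetUltra x).mono fun _ hs => Submodule.subset_span hs

/-- The `p`-th power of the norm of the coordinates. -/
noncomputable def energy (s : Finset X) (x : X) : ℝ := ∑ i, |𝒞.coord s x i| ^ p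

lemma energy_nonneg (s : Finset X) (x : X) : 0 ≤ 𝒞.energy s x :=
  Finset.sum_nonneg fun _ _ => by positivity

noncomputable def gapSum (s : Finset X) (x h : X) : ℝ :=
  ∑ i, gap p (𝒞.coord s x i) (𝒞.coord s h i)

noncomputable def pairing (s : Finset X) (x : X) : X →ₗ[ℝ] ℝ :=
  ∑ i, (p * signedPow p (𝒞.coord s x i)) • (LinearMap.proj i ∘ₗ 𝒞.coord s)

lemma pairing_apply (s : Finset X) (x h : X) :
    𝒞.pairing s x h = ∑ i, p * signedPow p (𝒞.coord s x i) * 𝒞.coord s h i := by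
  simp [pairing]

lemma energy_upper (hp1 : 1 < p) (hp2 : p < 2) (s : Finset X) (x h : X) :
    𝒞.energy s (x + h) ≤ 𝒞.energy s x + 𝒞.pairing s x h + 2 * 𝒞.energy s h := by
  rw [pairing_apply, energy, energy, energy, Finset.mul_sum, ← Finset.sum_add_distrib,
    ← Finset.sum_add_distrib]
  refine Finset.sum_le_sum fun i _ => ?_
  rw [map_add]
  exact abs_add_rpow_le hp1 hp2 _ _

lemma energy_lower (hp1 : 1 < p) (hp2 : p < 2) (s : Finset X) (x h : X) :
    𝒞.energy s x + 𝒞.pairing s x h + (p - 1) / 2 * 𝒞.gapSum s x h ≤ 𝒞.energy s (x + h) := by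
  rw [pairing_apply, energy, energy, gapSum, Finset.mul_sum, ← Finset.sum_add_distrib,
    ← Finset.sum_add_distrib]
  refine Finset.sum_le_sum fun i _ => ?_
  rw [map_add]
  exact le_abs_add_rpow hp1 hp2 _ _

lemma gapSum_nonneg (hp : 0 < p) (s : Finset X) (x h : X) : 0 ≤ 𝒞.gapSum s x h :=
  Finset.sum_nonneg fun _ _ => LpModel.gap_nonneg hp _ _

lemma energy_smul (s : Finset X) (t : ℝ) (x : X) :
    𝒞.energy s (t • x) = |t| ^ p * 𝒞.energy s x := by
  simp only [energy, map_smul, Pi.smul_apply, smul_eq_mul, abs_mul, Finset.mul_sum]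
  exact Finset.sum_congr rfl fun i _ => Real.mul_rpow (abs_nonneg _) (abs_nonneg _)

lemma gapSum_smul (s : Finset X) (t : ℝ) (x h : X) :
    𝒞.gapSum s (t • x) (t • h) = |t| ^ p * 𝒞.gapSum s x h := by
  simp only [gapSum, map_smul, Pi.smul_apply, smul_eq_mul, gap_mul, Finset.mul_sum]

lemma sum_sq_rpow_le (hp0 : 0 < p) (hp2 : p < 2) (s : Finset X) (u : X) (l : List X) :
    ∑ i, (𝒞.coord s u i ^ 2 + (l.map fun y => 𝒞.coord s y i ^ 2).sum) ^ (p / 2)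
      ≤ 𝒞.energy s u + (l.map (𝒞.gapSum s u)).sum := by
  have h : ∀ l : List X, (l.map (𝒞.gapSum s u)).sum
      = ∑ i, (l.map fun y => gap p (𝒞.coord s u i) (𝒞.coord s y i)).sum := by
    intro l
    induction l with
    | nil => simp
    | cons y l ih => simp [ih, Finset.sum_add_distrib, gapSum]
  rw [h, energy, ← Finset.sum_add_distrib]
  exact Finset.sum_le_sum fun i _ => sq_add_sum_rpow_le hp0 hp2 _ _ l

lemma signAvg_energy_le (hp1 : 1 < p) (hp2 : p < 2) (s : Finset X) (u : X) (l : List X) :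
    signAvg l (𝒞.energy s) ≤ 𝒞.energy s u + (l.map (𝒞.gapSum s u)).sum := by
  refine le_trans ?_ (𝒞.sum_sq_rpow_le (by linarith) hp2 s u l)
  have h := signAvg_sum_rpow_le (r := p / 2) (by linarith) (by linarith) (𝒞.coord s) l
    (fun _ => 0) (fun _ => le_rfl)
  have e : 𝒞.energy s = fun z => ∑ i, (0 + 𝒞.coord s z i ^ 2) ^ (p / 2) := by
    ext z
    simp [energy, abs_rpow_eq_sq_rpow]
  rw [e]
  refine h.trans (Finset.sum_le_sum fun i _ => ?_)
  have hl : 0 ≤ (l.map fun y => 𝒞.coord s y i ^ 2).sum :=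
    List.sum_nonneg (by simp only [List.mem_map]; rintro _ ⟨z, -, rfl⟩; positivity)
  refine Real.rpow_le_rpow (by linarith) ?_ (by linarith)
  have := sq_nonneg (𝒞.coord s u i)
  linarith

lemma pow_mul_energy_le (hp1 : 1 < p) (hp2 : p < 2) (s : Finset X) (k : ℕ) (m h : X) :
    (k : ℝ) ^ (p / 2) * 𝒞.energy s h ≤ 𝒞.energy s m + k * 𝒞.gapSum s m h := by
  have := 𝒞.sum_sq_rpow_le (by linarith) hp2 s m (List.replicate k h)
  simp only [List.map_replicate, List.sum_replicate, nsmul_eq_mul] at this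
  refine le_trans ?_ this
  rw [energy, Finset.mul_sum]
  refine Finset.sum_le_sum fun i _ => ?_
  rw [abs_rpow_eq_sq_rpow, ← Real.mul_rpow (by positivity) (sq_nonneg _)]
  exact Real.rpow_le_rpow (by positivity) (by linarith [sq_nonneg (𝒞.coord s m i)]) (by linarith)

lemma abs_energy_le (x : X) : ∀ᶠ s in (finsetUltra X : Filter (Finset X)),
    |𝒞.energy s x| ≤ lam ^ p * ‖x‖ ^ p :=
  (eventually_mem_span x).mono fun s hs => by
    rw [abs_of_nonneg (𝒞.energy_nonneg s x)]
    exact 𝒞.sum_le s x hs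

lemma pairing_le (hp1 : 1 < p) (hp2 : p < 2) {s : Finset X} {x h : X}
    (hx : x ∈ Submodule.span ℝ (s : Set X)) (hh : h ∈ Submodule.span ℝ (s : Set X)) :
    𝒞.pairing s x h ≤ |lam ^ p| * (‖x‖ + ‖h‖) ^ p := by
  have h1 := 𝒞.energy_lower hp1 hp2 s x h
  have h2 := 𝒞.gapSum_nonneg (by linarith) s x h
  have h3 := 𝒞.energy_nonneg s x
  have h4 := 𝒞.sum_le s (x + h) (Submodule.add_mem _ hx hh)
  have h5 : ‖x + h‖ ^ p ≤ (‖x‖ + ‖h‖) ^ p :=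
    Real.rpow_le_rpow (norm_nonneg _) (norm_add_le _ _) (by linarith)
  have h6 : lam ^ p * ‖x + h‖ ^ p ≤ |lam ^ p| * (‖x‖ + ‖h‖) ^ p :=
    mul_le_mul (le_abs_self _) h5 (by positivity) (abs_nonneg _)
  have h7 : 0 ≤ (p - 1) / 2 * 𝒞.gapSum s x h := mul_nonneg (by linarith) h2
  rw [← energy] at h4
  linarith

lemma abs_pairing_le (hp1 : 1 < p) (hp2 : p < 2) (x h : X) :
    ∀ᶠ s in (finsetUltra X : Filter (Finset X)),
      |𝒞.pairing s x h| ≤ |lam ^ p| * (‖x‖ + ‖h‖) ^ p := by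
  filter_upwards [eventually_mem_span x, eventually_mem_span h] with s hx hh
  refine abs_le'.2 ⟨𝒞.pairing_le hp1 hp2 hx hh, ?_⟩
  have := 𝒞.pairing_le hp1 hp2 hx (Submodule.neg_mem _ hh)
  rwa [map_neg, norm_neg] at this

lemma abs_gapSum_le (hp1 : 1 < p) (hp2 : p < 2) (x h : X) :
    ∃ C, ∀ᶠ s in (finsetUltra X : Filter (Finset X)), |𝒞.gapSum s x h| ≤ C := by
  refine ⟨2 / (p - 1) * (lam ^ p * ‖x + h‖ ^ p + |lam ^ p| * (‖x‖ + ‖h‖) ^ p), ?_⟩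
  filter_upwards [𝒞.abs_energy_le (x + h), 𝒞.abs_pairing_le hp1 hp2 x h] with s h1 h2
  rw [abs_of_nonneg (𝒞.gapSum_nonneg (by linarith) s x h)]
  have h3 := 𝒞.energy_lower hp1 hp2 s x h
  have h4 := 𝒞.energy_nonneg s x
  have h5 := (abs_le.1 h2).1
  have h6 := (abs_le.1 h1).2
  have hp : 0 < p - 1 := by linarith
  rw [div_mul_eq_mul_div, le_div_iff₀ hp]
  linarith

/-- The limit of the pairings along `finsetUltra`. -/
noncomputable def limPairing (hp1 : 1 < p) (hp2 : p < 2) (x : X) : X →L[ℝ] ℝ :=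
  LinearMap.mkContinuousOfExistsBound
    { toFun := fun h => ulim (finsetUltra X) fun s => 𝒞.pairing s x h
      map_add' := fun h h' => by
        refine tendsto_nhds_unique (tendsto_ulim _ (𝒞.abs_pairing_le hp1 hp2 x (h + h'))) ?_
        simp only [map_add]
        exact (tendsto_ulim _ (𝒞.abs_pairing_le hp1 hp2 x h)).add
          (tendsto_ulim _ (𝒞.abs_pairing_le hp1 hp2 x h'))
      map_smul' := fun t h => by
        refine tendsto_nhds_unique (tendsto_ulim _ (𝒞.abs_pairing_le hp1 hp2 x (t • h))) ?_
        simp only [map_smul]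
        exact (tendsto_ulim _ (𝒞.abs_pairing_le hp1 hp2 x h)).const_smul t }
    (by
      refine ⟨|lam ^ p| * (‖x‖ + 1) ^ p, fun h => ?_⟩
      have hb := tendsto_ulim _ (𝒞.abs_pairing_le hp1 hp2 x h)
      refine le_of_tendsto hb.norm ?_
      filter_upwards [𝒞.abs_pairing_le hp1 hp2 x (‖h‖⁻¹ • h)] with s hs
      rcases eq_or_ne h 0 with rfl | h0
      · simp
      · have hn : 0 < ‖h‖ := norm_pos_iff.2 h0
        rw [norm_smul, norm_inv, norm_norm, inv_mul_cancel₀ hn.ne', map_smul, smul_eq_mul, abs_mul,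
          abs_of_pos (inv_pos.2 hn), inv_mul_le_iff₀ hn, mul_comm] at hs
        rwa [Real.norm_eq_abs])

lemma tendsto_limPairing (hp1 : 1 < p) (hp2 : p < 2) (x h : X) :
    Tendsto (fun s => 𝒞.pairing s x h) (finsetUltra X) (nhds (𝒞.limPairing hp1 hp2 x h)) :=
  tendsto_ulim _ (𝒞.abs_pairing_le hp1 hp2 x h)

/-- The limit of the local models of `X`. -/
noncomputable def smoothModel (hp1 : 1 < p) (hp2 : p < 2) : SmoothModel p X where
  Φ x := ulim (finsetUltra X) fun s => 𝒞.energy s x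
  Ω x h := ulim (finsetUltra X) fun s => 𝒞.gapSum s x h
  deriv := 𝒞.limPairing hp1 hp2
  bound := lam ^ p
  norm_le x := ge_of_tendsto (tendsto_ulim _ (𝒞.abs_energy_le x))
    ((eventually_mem_span x).mono fun s hs => 𝒞.norm_le s x hs)
  le_norm x := le_of_tendsto (tendsto_ulim _ (𝒞.abs_energy_le x))
    ((eventually_mem_span x).mono fun s hs => 𝒞.sum_le s x hs)
  upper x h := le_of_tendsto_of_tendsto' (tendsto_ulim _ (𝒞.abs_energy_le (x + h)))
    (((tendsto_ulim _ (𝒞.abs_energy_le x)).add (𝒞.tendsto_limPairing hp1 hp2 x h)).add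
      ((tendsto_ulim _ (𝒞.abs_energy_le h)).const_mul 2))
    fun s => 𝒞.energy_upper hp1 hp2 s x h
  lower x h := by
    obtain ⟨C, hC⟩ := 𝒞.abs_gapSum_le hp1 hp2 x h
    exact le_of_tendsto_of_tendsto'
      (((tendsto_ulim _ (𝒞.abs_energy_le x)).add (𝒞.tendsto_limPairing hp1 hp2 x h)).add
        ((tendsto_ulim _ hC).const_mul _)) (tendsto_ulim _ (𝒞.abs_energy_le (x + h)))
      fun s => 𝒞.energy_lower hp1 hp2 s x h
  gap_nonneg x h := by
    obtain ⟨C, hC⟩ := 𝒞.abs_gapSum_le hp1 hp2 x h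
    exact ge_of_tendsto' (tendsto_ulim _ hC) fun s => 𝒞.gapSum_nonneg (by linarith) s x h
  signAvg_le u l := by
    have hl : Tendsto (fun s => (l.map (𝒞.gapSum s u)).sum) (finsetUltra X)
        (nhds (l.map fun h => ulim (finsetUltra X) fun s => 𝒞.gapSum s u h).sum) := by
      induction l with
      | nil => simp
      | cons y l ih =>
        obtain ⟨C, hC⟩ := 𝒞.abs_gapSum_le hp1 hp2 u y
        simpa using (tendsto_ulim _ hC).add ih
    exact le_of_tendsto_of_tendsto'
      (tendsto_signAvg l fun z => tendsto_ulim _ (𝒞.abs_energy_le z))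
      ((tendsto_ulim _ (𝒞.abs_energy_le u)).add hl)
      fun s => 𝒞.signAvg_energy_le hp1 hp2 s u l
  pow_mul_le k m h := by
    obtain ⟨C, hC⟩ := 𝒞.abs_gapSum_le hp1 hp2 m h
    exact le_of_tendsto_of_tendsto' ((tendsto_ulim _ (𝒞.abs_energy_le h)).const_mul _)
      ((tendsto_ulim _ (𝒞.abs_energy_le m)).add ((tendsto_ulim _ hC).const_mul _))
      fun s => 𝒞.pow_mul_energy_le hp1 hp2 s k m h
  Φ_smul t x := by
    refine tendsto_nhds_unique (tendsto_ulim _ (𝒞.abs_energy_le (t • x))) ?_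
    simp only [energy_smul]
    exact (tendsto_ulim _ (𝒞.abs_energy_le x)).const_mul _
  Ω_smul t x h := by
    obtain ⟨C, hC⟩ := 𝒞.abs_gapSum_le hp1 hp2 x h
    obtain ⟨C', hC'⟩ := 𝒞.abs_gapSum_le hp1 hp2 (t • x) (t • h)
    refine tendsto_nhds_unique (tendsto_ulim _ hC') ?_
    simp only [gapSum_smul]
    exact (tendsto_ulim _ hC).const_mul _

end LocalCoord

/-- An `𝓛_p`-space has local coordinates. -/
theorem exists_localCoord {p : ℝ} (hp1 : 1 < p) [Fact (1 ≤ ENNReal.ofReal p)] {lam : ℝ}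
    (hLp : ∀ E : Subspace ℝ X, FiniteDimensional ℝ E →
      ∃ F : Subspace ℝ X, FiniteDimensional ℝ F ∧ E ≤ F ∧
        ∃ (n : ℕ) (T : F ≃L[ℝ] PiLp (ENNReal.ofReal p) (fun _ : Fin n => ℝ)),
          ‖(T : F →L[ℝ] PiLp (ENNReal.ofReal p) (fun _ : Fin n => ℝ))‖ *
            ‖(T.symm : PiLp (ENNReal.ofReal p) (fun _ : Fin n => ℝ) →L[ℝ] F)‖ ≤ lam) :
    Nonempty (LocalCoord p lam X) := by
  have key : ∀ s : Finset X, ∃ (n : ℕ) (t : X →ₗ[ℝ] (Fin n → ℝ)) (S : (Fin n → ℝ) →ₗ[ℝ] X),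
      (∀ x ∈ Submodule.span ℝ (s : Set X), ‖x‖ ^ p ≤ ∑ i, |t x i| ^ p) ∧
      (∀ x ∈ Submodule.span ℝ (s : Set X), ∑ i, |t x i| ^ p ≤ lam ^ p * ‖x‖ ^ p) ∧
      (∀ y, ‖S y‖ ^ p ≤ ∑ i, |y i| ^ p) ∧
      (∀ x ∈ Submodule.span ℝ (s : Set X), S (t x) = x) := by
    intro s
    obtain ⟨F, hF, hEF, n, T, hT⟩ := hLp (Submodule.span ℝ (s : Set X))
      (FiniteDimensional.span_finset ℝ s)
    have hp0 : 0 < p := by linarith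
    have hto : (ENNReal.ofReal p).toReal = p := ENNReal.toReal_ofReal hp0.le
    have hnorm : ∀ y : PiLp (ENNReal.ofReal p) (fun _ : Fin n => ℝ),
        ‖y‖ ^ p = ∑ i, |y i| ^ p := by
      intro y
      rw [PiLp.norm_eq_sum (by rw [hto]; exact hp0), hto,
        ← Real.rpow_mul (Finset.sum_nonneg fun _ _ => by positivity),
        one_div_mul_cancel hp0.ne', Real.rpow_one]
      rfl
    set c := ‖(T.symm : PiLp (ENNReal.ofReal p) (fun _ : Fin n => ℝ) →L[ℝ] F)‖ with hc
    have hc0 : 0 ≤ c := ContinuousLinearMap.opNorm_nonneg _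
    have hsymm : ∀ y, ‖T.symm y‖ ≤ c * ‖y‖ := fun y =>
      (T.symm : PiLp (ENNReal.ofReal p) (fun _ : Fin n => ℝ) →L[ℝ] F).le_opNorm y
    set W := WithLp.linearEquiv (ENNReal.ofReal p) ℝ (Fin n → ℝ)
    obtain ⟨t, ht⟩ := LinearMap.exists_extend (c • (W.toLinearMap ∘ₗ T.toLinearEquiv.toLinearMap))
    have ht' : ∀ x : F, ∀ i, t x i = (c • T x) i := fun x i =>
      congrFun (LinearMap.congr_fun ht x) i
    have htx : ∀ x : F, t x = W (c • T x) := fun x => LinearMap.congr_fun ht x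
    have hsum : ∀ x : F, ∑ i, |t x i| ^ p = ‖c • T x‖ ^ p := fun x => by
      rw [hnorm]
      simp only [ht']
    refine ⟨n, t, c⁻¹ • (F.subtype ∘ₗ T.symm.toLinearEquiv.toLinearMap ∘ₗ W.symm.toLinearMap),
      ?_, ?_, ?_, ?_⟩
    · intro x hx
      rw [hsum ⟨x, hEF hx⟩, norm_smul, Real.norm_of_nonneg hc0]
      refine Real.rpow_le_rpow (norm_nonneg _) ?_ hp0.le
      have := hsymm (T ⟨x, hEF hx⟩)
      rwa [T.symm_apply_apply] at this
    · intro x hx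
      rw [hsum ⟨x, hEF hx⟩, norm_smul, Real.norm_of_nonneg hc0,
        ← Real.mul_rpow (le_trans (by positivity) hT) (norm_nonneg _)]
      refine Real.rpow_le_rpow (by positivity) ?_ hp0.le
      have := (T : F →L[ℝ] PiLp (ENNReal.ofReal p) (fun _ : Fin n => ℝ)).le_opNorm ⟨x, hEF hx⟩
      calc c * ‖T ⟨x, hEF hx⟩‖ ≤ c * (_ * ‖x‖) := mul_le_mul_of_nonneg_left this hc0
        _ = (_ * c) * ‖x‖ := by ring
        _ ≤ lam * ‖x‖ := mul_le_mul_of_nonneg_right hT (norm_nonneg _)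
    · intro y
      have h1 : ∑ i, |y i| ^ p = ‖W.symm y‖ ^ p := (hnorm (W.symm y)).symm
      rw [h1]
      refine Real.rpow_le_rpow (norm_nonneg _) ?_ hp0.le
      have h2 := hsymm (W.symm y)
      change ‖c⁻¹ • ((T.symm (W.symm y) : F) : X)‖ ≤ _
      rw [norm_smul, norm_inv, Real.norm_of_nonneg hc0]
      rcases hc0.eq_or_lt with h0 | h0
      · rw [← h0]
        simp
      · rw [inv_mul_le_iff₀ h0]
        exact h2
    · intro x hx
      change c⁻¹ • ((T.symm (W.symm (t x)) : F) : X) = x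
      rw [htx ⟨x, hEF hx⟩, LinearEquiv.symm_apply_apply, map_smul, T.symm_apply_apply]
      change c⁻¹ • (c • x) = x
      rcases hc0.eq_or_lt with h0 | h0
      · have := hsymm (T ⟨x, hEF hx⟩)
        rw [T.symm_apply_apply, ← h0, zero_mul] at this
        have hx0 : x = 0 := by simpa using this
        simp [hx0]
      · rw [inv_smul_smul₀ h0.ne']
  choose n t S h1 h2 h3 h4 using key
  exact ⟨⟨n, t, S, h1, h2, h3, h4⟩⟩

end

section

variable {X : Type*} [NormedAddCommGroup X] [NormedSpace ℝ X]

namespace SmoothModel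

variable {p : ℝ}

lemma Φ_nonneg (M : SmoothModel p X) (x : X) : 0 ≤ M.Φ x := le_trans (by positivity) (M.norm_le x)

lemma Φ_zero (M : SmoothModel p X) (hp : 1 < p) : M.Φ 0 = 0 := by
  have := M.Φ_smul 0 0
  rwa [abs_zero, Real.zero_rpow (by linarith), zero_mul, smul_zero] at this

lemma two_mul_add_le (M : SmoothModel p X) (hp1 : 1 < p) (m h : X) :
    2 * M.Φ m + (p - 1) / 2 * M.Ω m h ≤ M.Φ (m + h) + M.Φ (m - h) := by
  have h1 := M.lower m h
  have h2 := M.lower m (-h)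
  rw [map_neg, ← sub_eq_add_neg m] at h2
  have h3 : 0 ≤ (p - 1) / 2 * M.Ω m (-h) := mul_nonneg (by linarith) (M.gap_nonneg m _)
  linarith

/-- Uniform convexity of `Φ`. -/
lemma exists_uniform_convexity (M : SmoothModel p X) (hp1 : 1 < p) (S : ℝ) {ε : ℝ} (hε : 0 < ε) :
    ∃ δ > 0, ∀ z w : X, M.Φ z ≤ S + δ → M.Φ w ≤ S + δ →
      S - δ ≤ M.Φ ((1 / 2 : ℝ) • (z + w)) → ‖z - w‖ ≤ ε := by
  have hp0 : 0 < p := by linarith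
  have ht : Tendsto (fun k : ℕ => (k : ℝ) ^ (p / 2) * (ε / 2) ^ p) atTop atTop :=
    ((tendsto_rpow_atTop (by linarith)).comp tendsto_natCast_atTop_atTop).atTop_mul_const
      (by positivity)
  obtain ⟨k, hk⟩ := (ht.eventually_gt_atTop (S + 2)).exists
  set c := (p - 1) / 2 with hc
  have hc0 : 0 < c := by rw [hc]; linarith
  refine ⟨min 1 (c / (4 * (k + 1))), by positivity, fun z w hz hw hm => ?_⟩
  set δ := min 1 (c / (4 * (k + 1)))
  have hδ1 : δ ≤ 1 := min_le_left _ _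
  have hδ2 : k * (4 * δ / c) ≤ 1 := by
    have : δ ≤ c / (4 * (k + 1)) := min_le_right _ _
    rw [le_div_iff₀ (by positivity)] at this
    rw [mul_div_assoc', div_le_one hc0]
    have : 0 < δ := by positivity
    nlinarith
  set m := (1 / 2 : ℝ) • (z + w) with hmdef
  set h := (1 / 2 : ℝ) • (z - w) with hhdef
  have e1 : m + h = z := by rw [hmdef, hhdef]; module
  have e2 : m - h = w := by rw [hmdef, hhdef]; module
  have h1 := M.two_mul_add_le hp1 m h
  rw [e1, e2, ← hc] at h1
  have hΩ := M.gap_nonneg m h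
  have hcΩ : 0 ≤ c * M.Ω m h := by positivity
  have h2 : M.Ω m h ≤ 4 * δ / c := by
    rw [le_div_iff₀ hc0]; linarith
  have h3 := M.pow_mul_le k m h
  have h4 : (k : ℝ) * M.Ω m h ≤ 1 := le_trans (by gcongr) hδ2
  have h5 : (k : ℝ) ^ (p / 2) * ‖h‖ ^ p ≤ (k : ℝ) ^ (p / 2) * M.Φ h := by
    gcongr; exact M.norm_le h
  have h6 : (k : ℝ) ^ (p / 2) * ‖h‖ ^ p < (k : ℝ) ^ (p / 2) * (ε / 2) ^ p := by linarith
  have h7 : ‖h‖ < ε / 2 :=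
    (Real.rpow_lt_rpow_iff (norm_nonneg _) (by positivity) hp0).1
      (lt_of_mul_lt_mul_left h6 (by positivity))
  rw [hhdef, norm_smul, Real.norm_of_nonneg (by norm_num)] at h7
  linarith

/-- Bounded families have weak limits along ultrafilters. -/
theorem exists_weak_limit (M : SmoothModel p X) [CompleteSpace X] (hp1 : 1 < p)
    {ι : Type*} (U : Ultrafilter ι) (x : ι → X) {C : ℝ} (hx : ∀ᶠ i in (U : Filter ι), ‖x i‖ ≤ C) :
    ∃ x₀ : X, ∀ φ : X →L[ℝ] ℝ, Tendsto (fun i => φ (x i)) U (nhds (φ x₀)) := by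
  let 𝒦 : Set (Set X) := {K | IsClosed K ∧ Convex ℝ K ∧ ∀ᶠ i in (U : Filter ι), x i ∈ K}
  let R : Set ℝ := {r | ∃ K ∈ 𝒦, ∀ y ∈ K, r ≤ M.Φ y}
  have hRne : R.Nonempty :=
    ⟨0, Set.univ, ⟨isClosed_univ, convex_univ, by simp⟩, fun y _ => M.Φ_nonneg y⟩
  have hRbdd : BddAbove R := by
    refine ⟨|M.bound| * C ^ p, ?_⟩
    rintro r ⟨K, ⟨-, -, hK⟩, hr⟩
    obtain ⟨i, hi, hi'⟩ := (hK.and hx).exists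
    refine (hr _ hi).trans ((M.le_norm _).trans ?_)
    exact mul_le_mul (le_abs_self _) (Real.rpow_le_rpow (norm_nonneg _) hi' (by linarith))
      (by positivity) (abs_nonneg _)
  set S := sSup R
  have hlow : ∀ n : ℕ, ∃ K ∈ 𝒦, ∀ y ∈ K, S - 1 / ((n : ℝ) + 1) ≤ M.Φ y := by
    intro n
    obtain ⟨r, ⟨K, hK, hr⟩, hrS⟩ := exists_lt_of_lt_csSup hRne
      (sub_lt_self S (Nat.one_div_pos_of_nat (n := n) (α := ℝ)))
    exact ⟨K, hK, fun y hy => hrS.le.trans (hr y hy)⟩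
  have hup : ∀ (n : ℕ), ∀ K ∈ 𝒦, ∃ y ∈ K, M.Φ y ≤ S + 1 / ((n : ℝ) + 1) := by
    intro n K hK
    by_contra! hcon
    have h1 : S + 1 / ((n : ℝ) + 1) ∈ R := ⟨K, hK, fun y hy => (hcon y hy).le⟩
    have h2 := le_csSup hRbdd h1
    have h3 := Nat.one_div_pos_of_nat (n := n) (α := ℝ)
    linarith
  have hinter : ∀ K ∈ 𝒦, ∀ K' ∈ 𝒦, K ∩ K' ∈ 𝒦 := fun K hK K' hK' =>
    ⟨hK.1.inter hK'.1, hK.2.1.inter hK'.2.1, hK.2.2.and hK'.2.2⟩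
  choose K hK𝒦 hKlow using hlow
  let D : ℕ → Set X := fun n => ⋂ k ∈ Finset.range (n + 1), K k
  have hD𝒦 : ∀ n, D n ∈ 𝒦 := fun n =>
    ⟨isClosed_biInter fun k _ => (hK𝒦 k).1, convex_iInter₂ fun k _ => (hK𝒦 k).2.1, by
      simp only [D, Set.mem_iInter]
      exact (Filter.eventually_all_finset _).2 fun k _ => (hK𝒦 k).2.2⟩
  have hDanti : ∀ {n m}, n ≤ m → D m ⊆ D n := fun {n m} hnm =>
    Set.biInter_subset_biInter_left fun k hk => by
      simp only [SetLike.mem_coe, Finset.mem_range] at hk ⊢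
      omega
  have hDK : ∀ n, D n ⊆ K n := fun n => Set.biInter_subset_of_mem (by simp)
  have hclose : ∀ ε > 0, ∃ N : ℕ, ∀ n ≥ N, ∀ z ∈ D N, ∀ w ∈ D N,
      M.Φ z ≤ S + 1 / ((N : ℝ) + 1) → M.Φ w ≤ S + 1 / ((n : ℝ) + 1) → ‖z - w‖ ≤ ε := by
    intro ε hε
    obtain ⟨δ, hδ, h⟩ := M.exists_uniform_convexity hp1 S hε
    obtain ⟨N, hN⟩ := exists_nat_one_div_lt hδ
    refine ⟨N, fun n hn z hz w hw hΦz hΦw => h z w (by linarith) ?_ ?_⟩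
    · have := Nat.one_div_le_one_div (α := ℝ) hn
      linarith
    · have hmem : (1 / 2 : ℝ) • (z + w) ∈ D N := by
        rw [smul_add]
        exact (hD𝒦 N).2.1 hz hw (by norm_num) (by norm_num) (by norm_num)
      have := hKlow N _ (hDK N hmem)
      linarith
  have hz : ∀ n : ℕ, ∃ z ∈ D n, M.Φ z ≤ S + 1 / ((n : ℝ) + 1) := fun n => hup n _ (hD𝒦 n)
  choose z hzD hzΦ using hz
  have hcau : CauchySeq z := by
    rw [Metric.cauchySeq_iff']
    intro ε hε
    obtain ⟨N, hN⟩ := hclose (ε / 2) (by positivity)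
    refine ⟨N, fun n hn => ?_⟩
    rw [dist_comm, dist_eq_norm]
    have := hN n hn (z N) (hzD N) (z n) (hDanti hn (hzD n)) (hzΦ N) (hzΦ n)
    linarith
  obtain ⟨x₀, hx₀⟩ := cauchySeq_tendsto_of_complete hcau
  have hmem : ∀ L ∈ 𝒦, x₀ ∈ L := by
    intro L hL
    have hw : ∀ n : ℕ, ∃ w ∈ L ∩ D n, M.Φ w ≤ S + 1 / ((n : ℝ) + 1) := fun n =>
      hup n _ (hinter L hL _ (hD𝒦 n))
    choose w hwD hwΦ using hw
    have hwt : Tendsto w atTop (nhds x₀) := by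
      rw [Metric.tendsto_atTop]
      intro ε hε
      obtain ⟨N₁, hN₁⟩ := hclose (ε / 4) (by positivity)
      obtain ⟨N₂, hN₂⟩ := Metric.tendsto_atTop.1 hx₀ (ε / 4) (by positivity)
      refine ⟨max N₁ N₂, fun n hn => ?_⟩
      have hn1 : N₁ ≤ n := (le_max_left _ _).trans hn
      have h1 := hN₁ n hn1 (z N₁) (hzD N₁) (w n) (hDanti hn1 (hwD n).2) (hzΦ N₁) (hwΦ n)
      have h2 := hN₁ n hn1 (z N₁) (hzD N₁) (z n) (hDanti hn1 (hzD n)) (hzΦ N₁) (hzΦ n)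
      have h3 := hN₂ n ((le_max_right _ _).trans hn)
      rw [← dist_eq_norm] at h1 h2
      have h4 := dist_triangle4 (w n) (z N₁) (z n) x₀
      rw [dist_comm (w n) (z N₁)] at h4
      linarith
    exact hL.1.mem_of_tendsto hwt (Eventually.of_forall fun n => (hwD n).1)
  refine ⟨x₀, fun φ => ?_⟩
  have hbd : ∀ᶠ i in (U : Filter ι), |φ (x i)| ≤ ‖φ‖ * C := hx.mono fun i hi =>
    (φ.le_opNorm _).trans (by gcongr)
  obtain ⟨a, ha⟩ := exists_tendsto_of_bounded U hbd
  have : φ x₀ = a := by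
    have hball : ∀ ε > 0, dist (φ x₀) a ≤ ε := by
      intro ε hε
      have : φ ⁻¹' Metric.closedBall a ε ∈ 𝒦 :=
        ⟨Metric.isClosed_closedBall.preimage φ.continuous,
          (convex_closedBall a ε).linear_preimage φ.toLinearMap,
          ha.eventually (Metric.closedBall_mem_nhds a hε)⟩
      exact hmem _ this
    exact dist_le_zero.1 (le_of_forall_gt_imp_ge_of_dense fun ε hε => hball ε hε)
  rwa [this]

/-- On bounded sets, a separating family of functionals determines weak convergence. -/
theorem weak_tendsto_of_separating (M : SmoothModel p X) [CompleteSpace X] (hp1 : 1 < p)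
    {Γ : Set (X →L[ℝ] ℝ)} (hΓ : ∀ x, (∀ g ∈ Γ, g x = 0) → x = 0)
    {ι : Type*} {l : Filter ι} {x : ι → X} {x₀ : X} {C : ℝ} (hx : ∀ i, ‖x i‖ ≤ C) (h : ∀ g ∈ Γ, Tendsto (fun i => g (x i)) l (nhds (g x₀)))
    (φ : X →L[ℝ] ℝ) : Tendsto (fun i => φ (x i)) l (nhds (φ x₀)) := by
  rw [tendsto_iff_ultrafilter]
  intro U hU
  obtain ⟨x₁, hx₁⟩ := M.exists_weak_limit hp1 U x (Eventually.of_forall hx)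
  have : x₁ - x₀ = 0 := hΓ _ fun g hg => by
    rw [map_sub, sub_eq_zero]
    exact tendsto_nhds_unique (hx₁ g) ((h g hg).mono_left hU)
  rw [← sub_eq_zero.1 this]
  exact hx₁ φ

end SmoothModel

end

section

section Lp

variable {p : ℝ}

lemma add_rpow_le_two_mul (hp1 : 1 < p) (hp2 : p < 2) {x y : ℝ} (hx : 0 ≤ x) (hy : 0 ≤ y) :
    (x + y) ^ p ≤ 2 * (x ^ p + y ^ p) := by
  lift x to NNReal using hx
  lift y to NNReal using hy
  have h := NNReal.rpow_add_le_mul_rpow_add_rpow x y hp1.le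
  have h3 : (2:NNReal) ^ (p - 1) ≤ 2 := by
    simpa using NNReal.rpow_le_rpow_of_exponent_le (by norm_num : (1:NNReal) ≤ 2)
      (by linarith : p - 1 ≤ 1)
  exact_mod_cast h.trans (mul_le_mul_left h3 _)

lemma half_rpow_sub_le (hp1 : 1 < p) (hp2 : p < 2) (a b : ℝ) :
    |b| ^ p / 2 - |a| ^ p ≤ |a + b| ^ p := by
  have h1 : |b| ^ p ≤ (|a + b| + |a|) ^ p := by
    refine Real.rpow_le_rpow (abs_nonneg _) ?_ (by linarith)
    calc |b| = |(a + b) - a| := by ring_nf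
      _ ≤ _ := abs_sub _ _
  have h2 := add_rpow_le_two_mul hp1 hp2 (abs_nonneg (a + b)) (abs_nonneg a)
  linarith

lemma norm_rpow_eq (hp : 0 < p) [Fact (1 ≤ ENNReal.ofReal p)]
    (u : lp (fun _ : ℕ => ℝ) (ENNReal.ofReal p)) : ‖u‖ ^ p = ∑' j, |u j| ^ p := by
  have := lp.norm_rpow_eq_tsum (by rwa [ENNReal.toReal_ofReal hp.le]) u
  simpa [ENNReal.toReal_ofReal hp.le] using this

lemma summable_rpow (hp : 0 < p) [Fact (1 ≤ ENNReal.ofReal p)]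
    (u : lp (fun _ : ℕ => ℝ) (ENNReal.ofReal p)) : Summable fun j => |u j| ^ p := by
  have := (lp.memℓp u).summable (by rwa [ENNReal.toReal_ofReal hp.le])
  simpa [ENNReal.toReal_ofReal hp.le] using this

/-- Asymptotic uniform convexity of `ℓ_p`. -/
lemma eventually_norm_add_rpow_ge (hp1 : 1 < p) (hp2 : p < 2) [Fact (1 ≤ ENNReal.ofReal p)]
    {ι : Type*} {l : Filter ι} (v : lp (fun _ : ℕ => ℝ) (ENNReal.ofReal p))
    {w : ι → lp (fun _ : ℕ => ℝ) (ENNReal.ofReal p)} {b : ℝ} (hb : 0 < b)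
    (hw : ∀ j, Tendsto (fun i => w i j) l (nhds 0)) (hwb : ∀ᶠ i in l, b ≤ ‖w i‖) :
    ∀ᶠ i in l, ‖v‖ ^ p + b ^ p / 4 ≤ ‖v + w i‖ ^ p := by
  have hp0 : 0 < p := by linarith
  have hbp : 0 < b ^ p := by positivity
  have hs := summable_rpow hp0 v
  obtain ⟨F, hF⟩ := (hs.hasSum.eventually (lt_mem_nhds
    (show ∑' j, |v j| ^ p - b ^ p / 16 < ∑' j, |v j| ^ p by linarith))).exists
  rw [← norm_rpow_eq hp0] at hF
  have hcont : Continuous fun t : ℝ => |t| ^ p :=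
    (Real.continuous_rpow_const hp0.le).comp continuous_abs
  have h1 : Tendsto (fun i => ∑ j ∈ F, |v j + w i j| ^ p) l (nhds (∑ j ∈ F, |v j| ^ p)) := by
    refine tendsto_finsetSum _ fun j _ => ?_
    simpa [Function.comp_def] using (hcont.tendsto _).comp ((hw j).const_add (v j))
  have h2 : Tendsto (fun i => ∑ j ∈ F, |w i j| ^ p) l (nhds 0) := by
    have : Tendsto (fun i => ∑ j ∈ F, |w i j| ^ p) l (nhds (∑ j ∈ F, |(0:ℝ)| ^ p)) :=
      tendsto_finsetSum _ fun j _ => (hcont.tendsto _).comp (hw j)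
    simpa [Real.zero_rpow hp0.ne'] using this
  filter_upwards [hwb, h1.eventually (lt_mem_nhds
    (show ∑ j ∈ F, |v j| ^ p - b ^ p / 16 < ∑ j ∈ F, |v j| ^ p by linarith)),
    h2.eventually (gt_mem_nhds (show 0 < b ^ p / 16 by positivity))] with i hi1 hi2 hi3
  have split : ∀ u : lp (fun _ : ℕ => ℝ) (ENNReal.ofReal p),
      ‖u‖ ^ p = ∑ j ∈ F, |u j| ^ p + ∑' j : ↥((F : Set ℕ)ᶜ), |u j| ^ p := fun u => by
    rw [norm_rpow_eq hp0]
    exact ((summable_rpow hp0 u).sum_add_tsum_compl).symm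
  have hsub : ∀ u : lp (fun _ : ℕ => ℝ) (ENNReal.ofReal p),
      Summable fun j : ↥((F : Set ℕ)ᶜ) => |u j| ^ p := fun u => (summable_rpow hp0 u).subtype _
  have h3 : (∑' j : ↥((F : Set ℕ)ᶜ), |w i j| ^ p) / 2 - ∑' j : ↥((F : Set ℕ)ᶜ), |v j| ^ p
      ≤ ∑' j : ↥((F : Set ℕ)ᶜ), |(v + w i) j| ^ p := by
    rw [← tsum_div_const, ← ((hsub (w i)).div_const 2).tsum_sub (hsub v)]
    exact (((hsub (w i)).div_const 2).sub (hsub v)).tsum_le_tsum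
      (fun j => half_rpow_sub_le hp1 hp2 _ _) (hsub (v + w i))
  have h4 := split v
  have h5 := split (w i)
  have h6 := split (v + w i)
  have h7 : b ^ p ≤ ‖w i‖ ^ p := Real.rpow_le_rpow hb.le hi1 hp0.le
  have h8 : ∑ j ∈ F, |(v + w i) j| ^ p = ∑ j ∈ F, |v j + w i j| ^ p := rfl
  linarith

end Lp

section SignAverage

variable {X : Type*} [AddCommGroup X]

lemma eventually_signAvg_ge {ι : Type*} {𝓕 : Filter ι} {H : X → ℝ} {G : ι → X → ℝ} {b : ℝ}
    (h : ∀ z, ∀ᶠ i in 𝓕, H z + b ≤ G i z) (l : List X) :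
    ∀ᶠ i in 𝓕, signAvg l H + b ≤ signAvg l (G i) := by
  induction l generalizing H G with
  | nil => exact h 0
  | cons y l ih =>
    refine ih fun z => ?_
    filter_upwards [h (z + y), h (z - y)] with i h1 h2
    linarith

/-- If `H` increases by `b` in the directions `x i`, then it has large sign averages. -/
lemma exists_list_signAvg_ge {H : X → ℝ} {b : ℝ} (hH : 0 ≤ H 0) {x : ℕ → X}
    (h : ∀ z, ∀ᶠ i in atTop, H z + b ≤ (H (z + x i) + H (z - x i)) / 2) (k : ℕ) :
    ∃ l : List X, l.length = k ∧ (∀ y ∈ l, ∃ i, y = x i) ∧ k * b ≤ signAvg l H := by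
  induction k with
  | zero => exact ⟨[], rfl, by simp, by simpa [signAvg] using hH⟩
  | succ k ih =>
    obtain ⟨l, hl, hx, hb⟩ := ih
    obtain ⟨i, hi⟩ := (eventually_signAvg_ge h l).exists
    refine ⟨x i :: l, by simp [hl], ?_, ?_⟩
    · intro y hy
      rcases List.mem_cons.1 hy with rfl | hy
      exacts [⟨i, rfl⟩, hx y hy]
    · simp only [signAvg]
      push_cast
      linarith

end SignAverage

variable {X : Type*} [NormedAddCommGroup X] [NormedSpace ℝ X]

/-- A coarse map grows at most linearly. -/
lemma Coarse_exists_affine_bound {Y : Type*} [NormedAddCommGroup Y] {f : X → Y} (hf : Coarse f) :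
    ∃ C, 0 ≤ C ∧ ∀ z, ‖f z - f 0‖ ≤ C * (‖z‖ + 1) := by
  obtain ⟨C, hC⟩ := hf 1 zero_le_one
  have hC0 : 0 ≤ C := (norm_nonneg _).trans (hC 0 0 (by simp))
  have key : ∀ (n : ℕ) (z : X), ‖z‖ ≤ n → ‖f z - f 0‖ ≤ C * n := by
    intro n
    induction n with
    | zero =>
      intro z hz
      have : z = 0 := by simpa using hz
      simp [this]
    | succ n ih =>
      intro z hz
      push_cast at hz ⊢
      have hn : (0:ℝ) < n + 1 := by positivity
      set y : X := ((n : ℝ) / (n + 1)) • z with hy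
      have h1 : ‖y‖ ≤ n := by
        rw [hy, norm_smul, Real.norm_of_nonneg (by positivity), div_mul_eq_mul_div, div_le_iff₀ hn]
        gcongr
      have h2 : ‖z - y‖ ≤ 1 := by
        have : z - y = (1 / ((n : ℝ) + 1)) • z := by
          rw [hy, ← sub_eq_zero]
          have : (1 : ℝ) - n / (n + 1) - 1 / (n + 1) = 0 := by field_simp; ring
          calc _ = ((1 : ℝ) - n / (n + 1) - 1 / (n + 1)) • z := by module
            _ = 0 := by rw [this, zero_smul]
        rw [this, norm_smul, Real.norm_of_nonneg (by positivity), div_mul_eq_mul_div,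
          div_le_iff₀ hn]
        linarith
      calc ‖f z - f 0‖ ≤ ‖f z - f y‖ + ‖f y - f 0‖ := norm_sub_le_norm_sub_add_norm_sub _ _ _
        _ ≤ C + C * n := add_le_add (hC _ _ h2) (ih y h1)
        _ = C * (n + 1) := by ring
  refine ⟨C, hC0, fun z => (key ⌈‖z‖⌉₊ z (Nat.le_ceil _)).trans ?_⟩
  exact mul_le_mul_of_nonneg_left (Nat.ceil_lt_add_one (norm_nonneg z)).le hC0

namespace SmoothModel

variable {p : ℝ}

lemma exists_gap_ge (M : SmoothModel p X) (hp1 : 1 < p) (hp2 : p < 2)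
    [Fact (1 ≤ ENNReal.ofReal p)] {f : X → lp (fun _ : ℕ => ℝ) (ENNReal.ofReal p)}
    (hwsc : WeakSeqCont f) (hcoarse : Coarse f) {α β b : ℝ} (hb : 0 < b)
    (hstar : ∀ x y : X, α ≤ ‖x - y‖ → ‖x - y‖ ≤ β → b ≤ ‖f x - f y‖) :
    ∃ κ > 0, ∀ (u : X) (x : ℕ → X), (∀ n, α ≤ ‖x n‖ ∧ ‖x n‖ ≤ β) →
      (∀ φ : X →L[ℝ] ℝ, Tendsto (fun n => φ (x n)) atTop (nhds 0)) → ∃ n, κ ≤ M.Ω u (x n) := by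
  have hp0 : 0 < p := by linarith
  obtain ⟨C, hC0, hC⟩ := Coarse_exists_affine_bound hcoarse
  set H : X → ℝ := fun z => ‖f z - f 0‖ ^ p with hH
  have hbp : 0 < b ^ p := by positivity
  set D := C ^ p * 2 + 1 with hD
  have hD0 : 0 < D := by positivity
  have hHΦ : ∀ z, H z ≤ D * (M.Φ z + 1) := by
    intro z
    have h1 : H z ≤ C ^ p * (‖z‖ + 1) ^ p := by
      rw [← Real.mul_rpow hC0 (by positivity)]
      exact Real.rpow_le_rpow (norm_nonneg _) (hC z) hp0.le
    have h2 := add_rpow_le_two_mul hp1 hp2 (norm_nonneg z) zero_le_one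
    rw [Real.one_rpow] at h2
    have h4 := M.norm_le z
    have h5 := M.Φ_nonneg z
    calc H z ≤ C ^ p * (2 * (M.Φ z + 1)) := h1.trans (by gcongr; linarith)
      _ ≤ D * (M.Φ z + 1) := by rw [hD]; nlinarith
  refine ⟨b ^ p / 4 / D / 2, by positivity, fun u x hx hnull => ?_⟩
  by_contra! hcon
  have hstep : ∀ z, ∀ᶠ i in atTop, H z + b ^ p / 4 ≤ (H (z + x i) + H (z - x i)) / 2 := by
    have key : ∀ (z : X) (x' : ℕ → X), (∀ n, ‖x' n‖ = ‖x n‖) →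
        (∀ φ : X →L[ℝ] ℝ, Tendsto (fun n => φ (x' n)) atTop (nhds 0)) →
        ∀ᶠ i in atTop, H z + b ^ p / 4 ≤ H (z + x' i) := by
      intro z x' hx' hnull'
      have h1 := hwsc (fun n => z + x' n) z fun φ => by
        simpa using (hnull' φ).const_add (φ z)
      have h2 := eventually_norm_add_rpow_ge hp1 hp2 (l := atTop) (f z - f 0)
        (w := fun i => f (z + x' i) - f z) hb (fun j => by
          have := h1 (lp.evalCLM ℝ (fun _ : ℕ => ℝ) (ENNReal.ofReal p) j)
          change Tendsto (fun i => f (z + x' i) j) atTop (nhds (f z j)) at this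
          simpa using this.sub_const (f z j)) (Eventually.of_forall fun i =>
          hstar _ _ (by simpa [hx'] using (hx i).1) (by simpa [hx'] using (hx i).2))
      filter_upwards [h2] with i hi
      have e : f z - f 0 + (f (z + x' i) - f z) = f (z + x' i) - f 0 := by abel
      rwa [e] at hi
    intro z
    filter_upwards [key z x (fun _ => rfl) hnull, key z (fun n => -x n) (fun _ => norm_neg _)
      (fun φ => by simpa using (hnull φ).neg)] with i h1 h2
    rw [← sub_eq_add_neg] at h2
    linarith
  have hH0 : 0 ≤ H 0 := by positivity
  have hbound : ∀ k : ℕ, k * (b ^ p / 4) ≤ D * (M.Φ u + k * (b ^ p / 4 / D / 2) + 1) := by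
    intro k
    obtain ⟨l, hl, hlx, hlb⟩ := exists_list_signAvg_ge hH0 hstep k
    have h1 := signAvg_mono l hHΦ
    rw [signAvg_const_mul l (fun z => M.Φ z + 1), signAvg_add_const] at h1
    have h2 := M.signAvg_le u l
    have h3 : (l.map (M.Ω u)).sum ≤ k * (b ^ p / 4 / D / 2) := by
      have := List.sum_le_card_nsmul (l.map (M.Ω u)) (b ^ p / 4 / D / 2) (by
        intro t ht
        obtain ⟨y, hy, rfl⟩ := List.mem_map.1 ht
        obtain ⟨i, rfl⟩ := hlx y hy
        exact (hcon i).le)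
      simpa [hl] using this
    calc _ ≤ D * (signAvg l M.Φ + 1) := hlb.trans h1
      _ ≤ _ := by gcongr; linarith
  obtain ⟨k, hk⟩ := exists_nat_gt (D * (M.Φ u + 1) / (b ^ p / 8))
  rw [div_lt_iff₀ (by positivity)] at hk
  have h1 := hbound k
  have h2 : D * (M.Φ u + k * (b ^ p / 4 / D / 2) + 1) = D * (M.Φ u + 1) + k * (b ^ p / 8) := by
    field_simp
    ring
  linarith

/-- Asymptotic uniform convexity with power type `p`, inherited from `ℓ_p` through the map `f`. -/
theorem exists_asymptotic_lower (M : SmoothModel p X) (hp1 : 1 < p) (hp2 : p < 2)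
    [Fact (1 ≤ ENNReal.ofReal p)] {f : X → lp (fun _ : ℕ => ℝ) (ENNReal.ofReal p)}
    (hwsc : WeakSeqCont f) (hcoarse : Coarse f) (hstar : PropertyStar f) :
    ∃ c > 0, ∀ (u : X) (y : ℕ → X) (B : ℝ), (∀ n, ‖y n‖ ≤ B) →
      (∀ φ : X →L[ℝ] ℝ, Tendsto (fun n => φ (y n)) atTop (nhds 0)) → ∀ ε > 0,
      ∀ᶠ n in atTop, M.Φ u + c * ‖y n‖ ^ p - ε ≤ M.Φ (u + y n) := by
  have hp0 : 0 < p := by linarith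
  obtain ⟨α, β, b, hα, hαβ, hb, hstar⟩ := hstar
  obtain ⟨κ, hκ, hgap⟩ := M.exists_gap_ge hp1 hp2 hwsc hcoarse hb hstar
  have hβ : 0 < β := hα.trans hαβ
  have hc0 : 0 < (p - 1) / 2 := by linarith
  refine ⟨(p - 1) / 2 * (κ / β ^ p), by positivity, fun u y B hB hnull ε hε => ?_⟩
  set c := (p - 1) / 2 * (κ / β ^ p) with hc
  have hcpos : 0 < c := by positivity
  by_contra hcon
  obtain ⟨σ, hσ, hσ'⟩ := extraction_of_frequently_atTop (not_eventually.1 hcon)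
  obtain ⟨ρ, -, τ, hτ, hρ⟩ := tendsto_subseq_of_bounded (x := fun n => ‖y (σ n)‖)
    (Metric.isBounded_Icc 0 B) (fun n => ⟨norm_nonneg _, hB _⟩)
  set z : ℕ → X := fun n => y (σ (τ n)) with hz
  have hznull : ∀ φ : X →L[ℝ] ℝ, Tendsto (fun n => φ (z n)) atTop (nhds 0) := fun φ =>
    (hnull φ).comp (hσ.tendsto_atTop.comp hτ.tendsto_atTop)
  have hzρ : Tendsto (fun n => ‖z n‖) atTop (nhds ρ) := hρ
  have hzlt : ∀ n, c * ‖z n‖ ^ p > ε + M.deriv u (z n) + (p - 1) / 2 * M.Ω u (z n) := fun n => by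
    have h1 := hσ' (τ n)
    have h2 := M.lower u (z n)
    rw [not_le] at h1
    simp only [hz] at h2 ⊢
    linarith
  have hder : ∀ᶠ n in atTop, -ε / 2 < M.deriv u (z n) :=
    (hznull (M.deriv u)).eventually (lt_mem_nhds (by linarith))
  have hρ0 : 0 < ρ := by
    have h1 : ∀ᶠ n in atTop, ε / 2 ≤ c * ‖z n‖ ^ p := hder.mono fun n hn => by
      have := hzlt n
      have := mul_nonneg hc0.le (M.gap_nonneg u (z n))
      linarith
    have h2 : Tendsto (fun n => c * ‖z n‖ ^ p) atTop (nhds (c * ρ ^ p)) :=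
      (hzρ.rpow_const (Or.inr hp0.le)).const_mul c
    have h3 := ge_of_tendsto h2 h1
    have h4 : 0 ≤ ρ := ge_of_tendsto' hzρ fun n => norm_nonneg _
    rcases h4.eq_or_lt with h | h
    · rw [← h, Real.zero_rpow hp0.ne', mul_zero] at h3
      linarith
    · exact h
  set t := (α + β) / 2 / ρ with ht
  have ht0 : 0 < t := by positivity
  have htρ : Tendsto (fun n => t * ‖z n‖) atTop (nhds ((α + β) / 2)) := by
    have := hzρ.const_mul t
    rwa [ht, div_mul_cancel₀ _ hρ0.ne'] at this
  obtain ⟨N, hN⟩ := eventually_atTop.1 ((htρ.eventually (lt_mem_nhds (by linarith : α < _))).and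
    ((htρ.eventually (gt_mem_nhds (by linarith : _ < β))).and hder))
  obtain ⟨n, hn⟩ := hgap (t • u) (fun n => t • z (n + N)) (fun n => by
    rw [norm_smul, Real.norm_of_nonneg ht0.le]
    exact ⟨(hN _ (Nat.le_add_left _ _)).1.le, (hN _ (Nat.le_add_left _ _)).2.1.le⟩) (fun φ => by
    simpa using ((hznull φ).comp (tendsto_add_atTop_nat N)).const_mul t)
  rw [M.Ω_smul, abs_of_pos ht0] at hn
  obtain ⟨-, h2, h3⟩ := hN (n + N) (Nat.le_add_left _ _)
  have h4 : t ^ p * ‖z (n + N)‖ ^ p ≤ β ^ p := by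
    rw [← Real.mul_rpow ht0.le (norm_nonneg _)]
    exact Real.rpow_le_rpow (by positivity) h2.le hp0.le
  have h5 : κ / β ^ p * ‖z (n + N)‖ ^ p ≤ M.Ω u (z (n + N)) := by
    have htp : 0 < t ^ p := by positivity
    refine le_of_mul_le_mul_left ?_ htp
    calc t ^ p * (κ / β ^ p * ‖z (n + N)‖ ^ p) = κ / β ^ p * (t ^ p * ‖z (n + N)‖ ^ p) := by ring
      _ ≤ κ / β ^ p * β ^ p := by gcongr
      _ = κ := by field_simp
      _ ≤ _ := hn
  have h6 := mul_le_mul_of_nonneg_left h5 hc0.le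
  rw [← mul_assoc, ← hc] at h6
  have h7 := hzlt (n + N)
  linarith

end SmoothModel

end

section

variable {X : Type*} [NormedAddCommGroup X] [NormedSpace ℝ X]

lemma exists_dual_eq_zero_of_notMem_closure {V : Submodule ℝ X} {x : X}
    (hx : x ∉ closure (V : Set X)) : ∃ φ : X →L[ℝ] ℝ, (∀ v ∈ V, φ v = 0) ∧ φ x ≠ 0 := by
  obtain ⟨φ, u, h1, h2⟩ := geometric_hahn_banach_closed_point V.convex.closure isClosed_closure hx
  have hV : ∀ v ∈ V, φ v = 0 := by
    intro v hv
    by_contra h0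
    have := h1 ((u / φ v) • v) (subset_closure (V.smul_mem _ hv))
    rw [map_smul, smul_eq_mul, div_mul_cancel₀ _ h0] at this
    exact lt_irrefl _ this
  refine ⟨φ, hV, ?_⟩
  have := h1 0 (subset_closure V.zero_mem)
  rw [map_zero] at this
  exact (this.trans h2).ne'

/-- A countable norming family for the span of a list. -/
lemma exists_countable_norming (l : List X) : ∃ N : Set (X →L[ℝ] ℝ), N.Countable ∧
    ∀ v ∈ Submodule.span ℝ {y | y ∈ l}, ∃ γ ∈ N, ‖γ‖ ≤ 1 ∧ ‖v‖ / 2 ≤ γ v := by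
  have hsep : TopologicalSpace.IsSeparable
      (Submodule.span ℝ {y | y ∈ l} : Set X) :=
    (List.finite_toSet l).countable.isSeparable.span
  obtain ⟨D, hD, hDc, hDd⟩ := hsep.exists_countable_dense_subset
  choose γ hγ1 hγ2 using fun x : X => exists_dual_vector'' ℝ x
  refine ⟨γ '' D, hDc.image γ, fun v hv => ?_⟩
  rcases eq_or_ne v 0 with rfl | hv0
  · obtain ⟨d, hd⟩ : D.Nonempty := by
      rw [Set.nonempty_iff_ne_empty]
      rintro rfl
      simpa using hDd hv
    exact ⟨γ d, ⟨d, hd, rfl⟩, hγ1 d, by simp⟩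
  · obtain ⟨d, hd, hdv⟩ := Metric.mem_closure_iff.1 (hDd hv) (‖v‖ / 4)
      (by have := norm_pos_iff.2 hv0; positivity)
    refine ⟨γ d, ⟨d, hd, rfl⟩, hγ1 d, ?_⟩
    rw [dist_eq_norm] at hdv
    have h1 : γ d (v - d) ≥ -‖v - d‖ := by
      have := (γ d).le_of_opNorm_le (hγ1 d) (v - d)
      rw [one_mul] at this
      exact (abs_le.1 this).1
    rw [map_sub, hγ2] at h1
    have h2 := norm_sub_norm_le v d
    simp only [RCLike.ofReal_real_eq_id, id] at h1
    linarith

namespace SmoothModel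

variable {p : ℝ}

lemma exists_countable_small_variation (M : SmoothModel p X) [CompleteSpace X] (hp1 : 1 < p)
    {h : X → ℝ} (hh : ∀ x : ℕ → X, (∀ φ : X →L[ℝ] ℝ, Tendsto (fun n => φ (x n)) atTop (nhds 0)) →
      Tendsto (fun n => h (x n)) atTop (nhds (h 0))) (β : ℝ) {ε : ℝ} (hε : 0 < ε) :
    ∃ Γ : Set (X →L[ℝ] ℝ), Γ.Countable ∧
      ∀ x, (∀ γ ∈ Γ, γ x = 0) → ‖x‖ ≤ β → |h x - h 0| < ε := by
  by_contra! hcon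
  choose N hN hN' using fun l : List X => exists_countable_norming l
  let Γ : List X → Set (X →L[ℝ] ℝ) := fun l => ⋃ t ∈ {t | t ∈ l.tails}, N t
  have hΓc : ∀ l, (Γ l).Countable := fun l =>
    (List.finite_toSet l.tails).countable.biUnion fun t _ => hN t
  choose s hs1 hs2 hs3 using fun l : List X => hcon (Γ l) (hΓc l)
  let L : ℕ → List X := fun n => n.rec [] fun _ l => s l :: l
  have hL : ∀ n, L (n + 1) = s (L n) :: L n := fun n => rfl
  have hsuf : ∀ {n m}, n ≤ m → L n <:+ L m := fun {n m} hnm => by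
    induction m, hnm using Nat.le_induction with
    | base => exact List.suffix_rfl
    | succ m _ ih => exact ih.trans (hL m ▸ List.suffix_cons _ _)
  have hkill : ∀ {n m}, n ≤ m → ∀ γ ∈ N (L n), γ (s (L m)) = 0 := fun {n m} hnm γ hγ =>
    hs1 _ γ (Set.mem_biUnion (x := L n) ((List.mem_tails _ _).2 (hsuf hnm)) hγ)
  have hmem : ∀ n, s (L n) ∈ L (n + 1) := fun n => by simp [hL]
  let V : ℕ → Submodule ℝ X := fun n => Submodule.span ℝ {y | y ∈ L n}
  have hVmono : Monotone V := fun n m hnm =>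
    Submodule.span_mono fun y hy => (hsuf hnm).subset hy
  have hweak : ∀ φ : X →L[ℝ] ℝ, Tendsto (fun n => φ (s (L n))) atTop (nhds 0) := by
    intro φ
    rw [tendsto_iff_ultrafilter]
    intro U hU
    obtain ⟨z, hz⟩ := M.exists_weak_limit hp1 U (fun n => s (L n))
      (Eventually.of_forall fun n => hs2 (L n))
    have hγz : ∀ n, ∀ γ ∈ N (L n), γ z = 0 := fun n γ hγ => by
      refine tendsto_nhds_unique (hz γ) (tendsto_const_nhds.congr' ?_)
      exact Filter.Eventually.mono (hU (eventually_ge_atTop n)) fun m hm => (hkill hm γ hγ).symm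
    have hzV : z ∈ closure ((⨆ n, V n : Submodule ℝ X) : Set X) := by
      by_contra hz'
      obtain ⟨ψ, hψ, hψz⟩ := exists_dual_eq_zero_of_notMem_closure hz'
      refine hψz (tendsto_nhds_unique (hz ψ) (tendsto_const_nhds.congr' ?_))
      exact Eventually.of_forall fun n => (hψ _ ((le_iSup V (n + 1))
        (Submodule.subset_span (hmem n)))).symm
    have hz0 : z = 0 := by
      by_contra hz0
      have hzpos := norm_pos_iff.2 hz0
      obtain ⟨v, hv, hvz⟩ := Metric.mem_closure_iff.1 hzV (‖z‖ / 3) (by positivity)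
      obtain ⟨n, hn⟩ := (Submodule.mem_iSup_of_directed V hVmono.directed_le).1 hv
      obtain ⟨γ, hγ, hγ1, hγv⟩ := hN' (L n) v hn
      have h1 : γ (v - z) ≤ ‖v - z‖ := by
        have := γ.le_of_opNorm_le hγ1 (v - z)
        rw [one_mul] at this
        exact (le_abs_self _).trans this
      rw [map_sub, hγz n γ hγ, sub_zero] at h1
      rw [dist_comm, dist_eq_norm] at hvz
      have h2 := norm_sub_norm_le z v
      rw [norm_sub_rev] at h2
      linarith
    have := hz φ
    rwa [hz0, map_zero] at this
  have h1 := (hh _ hweak).eventually (Metric.ball_mem_nhds _ hε)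
  obtain ⟨n, hn⟩ := h1.exists
  rw [Real.dist_eq] at hn
  exact absurd (hs3 (L n)) (not_le.2 hn)

/-- The dual of `X` contains a countable separating family. -/
theorem exists_separating_seq (M : SmoothModel p X) [CompleteSpace X] (hp1 : 1 < p)
    [Fact (1 ≤ ENNReal.ofReal p)] {f : X → lp (fun _ : ℕ => ℝ) (ENNReal.ofReal p)}
    (hwsc : WeakSeqCont f) (hstar : PropertyStar f) :
    ∃ g : ℕ → X →L[ℝ] ℝ, ∀ x, (∀ j, g j x = 0) → x = 0 := by
  obtain ⟨α, β, b, hα, hαβ, hb, hstar⟩ := hstar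
  have hcoord : ∀ (j : ℕ) (x : ℕ → X),
      (∀ φ : X →L[ℝ] ℝ, Tendsto (fun n => φ (x n)) atTop (nhds 0)) →
      Tendsto (fun n => f (x n) j) atTop (nhds (f 0 j)) := fun j x hx =>
    hwsc x 0 (fun φ => by simpa using hx φ)
      (lp.evalCLM ℝ (fun _ : ℕ => ℝ) (ENNReal.ofReal p) j)
  choose Γ hΓ hΓ' using fun q : ℕ × ℕ => M.exists_countable_small_variation hp1
    (h := fun x => f x q.1) (hcoord q.1) α
    (Nat.one_div_pos_of_nat (n := q.2) (α := ℝ))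
  have hne : (insert 0 (⋃ q, Γ q)).Nonempty := Set.insert_nonempty _ _
  obtain ⟨g, hg⟩ := ((Set.countable_iUnion hΓ).insert 0).exists_eq_range hne
  refine ⟨g, fun x hx => ?_⟩
  by_contra hx0
  have hxpos := norm_pos_iff.2 hx0
  set y : X := (α / ‖x‖) • x with hy
  have hynorm : ‖y‖ = α := by
    rw [hy, norm_smul, Real.norm_of_nonneg (by positivity), div_mul_cancel₀ _ hxpos.ne']
  have hyker : ∀ q, ∀ γ ∈ Γ q, γ y = 0 := fun q γ hγ => by
    have : γ ∈ Set.range g := hg ▸ Set.mem_insert_of_mem _ (Set.mem_iUnion.2 ⟨q, hγ⟩)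
    obtain ⟨j, rfl⟩ := this
    rw [hy, map_smul, hx j, smul_zero]
  have hfy : f y = f 0 := by
    ext j
    have h1 : ∀ k : ℕ, |f y j - f 0 j| ≤ 1 / ((k : ℝ) + 1) := fun k =>
      (hΓ' (j, k) y (hyker (j, k)) hynorm.le).le
    have h2 : |f y j - f 0 j| ≤ 0 :=
      ge_of_tendsto' tendsto_one_div_add_atTop_nhds_zero_nat h1
    exact sub_eq_zero.1 (abs_nonpos_iff.1 h2)
  have := hstar y 0 (by rw [sub_zero, hynorm]) (by rw [sub_zero, hynorm]; exact hαβ.le)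
  rw [hfy, sub_self, norm_zero] at this
  linarith

/-- A space with a countable separating family of functionals is separable. -/
theorem separableSpace_of_separating (M : SmoothModel p X) [CompleteSpace X] (hp1 : 1 < p)
    {g : ℕ → X →L[ℝ] ℝ} (hg : ∀ x, (∀ j, g j x = 0) → x = 0) :
    TopologicalSpace.SeparableSpace X := by
  let G : X → ℕ → ℝ := fun x j => g j x
  let B : Set X := Metric.closedBall 0 1
  obtain ⟨D, hDc, hD⟩ := TopologicalSpace.exists_countable_dense (G '' B)
  choose r hrB hr using fun d : G '' B => d.2
  let S : Set X := r '' D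
  have hS : S.Countable := hDc.image r
  have hclos : closure ((Submodule.span ℝ S : Submodule ℝ X) : Set X) = Set.univ := by
    by_contra hcon
    obtain ⟨x, hx⟩ := (Set.ne_univ_iff_exists_notMem _).1 hcon
    obtain ⟨φ, hφ, hφx⟩ := exists_dual_eq_zero_of_notMem_closure hx
    have hx0 : x ≠ 0 := by rintro rfl; simp at hφx
    have hxpos := norm_pos_iff.2 hx0
    set y : X := ‖x‖⁻¹ • x with hy
    have hyB : y ∈ B := by
      simp [B, hy, norm_smul, inv_mul_cancel₀ hxpos.ne']
    have hne : (comap ((↑) : D → G '' B) (nhds ⟨G y, y, hyB, rfl⟩)).NeBot :=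
      mem_closure_iff_comap_neBot.1 (hD ⟨G y, y, hyB, rfl⟩)
    have ht : Tendsto (fun d : D => ((d : G '' B) : ℕ → ℝ))
        (comap ((↑) : D → G '' B) (nhds ⟨G y, y, hyB, rfl⟩)) (nhds (G y)) :=
      (continuous_subtype_val.tendsto (⟨G y, y, hyB, rfl⟩ : G '' B)).comp tendsto_comap
    have h1 := M.weak_tendsto_of_separating hp1 (Γ := Set.range g)
      (fun x h => hg x fun j => h _ ⟨j, rfl⟩) (x := fun d : D => r d) (x₀ := y) (C := 1)
      (fun d => by simpa [B] using hrB d) (by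
        rintro _ ⟨j, rfl⟩
        have := (tendsto_pi_nhds.1 ht) j
        refine this.congr fun d => ?_
        rw [← hr d]) φ
    have h2 : φ y = 0 := by
      refine tendsto_nhds_unique h1 (tendsto_const_nhds.congr fun d => ?_)
      exact (hφ _ (Submodule.subset_span ⟨d, d.2, rfl⟩)).symm
    rw [hy, map_smul, smul_eq_mul] at h2
    exact hφx ((mul_eq_zero.1 h2).resolve_left (inv_ne_zero hxpos.ne'))
  have hsep := (hS.isSeparable.span (R := ℝ)).closure
  rw [hclos] at hsep
  exact TopologicalSpace.isSeparable_univ_iff.1 hsep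

end SmoothModel

end

section

section CellAverage

variable {ι κ : Type*} [Fintype ι] [DecidableEq κ]

/-- The mass of a cell of the partition `c`. -/
noncomputable def cellMass (m : ι → ℝ) (c : ι → κ) (k : κ) : ℝ := ∑ i with c i = k, m i

/-- The normalization in `ℓ_r` of the restriction of `m ^ (1 / r)` to a cell. -/
noncomputable def cellWeight (m : ι → ℝ) (c : ι → κ) (r : ℝ) (k : κ) (i : ι) : ℝ :=
  if c i = k then (m i / cellMass m c k) ^ (1 / r) else 0

variable {m : ι → ℝ} (c : ι → κ) {p q r : ℝ}

lemma cellMass_nonneg (hm : ∀ i, 0 ≤ m i) (k : κ) : 0 ≤ cellMass m c k :=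
  Finset.sum_nonneg fun i _ => hm i

lemma cellWeight_nonneg (hm : ∀ i, 0 ≤ m i) (k : κ) (i : ι) : 0 ≤ cellWeight m c r k i := by
  unfold cellWeight
  split_ifs
  · exact Real.rpow_nonneg (div_nonneg (hm i) (cellMass_nonneg c hm k)) _
  · exact le_rfl

lemma sum_cellWeight_rpow_le (hm : ∀ i, 0 ≤ m i) (hr : 0 < r) (k : κ) :
    ∑ i, cellWeight m c r k i ^ r ≤ 1 := by
  have h : ∀ i, cellWeight m c r k i ^ r = if c i = k then m i / cellMass m c k else 0 := by
    intro i
    unfold cellWeight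
    split_ifs
    · rw [← Real.rpow_mul (div_nonneg (hm i) (cellMass_nonneg c hm k)),
        one_div_mul_cancel hr.ne', Real.rpow_one]
    · exact Real.zero_rpow hr.ne'
  simp_rw [h]
  rw [← Finset.sum_filter, ← Finset.sum_div]
  exact div_self_le_one _

variable [Fintype κ]

lemma sum_abs_sum_cellWeight_mul_le (hpq : p.HolderConjugate q) (hm : ∀ i, 0 ≤ m i) (y : ι → ℝ) :
    ∑ k, |∑ i, cellWeight m c q k i * y i| ^ p ≤ ∑ i, |y i| ^ p := by
  have hp := hpq.pos
  have hq := hpq.symm.pos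
  rw [← Finset.sum_fiberwise (s := Finset.univ) (g := c) (f := fun i => |y i| ^ p)]
  refine Finset.sum_le_sum fun k _ => ?_
  have h1 : ∑ i, cellWeight m c q k i * y i
      = ∑ i with c i = k, cellWeight m c q k i * y i := by
    rw [Finset.sum_filter]
    refine Finset.sum_congr rfl fun i _ => ?_
    split_ifs with h
    · rfl
    · simp [cellWeight, h]
  have h2 : |∑ i, cellWeight m c q k i * y i| ≤ (∑ i with c i = k, |y i| ^ p) ^ (1 / p) := by
    rw [h1]
    refine (Finset.abs_sum_le_sum_abs _ _).trans ?_
    simp_rw [abs_mul]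
    refine (Real.inner_le_Lp_mul_Lq _ _ _ hpq.symm).trans ?_
    simp_rw [abs_abs]
    refine mul_le_of_le_one_left (by positivity)
      (Real.rpow_le_one (by positivity) ?_ (one_div_nonneg.2 hq.le))
    refine le_trans ?_ (sum_cellWeight_rpow_le c hm hq k)
    simp_rw [abs_of_nonneg (cellWeight_nonneg c hm k _)]
    exact Finset.sum_le_sum_of_subset_of_nonneg (Finset.filter_subset _ _)
      fun i _ _ => Real.rpow_nonneg (cellWeight_nonneg c hm k i) _
  refine (Real.rpow_le_rpow (abs_nonneg _) h2 hp.le).trans (le_of_eq ?_)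
  rw [← Real.rpow_mul (by positivity), one_div_mul_cancel hp.ne', Real.rpow_one]

lemma sum_mul_cellWeight (t : κ → ℝ) (i : ι) :
    ∑ k, t k * cellWeight m c r k i = t (c i) * (m i / cellMass m c (c i)) ^ (1 / r) := by
  simp [cellWeight]

lemma sum_abs_sum_mul_cellWeight_le (hm : ∀ i, 0 ≤ m i) (hr : 0 < r) (t : κ → ℝ) :
    ∑ i, |∑ k, t k * cellWeight m c r k i| ^ r ≤ ∑ k, |t k| ^ r := by
  have h : ∀ i, |∑ k, t k * cellWeight m c r k i| ^ r
      = |t (c i)| ^ r * (m i / cellMass m c (c i)) := by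
    intro i
    have h0 := div_nonneg (hm i) (cellMass_nonneg c hm (c i))
    rw [sum_mul_cellWeight, abs_mul, Real.mul_rpow (abs_nonneg _) (abs_nonneg _),
      abs_of_nonneg (Real.rpow_nonneg h0 _), ← Real.rpow_mul h0, one_div_mul_cancel hr.ne',
      Real.rpow_one]
  simp_rw [h]
  rw [← Finset.sum_fiberwise (s := Finset.univ) (g := c)]
  refine Finset.sum_le_sum fun k _ => ?_
  have : ∑ i with c i = k, |t (c i)| ^ r * (m i / cellMass m c (c i))
      = |t k| ^ r * (cellMass m c k / cellMass m c k) := by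
    rw [cellMass, Finset.sum_div, Finset.mul_sum]
    refine Finset.sum_congr rfl fun i hi => ?_
    rw [(Finset.mem_filter.1 hi).2, cellMass]
  rw [this]
  exact mul_le_of_le_one_right (by positivity) (div_self_le_one _)

lemma abs_cellAverage_sub_le (hpq : p.HolderConjugate q) (hm : ∀ i, 0 ≤ m i) {θ : ι → ℝ} {δ : ℝ}
    (hθ : ∀ i j, c i = c j → |θ i - θ j| ≤ δ) (i : ι) :
    |∑ k, (∑ j, cellWeight m c q k j * (m j ^ (1 / p) * θ j)) * cellWeight m c p k i
      - m i ^ (1 / p) * θ i| ≤ m i ^ (1 / p) * δ := by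
  have hp := hpq.pos
  have hp1 : (1 / p) ≠ 0 := (one_div_pos.2 hp).ne'
  rw [sum_mul_cellWeight]
  rcases (hm i).eq_or_lt with h0 | hpos
  · simp [← h0, Real.zero_rpow (inv_ne_zero hp.ne')]
  set S := cellMass m c (c i) with hS
  have hSpos : 0 < S := hpos.trans_le
    (Finset.single_le_sum (f := m) (fun j _ => hm j) (by simp))
  have hmass : ∑ j with c j = c i, m j / S = 1 := by
    rw [← Finset.sum_div]
    exact div_self hSpos.ne'
  have h1 : (∑ j, cellWeight m c q (c i) j * (m j ^ (1 / p) * θ j)) * (m i / S) ^ (1 / p)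
      = m i ^ (1 / p) * ∑ j with c j = c i, m j / S * θ j := by
    rw [Finset.sum_filter, Finset.sum_mul, Finset.mul_sum]
    refine Finset.sum_congr rfl fun j _ => ?_
    unfold cellWeight
    split_ifs
    · have h2 : m j = m j ^ (1 / q) * m j ^ (1 / p) := by
        rw [← Real.rpow_add_of_nonneg (hm j) (one_div_nonneg.2 hpq.symm.nonneg)
          (one_div_nonneg.2 hpq.nonneg), one_div, one_div, hpq.symm.inv_add_inv_eq_one,
          Real.rpow_one]
      have h3 : S = S ^ (1 / q) * S ^ (1 / p) := by
        rw [← Real.rpow_add hSpos, one_div, one_div, hpq.symm.inv_add_inv_eq_one, Real.rpow_one]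
      rw [← hS, Real.div_rpow (hm j) hSpos.le, Real.div_rpow hpos.le hSpos.le]
      have h4 : m j / S = m j ^ (1 / q) * m j ^ (1 / p) / (S ^ (1 / q) * S ^ (1 / p)) := by
        rw [← h2, ← h3]
      rw [h4]
      field_simp
    · simp
  rw [h1, ← mul_sub]
  have h5 : ∑ j with c j = c i, m j / S * θ j - θ i
      = ∑ j with c j = c i, m j / S * (θ j - θ i) := by
    simp_rw [mul_sub]
    rw [Finset.sum_sub_distrib, ← Finset.sum_mul, hmass, one_mul]
  rw [abs_mul, abs_of_nonneg (Real.rpow_nonneg (hm i) _), h5]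
  refine mul_le_mul_of_nonneg_left ?_ (Real.rpow_nonneg (hm i) _)
  calc |∑ j with c j = c i, m j / S * (θ j - θ i)|
      ≤ ∑ j with c j = c i, |m j / S * (θ j - θ i)| := Finset.abs_sum_le_sum_abs _ _
    _ ≤ ∑ j with c j = c i, m j / S * δ := by
        refine Finset.sum_le_sum fun j hj => ?_
        have hj0 := div_nonneg (hm j) hSpos.le
        rw [abs_mul, abs_of_nonneg hj0]
        exact mul_le_mul_of_nonneg_left (hθ j i (Finset.mem_filter.1 hj).2) hj0
    _ = δ := by rw [← Finset.sum_mul, hmass, one_mul]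

/-- Finitely many functions bounded by one are almost constant on the cells of a partition whose
number of cells does not depend on the functions. -/
lemma exists_cells {I J : Type*} (K : ℕ) (hK : 0 < K) (θ : J → I → ℝ)
    (hθ : ∀ j i, |θ j i| ≤ 1) : ∃ c : I → J → Fin (2 * K + 1),
      ∀ j i i', c i = c i' → |θ j i - θ j i'| ≤ 1 / K := by
  have hK' : (0 : ℝ) < K := by exact_mod_cast hK
  have hlt : ∀ j i, ⌊K * (θ j i + 1)⌋₊ < 2 * K + 1 := fun j i => by
    refine Nat.lt_succ_of_le (Nat.floor_le_of_le ?_)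
    push_cast
    nlinarith [(abs_le.1 (hθ j i)).2]
  refine ⟨fun i j => ⟨_, hlt j i⟩, fun j i i' h => ?_⟩
  have h1 : ⌊K * (θ j i + 1)⌋₊ = ⌊K * (θ j i' + 1)⌋₊ := congrArg Fin.val (congrFun h j)
  have hnn : ∀ i, 0 ≤ K * (θ j i + 1) := fun i =>
    mul_nonneg hK'.le (by linarith [(abs_le.1 (hθ j i)).1])
  have h2 := Nat.floor_le (hnn i)
  have h3 := Nat.lt_floor_add_one (K * (θ j i + 1))
  have h4 := Nat.floor_le (hnn i')
  have h5 := Nat.lt_floor_add_one (K * (θ j i' + 1))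
  rw [h1] at h2 h3
  rw [le_div_iff₀ hK']
  rcases abs_cases (θ j i - θ j i') with ⟨h, -⟩ | ⟨h, -⟩ <;> rw [h] <;> linarith

lemma exists_cellOperators {α β : Type*} [Fintype α] [Fintype β] [DecidableEq α]
    [DecidableEq β] (hpq : p.HolderConjugate q)
    {K : ℕ} (hK : 0 < K) (a : α → ι → ℝ) (γ : β → ι → ℝ) {A : ℝ}
    (hA : ∑ j, ∑ i, |a j i| ^ p + ∑ j, ∑ i, |γ j i| ^ q ≤ A) :
    ∃ ρ w : (α ⊕ β → Fin (2 * K + 1)) → ι → ℝ,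
      (∀ y : ι → ℝ, ∑ k, |∑ i, ρ k i * y i| ^ p ≤ ∑ i, |y i| ^ p) ∧
      (∀ t : (α ⊕ β → Fin (2 * K + 1)) → ℝ, ∑ i, |∑ k, t k * w k i| ^ p ≤ ∑ k, |t k| ^ p) ∧
      (∀ j, ∑ i, |∑ k, (∑ i', ρ k i' * a j i') * w k i - a j i| ^ p ≤ A * (1 / K) ^ p) ∧
      (∀ j, ∑ i, |∑ k, (∑ i', w k i' * γ j i') * ρ k i - γ j i| ^ q ≤ A * (1 / K) ^ q) := by
  have hp := hpq.pos
  have hq := hpq.symm.pos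
  let m : ι → ℝ := fun i => ∑ j, |a j i| ^ p + ∑ j, |γ j i| ^ q
  have hm : ∀ i, 0 ≤ m i := fun i => by positivity
  have hmA : ∑ i, m i ≤ A := by
    rw [Finset.sum_add_distrib, Finset.sum_comm, Finset.sum_comm (f := fun i j => |γ j i| ^ q)]
    exact hA
  have hroot : ∀ {r b : ℝ} {i}, 0 < r → |b| ^ r ≤ m i →
      |b / m i ^ (1 / r)| ≤ 1 ∧ b = m i ^ (1 / r) * (b / m i ^ (1 / r)) := by
    intro r b i hr hb
    have h1 : |b| ≤ m i ^ (1 / r) := by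
      rwa [one_div, Real.le_rpow_inv_iff_of_pos (abs_nonneg _) (hm i) hr]
    refine ⟨?_, ?_⟩
    · rw [abs_div, abs_of_nonneg (Real.rpow_nonneg (hm i) _)]
      exact div_le_one_of_le₀ h1 (Real.rpow_nonneg (hm i) _)
    · rcases eq_or_ne (m i ^ (1 / r)) 0 with h0 | h0
      · rw [h0] at h1 ⊢
        rw [zero_mul]
        exact abs_nonpos_iff.1 h1
      · rw [mul_div_cancel₀ _ h0]
  have ha : ∀ j i, |a j i| ^ p ≤ m i := fun j i =>
    (Finset.single_le_sum (f := fun j => |a j i| ^ p) (fun _ _ => by positivity)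
      (Finset.mem_univ j)).trans (le_add_of_nonneg_right (by positivity))
  have hγ : ∀ j i, |γ j i| ^ q ≤ m i := fun j i =>
    (Finset.single_le_sum (f := fun j => |γ j i| ^ q) (fun _ _ => by positivity)
      (Finset.mem_univ j)).trans (le_add_of_nonneg_left (by positivity))
  obtain ⟨c, hc⟩ := exists_cells K hK
    (Sum.elim (fun j i => a j i / m i ^ (1 / p)) fun j i => γ j i / m i ^ (1 / q)) (by
      rintro (j | j) i
      · exact (hroot hp (ha j i)).1
      · exact (hroot hq (hγ j i)).1)
  have hfinal : ∀ {r : ℝ} {F : ι → ℝ}, 0 < r → (∀ i, |F i| ≤ m i ^ (1 / r) * (1 / K)) →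
      ∑ i, |F i| ^ r ≤ A * (1 / K) ^ r := by
    intro r F hr hF
    refine le_trans (Finset.sum_le_sum fun i _ => ?_) (b := ∑ i, m i * (1 / (K : ℝ)) ^ r) ?_
    · refine (Real.rpow_le_rpow (abs_nonneg _) (hF i) hr.le).trans (le_of_eq ?_)
      rw [Real.mul_rpow (Real.rpow_nonneg (hm i) _) (by positivity), ← Real.rpow_mul (hm i),
        one_div_mul_cancel hr.ne', Real.rpow_one]
    · rw [← Finset.sum_mul]
      exact mul_le_mul_of_nonneg_right hmA (by positivity)
  refine ⟨cellWeight m c q, cellWeight m c p, sum_abs_sum_cellWeight_mul_le c hpq hm,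
    sum_abs_sum_mul_cellWeight_le c hm hp, fun j => hfinal hp fun i => ?_,
    fun j => hfinal hq fun i => ?_⟩
  · have := abs_cellAverage_sub_le c hpq hm (hc (Sum.inl j)) i
    simpa only [Sum.elim_inl, ← (hroot hp (ha j _)).2] using this
  · have := abs_cellAverage_sub_le c hpq.symm hm (hc (Sum.inr j)) i
    simpa only [Sum.elim_inr, ← (hroot hq (hγ j _)).2] using this

end CellAverage

end

section

variable {X : Type*} [NormedAddCommGroup X] [NormedSpace ℝ X]

lemma mul_signedPow {q : ℝ} (hq : 1 < q) (a : ℝ) : signedPow q a * a = |a| ^ q := by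
  rcases eq_or_ne a 0 with rfl | h
  · simp [Real.zero_rpow (by linarith : q ≠ 0)]
  · rw [signedPow, mul_assoc, ← abs_mul_abs_self, ← mul_assoc,
      ← Real.rpow_add_one (abs_pos.2 h).ne', ← Real.rpow_add_one (abs_pos.2 h).ne']
    congr 1
    ring

lemma sum_rpow_le_of_forall_sum_mul_le {ι : Type*} (s : Finset ι) {p q : ℝ}
    (hpq : p.HolderConjugate q) (γ : ι → ℝ) {C : ℝ} (hC : 0 ≤ C)
    (h : ∀ y : ι → ℝ, ∑ i ∈ s, y i * γ i ≤ C * (∑ i ∈ s, |y i| ^ p) ^ (1 / p)) :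
    ∑ i ∈ s, |γ i| ^ q ≤ C ^ q := by
  set N := ∑ i ∈ s, |γ i| ^ q with hN
  have hN0 : 0 ≤ N := by positivity
  rcases hN0.eq_or_lt with h0 | hpos
  · rw [← h0]
    positivity
  have h1 := h fun i => signedPow q (γ i)
  have h2 : ∀ i, |signedPow q (γ i)| ^ p = |γ i| ^ q := fun i => by
    rw [abs_signedPow hpq.symm.lt, ← Real.rpow_mul (abs_nonneg _), hpq.symm.sub_one_mul_conj]
  simp_rw [h2, mul_signedPow hpq.symm.lt] at h1
  rw [← hN] at h1
  have h3 : N = N ^ (1 / q) * N ^ (1 / p) := by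
    rw [← Real.rpow_add hpos, one_div, one_div, hpq.symm.inv_add_inv_eq_one, Real.rpow_one]
  have h4 : N ^ (1 / q) ≤ C := by
    refine le_of_mul_le_mul_right (a := N ^ (1 / p)) ?_ (Real.rpow_pos_of_pos hpos _)
    rwa [← h3]
  have h5 := Real.rpow_le_rpow (by positivity) h4 hpq.symm.nonneg
  rwa [← Real.rpow_mul hN0, one_div_mul_cancel hpq.symm.ne_zero, Real.rpow_one] at h5

/-- The pointwise limit of locally bounded linear functionals along `finsetUltra`. -/
lemma exists_functional_limit (ℓ : Finset X → X →ₗ[ℝ] ℝ) {C : ℝ}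
    (h : ∀ x, ∀ᶠ s in (finsetUltra X : Filter (Finset X)), |ℓ s x| ≤ C * ‖x‖) :
    ∃ r : X →L[ℝ] ℝ, ∀ x, Tendsto (fun s => ℓ s x) (finsetUltra X) (nhds (r x)) := by
  let r : X →ₗ[ℝ] ℝ :=
    { toFun := fun x => ulim (finsetUltra X) fun s => ℓ s x
      map_add' := fun x y => by
        refine tendsto_nhds_unique (tendsto_ulim _ (h (x + y))) ?_
        simp only [map_add]
        exact (tendsto_ulim _ (h x)).add (tendsto_ulim _ (h y))
      map_smul' := fun t x => by
        refine tendsto_nhds_unique (tendsto_ulim _ (h (t • x))) ?_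
        simp only [map_smul]
        exact (tendsto_ulim _ (h x)).const_smul t }
  exact ⟨r.mkContinuous C fun x => le_of_tendsto (tendsto_ulim _ (h x)).norm (h x),
    fun x => tendsto_ulim _ (h x)⟩

lemma norm_le_of_forall_dual {z : X} {C : ℝ}
    (h : ∀ φ : X →L[ℝ] ℝ, ‖φ‖ ≤ 1 → φ z ≤ C) : ‖z‖ ≤ C := by
  obtain ⟨φ, hφ, hφz⟩ := exists_dual_vector'' ℝ z
  have := h φ hφ
  rw [hφz] at this
  simpa using this

/-- Local coordinates yield finite rank operators, uniformly factored through `ℓ_p`, which are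
almost the identity on finitely many vectors and whose adjoints are almost the identity on finitely
many functionals. -/
theorem LocalCoord.exists_finiteRank {p lam : ℝ} (𝒞 : LocalCoord p lam X) (hp1 : 1 < p)
    (hp2 : p < 2) (hlam : 0 ≤ lam) [CompleteSpace X] {α β : Type*} [Fintype α] [Fintype β]
    (e : α → X) (g : β → X →L[ℝ] ℝ) {ε : ℝ} (hε : 0 < ε) :
    ∃ (n : ℕ) (r : Fin n → X →L[ℝ] ℝ) (v : Fin n → X),
      (∀ x, ∑ k, |r k x| ^ p ≤ lam ^ p * ‖x‖ ^ p) ∧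
      (∀ t : Fin n → ℝ, ‖∑ k, t k • v k‖ ^ p ≤ ∑ k, |t k| ^ p) ∧
      (∀ j, ‖∑ k, r k (e j) • v k - e j‖ ≤ ε) ∧
      (∀ j x, |g j (∑ k, r k x • v k) - g j x| ≤ ε * ‖x‖) := by
  classical
  let M := 𝒞.smoothModel hp1 hp2
  have hp0 : 0 < p := by linarith
  have hpq := Real.HolderConjugate.conjExponent hp1
  set q := p.conjExponent
  let U := finsetUltra X
  let A : ℝ := ∑ j, lam ^ p * ‖e j‖ ^ p + ∑ j, ‖g j‖ ^ q
  have hA0 : 0 ≤ A := by positivity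
  obtain ⟨K, hK⟩ := exists_nat_gt ((A ^ (1 / p) + A ^ (1 / q) * lam) / ε)
  have hK' : (0 : ℝ) < K := lt_of_le_of_lt (by positivity) hK
  rw [div_lt_iff₀ hε] at hK
  have hKp : A ^ (1 / p) * (1 / K) ≤ ε := by
    rw [mul_one_div, div_le_iff₀ hK', mul_comm ε]
    have : 0 ≤ A ^ (1 / q) * lam := by positivity
    linarith
  have hKq : A ^ (1 / q) * (1 / K) * lam ≤ ε := by
    rw [mul_one_div, div_mul_eq_mul_div, div_le_iff₀ hK', mul_comm ε]
    have : 0 ≤ A ^ (1 / p) := by positivity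
    linarith
  have hroot : ∀ {r a S : ℝ}, 0 < r → 0 ≤ a → 0 ≤ S → a ^ r ≤ S → a ≤ S ^ (1 / r) :=
    fun hr ha hS h => by rwa [one_div, Real.le_rpow_inv_iff_of_pos ha hS hr]
  have hlift : ∀ (s : Finset X) (y : Fin (𝒞.dim s) → ℝ),
      ‖𝒞.lift s y‖ ≤ (∑ i, |y i| ^ p) ^ (1 / p) := fun s y =>
    hroot hp0 (norm_nonneg _) (by positivity) (𝒞.norm_lift s y)
  let γ : ∀ s, β → Fin (𝒞.dim s) → ℝ := fun s j i =>
    g j (𝒞.lift s fun i' => if i = i' then 1 else 0)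
  have hγ : ∀ s j y, g j (𝒞.lift s y) = ∑ i, y i * γ s j i := fun s j y => by
    rw [LinearMap.pi_apply_eq_sum_univ (𝒞.lift s) y, map_sum]
    simp [γ]
  have hγq : ∀ s j, ∑ i, |γ s j i| ^ q ≤ ‖g j‖ ^ q := fun s j => by
    refine sum_rpow_le_of_forall_sum_mul_le _ hpq _ (norm_nonneg _) fun y => ?_
    rw [← hγ]
    exact (le_abs_self _).trans (((g j).le_opNorm _).trans
      (mul_le_mul_of_nonneg_left (hlift s y) (norm_nonneg _)))
  choose ρ w hρ hw ha hb using fun s : Finset X => exists_cellOperators (α := α) (β := β) hpq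
    (K := K) (by exact_mod_cast hK') (fun j => 𝒞.coord s (e j)) (γ s) le_rfl
  have hbound : ∀ᶠ s in (U : Filter (Finset X)),
      ∑ j, ∑ i, |𝒞.coord s (e j) i| ^ p + ∑ j, ∑ i, |γ s j i| ^ q ≤ A := by
    filter_upwards [Filter.eventually_all.2 fun j => eventually_mem_span (e j)] with s hs
    exact add_le_add (Finset.sum_le_sum fun j _ => 𝒞.sum_le s _ (hs j))
      (Finset.sum_le_sum fun j _ => hγq s j)
  let ℓ : (α ⊕ β → Fin (2 * K + 1)) → ∀ s, X →ₗ[ℝ] ℝ := fun k s =>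
    ∑ i, ρ s k i • (LinearMap.proj i ∘ₗ 𝒞.coord s)
  have hℓ : ∀ k s x, ℓ k s x = ∑ i, ρ s k i * 𝒞.coord s x i := fun k s x => by
    simp [ℓ]
  have hℓsum : ∀ x, ∀ᶠ s in (U : Filter (Finset X)), ∑ k, |ℓ k s x| ^ p ≤ lam ^ p * ‖x‖ ^ p := by
    intro x
    filter_upwards [eventually_mem_span x] with s hs
    simp_rw [hℓ]
    exact (hρ s _).trans (𝒞.sum_le s x hs)
  choose r hr using fun k => exists_functional_limit (ℓ k) (C := lam) fun x => by
    filter_upwards [hℓsum x] with s hs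
    rw [← Real.rpow_le_rpow_iff (abs_nonneg _) (by positivity) hp0,
      Real.mul_rpow hlam (norm_nonneg _)]
    exact (Finset.single_le_sum (f := fun k => |ℓ k s x| ^ p) (fun _ _ => by positivity)
      (Finset.mem_univ k)).trans hs
  have hwnorm : ∀ s (t : (α ⊕ β → Fin (2 * K + 1)) → ℝ),
      ‖𝒞.lift s fun i => ∑ k, t k * w s k i‖ ^ p ≤ ∑ k, |t k| ^ p :=
    fun s t => (𝒞.norm_lift s _).trans (hw s t)
  have hwlift : ∀ s (t : (α ⊕ β → Fin (2 * K + 1)) → ℝ), ∑ k, t k • 𝒞.lift s (w s k)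
      = 𝒞.lift s fun i => ∑ k, t k * w s k i := fun s t => by
    simp_rw [← map_smul, ← map_sum]
    congr 1
    ext i
    simp
  choose v hv using fun k => M.exists_weak_limit hp1 U (fun s => 𝒞.lift s (w s k)) (C := 1)
    (Eventually.of_forall fun s => by
      rw [← Real.rpow_le_rpow_iff (norm_nonneg _) zero_le_one hp0, Real.one_rpow]
      have h := hwnorm s fun k' => if k' = k then 1 else 0
      have hsingle : ∀ f : (α ⊕ β → Fin (2 * K + 1)) → ℝ,
          ∑ k', (if k' = k then f k' else 0) = f k := fun f =>
        (Fintype.sum_eq_single k fun k' hk' => if_neg hk').trans (if_pos rfl)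
      simp only [ite_mul, one_mul, zero_mul, hsingle, apply_ite abs,
        apply_ite (fun a : ℝ => a ^ p), abs_one, abs_zero, Real.one_rpow,
        Real.zero_rpow hp0.ne'] at h
      exact h)
  have hsumv : ∀ (φ : X →L[ℝ] ℝ) {t : Finset X → (α ⊕ β → Fin (2 * K + 1)) → ℝ}
      {t₀ : (α ⊕ β → Fin (2 * K + 1)) → ℝ},
      (∀ k, Tendsto (fun s => t s k) U (nhds (t₀ k))) →
      Tendsto (fun s => φ (𝒞.lift s fun i => ∑ k, t s k * w s k i)) U
        (nhds (φ (∑ k, t₀ k • v k))) := by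
    intro φ t t₀ ht
    simp_rw [← hwlift, map_sum, map_smul, smul_eq_mul]
    exact tendsto_finsetSum _ fun k _ => (ht k).mul (hv k φ)
  have hPx : ∀ (φ : X →L[ℝ] ℝ) (x : X), Tendsto (fun s => φ (𝒞.lift s fun i =>
      ∑ k, (∑ i', ρ s k i' * 𝒞.coord s x i') * w s k i) - φ x) U
        (nhds (φ (∑ k, r k x • v k) - φ x)) := fun φ x => by
    refine (hsumv φ fun k => ?_).sub_const _
    simpa only [hℓ] using hr k x
  have hmain : ∃ (r : (α ⊕ β → Fin (2 * K + 1)) → X →L[ℝ] ℝ) (v : (α ⊕ β → Fin (2 * K + 1)) → X),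
      (∀ x, ∑ k, |r k x| ^ p ≤ lam ^ p * ‖x‖ ^ p) ∧
      (∀ t : (α ⊕ β → Fin (2 * K + 1)) → ℝ, ‖∑ k, t k • v k‖ ^ p ≤ ∑ k, |t k| ^ p) ∧
      (∀ j, ‖∑ k, r k (e j) • v k - e j‖ ≤ ε) ∧
      (∀ j x, |g j (∑ k, r k x • v k) - g j x| ≤ ε * ‖x‖) := by
    refine ⟨r, v, fun x => ?_, fun t => ?_, fun j => ?_, fun j x => ?_⟩
    · exact le_of_tendsto (tendsto_finsetSum _ fun k _ =>
        ((hr k x).abs.rpow_const (Or.inr hp0.le))) (hℓsum x)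
    · have h0 : 0 ≤ ∑ k, |t k| ^ p := by positivity
      have : ‖∑ k, t k • v k‖ ≤ (∑ k, |t k| ^ p) ^ (1 / p) := by
        refine norm_le_of_forall_dual fun φ hφ => ?_
        refine le_of_tendsto' (hsumv φ (t := fun _ => t) fun k => tendsto_const_nhds) fun s => ?_
        refine (le_abs_self _).trans ((φ.le_of_opNorm_le hφ _).trans ?_)
        rw [one_mul]
        exact hroot hp0 (norm_nonneg _) h0 (hwnorm s t)
      rwa [one_div, Real.le_rpow_inv_iff_of_pos (norm_nonneg _) h0 hp0] at this
    · refine norm_le_of_forall_dual fun φ hφ => ?_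
      rw [map_sub]
      refine le_of_tendsto (hPx φ (e j)) ?_
      filter_upwards [hbound, eventually_mem_span (e j)] with s hs hsp
      nth_rewrite 2 [← 𝒞.lift_coord s _ hsp]
      rw [← map_sub, ← map_sub]
      refine (le_abs_self _).trans ((φ.le_of_opNorm_le hφ _).trans ?_)
      rw [one_mul]
      refine (hlift s _).trans (le_trans ?_ hKp)
      refine (Real.rpow_le_rpow (by positivity) ((ha s j).trans
        (mul_le_mul_of_nonneg_right hs (by positivity))) (by positivity)).trans (le_of_eq ?_)
      rw [Real.mul_rpow hA0 (by positivity), ← Real.rpow_mul (by positivity),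
        mul_one_div_cancel hp0.ne', Real.rpow_one]
    · refine le_of_tendsto (hPx (g j) x).abs ?_
      filter_upwards [hbound, eventually_mem_span x] with s hs hsp
      nth_rewrite 2 [← 𝒞.lift_coord s _ hsp]
      rw [hγ, hγ]
      have h1 : ∑ i, (∑ k, (∑ i', ρ s k i' * 𝒞.coord s x i') * w s k i) * γ s j i
          = ∑ i, 𝒞.coord s x i * ∑ k, (∑ i', w s k i' * γ s j i') * ρ s k i := by
        trans ∑ k, (∑ i, ρ s k i * 𝒞.coord s x i) * ∑ i, w s k i * γ s j i
        · simp_rw [Finset.sum_mul _ _ (γ s j _)]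
          rw [Finset.sum_comm]
          simp_rw [mul_assoc, Finset.mul_sum]
        · simp_rw [Finset.mul_sum _ _ (𝒞.coord s x _)]
          rw [Finset.sum_comm]
          refine Finset.sum_congr rfl fun k _ => ?_
          rw [Finset.sum_mul]
          exact Finset.sum_congr rfl fun i _ => by ring
      rw [h1, ← Finset.sum_sub_distrib]
      simp_rw [← mul_sub]
      have h2 : ∀ F : Fin (𝒞.dim s) → ℝ, (∑ i, |F i| ^ q) ≤ A * (1 / K) ^ q →
          ∑ i, 𝒞.coord s x i * F i ≤ ε * ‖x‖ := by
        intro F hF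
        refine (Real.inner_le_Lp_mul_Lq _ _ _ hpq).trans ?_
        have h3 : (∑ i, |𝒞.coord s x i| ^ p) ^ (1 / p) ≤ lam * ‖x‖ := by
          rw [one_div, Real.rpow_inv_le_iff_of_pos (by positivity) (by positivity) hp0,
            Real.mul_rpow hlam (norm_nonneg _)]
          exact 𝒞.sum_le s x hsp
        have h4 : (∑ i, |F i| ^ q) ^ (1 / q) ≤ A ^ (1 / q) * (1 / K) := by
          refine (Real.rpow_le_rpow (by positivity) hF
            (one_div_nonneg.2 hpq.symm.nonneg)).trans (le_of_eq ?_)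
          rw [Real.mul_rpow hA0 (by positivity), ← Real.rpow_mul (by positivity),
            mul_one_div_cancel hpq.symm.ne_zero, Real.rpow_one]
        calc _ ≤ (lam * ‖x‖) * (A ^ (1 / q) * (1 / K)) :=
              mul_le_mul h3 h4 (by positivity) (by positivity)
          _ = (A ^ (1 / q) * (1 / K) * lam) * ‖x‖ := by ring
          _ ≤ _ := mul_le_mul_of_nonneg_right hKq (norm_nonneg _)
      have hF := (hb s j).trans (mul_le_mul_of_nonneg_right hs (by positivity))
      refine abs_le'.2 ⟨h2 _ hF, ?_⟩
      rw [← Finset.sum_neg_distrib]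
      simp_rw [← mul_neg]
      exact h2 _ (by simpa only [abs_neg] using hF)
  obtain ⟨r, v, h1, h2, h3, h4⟩ := hmain
  let E := Fintype.equivFin (α ⊕ β → Fin (2 * K + 1))
  refine ⟨Fintype.card (α ⊕ β → Fin (2 * K + 1)), fun k => r (E.symm k), fun k => v (E.symm k),
    fun x => ?_, fun t => ?_, fun j => ?_, fun j x => ?_⟩
  · rw [E.symm.sum_comp fun k => |r k x| ^ p]
    exact h1 x
  · have h5 := h2 fun k => t (E k)
    rw [← E.symm.sum_comp, ← E.symm.sum_comp] at h5
    simpa using h5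
  · rw [E.symm.sum_comp fun k => r k (e j) • v k]
    exact h3 j
  · rw [E.symm.sum_comp fun k => r k x • v k]
    exact h4 j x

end

section

variable {p : ℝ} {X : Type*} [NormedAddCommGroup X] [NormedSpace ℝ X]

/-- Finite rank operators `∑ k, r k ⊗ v k` factoring through `ℓ_p^n`. -/
structure FiniteRankOp (p Λ : ℝ) (X : Type*) [NormedAddCommGroup X] [NormedSpace ℝ X] where
  n : ℕ
  r : Fin n → X →L[ℝ] ℝ
  v : Fin n → X
  sum_le : ∀ x, ∑ k, |r k x| ^ p ≤ Λ ^ p * ‖x‖ ^ p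
  norm_le : ∀ t : Fin n → ℝ, ‖∑ k, t k • v k‖ ^ p ≤ ∑ k, |t k| ^ p

namespace FiniteRankOp

variable {Λ : ℝ}

/-- The operator `∑ k, r k ⊗ v k`. -/
noncomputable def toCLM (P : FiniteRankOp p Λ X) : X →L[ℝ] X :=
  ∑ k, (P.r k).smulRight (P.v k)

lemma toCLM_apply (P : FiniteRankOp p Λ X) (x : X) : P.toCLM x = ∑ k, P.r k x • P.v k := by
  simp [toCLM]

/-- The zero operator. -/
def zero (hp : 0 < p) (hΛ : 0 ≤ Λ) : FiniteRankOp p Λ X where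
  n := 0
  r := Fin.elim0
  v := Fin.elim0
  sum_le x := by simpa using by positivity
  norm_le t := by simp [Real.zero_rpow hp.ne']

lemma toCLM_zero (hp : 0 < p) (hΛ : 0 ≤ Λ) : (zero hp hΛ : FiniteRankOp p Λ X).toCLM = 0 := by
  ext x
  rw [toCLM_apply]
  exact Finset.sum_empty

lemma norm_toCLM_le (P : FiniteRankOp p Λ X) (hp : 0 < p) (hΛ : 0 ≤ Λ) : ‖P.toCLM‖ ≤ Λ := by
  refine P.toCLM.opNorm_le_bound hΛ fun x => ?_
  rw [← Real.rpow_le_rpow_iff (norm_nonneg _) (by positivity) hp,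
    Real.mul_rpow hΛ (norm_nonneg _), toCLM_apply]
  exact (P.norm_le _).trans (P.sum_le x)

lemma toCLM_mem_span (P : FiniteRankOp p Λ X) (x : X) :
    P.toCLM x ∈ Submodule.span ℝ (Set.range P.v) := by
  rw [toCLM_apply]
  exact Submodule.sum_mem _ fun k _ => Submodule.smul_mem _ _ (Submodule.subset_span ⟨k, rfl⟩)

lemma comp_toCLM_mem_span (P : FiniteRankOp p Λ X) (z : X →L[ℝ] ℝ) :
    z ∘L P.toCLM ∈ Submodule.span ℝ (Set.range P.r) := by
  have : z ∘L P.toCLM = ∑ k, z (P.v k) • P.r k := by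
    ext x
    simp [toCLM_apply, mul_comm]
  rw [this]
  exact Submodule.sum_mem _ fun k _ => Submodule.smul_mem _ _ (Submodule.subset_span ⟨k, rfl⟩)

lemma tendsto_comp_left (Q : FiniteRankOp p Λ X) {ι : Type*} {l : Filter ι} {T : ι → X →L[ℝ] X}
    (hT : ∀ x, Tendsto (fun i => T i x) l (nhds x)) :
    Tendsto (fun i => T i ∘L Q.toCLM) l (nhds Q.toCLM) := by
  have h1 : ∀ i, T i ∘L Q.toCLM = ∑ k, (Q.r k).smulRight (T i (Q.v k)) := by
    intro i
    ext x
    simp [toCLM_apply, map_sum]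
  simp_rw [h1]
  refine tendsto_finsetSum _ fun k _ => ?_
  exact ((ContinuousLinearMap.smulRightL ℝ X X (Q.r k)).continuous.tendsto (Q.v k)).comp
    (hT (Q.v k))

lemma tendsto_comp_right (Q : FiniteRankOp p Λ X) {ι : Type*} {l : Filter ι} {T : ι → X →L[ℝ] X}
    (hT : ∀ φ : X →L[ℝ] ℝ, Tendsto (fun i => φ ∘L T i) l (nhds φ)) :
    Tendsto (fun i => Q.toCLM ∘L T i) l (nhds Q.toCLM) := by
  have h1 : ∀ i, Q.toCLM ∘L T i = ∑ k, (Q.r k ∘L T i).smulRight (Q.v k) := by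
    intro i
    ext x
    simp [toCLM_apply]
  simp_rw [h1]
  refine tendsto_finsetSum _ fun k _ => ?_
  exact (((ContinuousLinearMap.smulRightL ℝ X X).flip (Q.v k)).continuous.tendsto (Q.r k)).comp
    (hT (Q.r k))

end FiniteRankOp

/-- Some net of finite rank operators factoring uniformly through the spaces `ℓ_p^n` converges
strongly to the identity together with its adjoints. -/
theorem LocalCoord.exists_approximation {lam : ℝ} (𝒞 : LocalCoord p lam X) [CompleteSpace X]
    (hp1 : 1 < p) (hp2 : p < 2) (hlam : 0 ≤ lam) :
    ∃ 𝓕 : Filter (FiniteRankOp p lam X), 𝓕.NeBot ∧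
      (∀ e, Tendsto (fun P => P.toCLM e) 𝓕 (nhds e)) ∧
      ∀ g : X →L[ℝ] ℝ, Tendsto (fun P => g ∘L P.toCLM) 𝓕 (nhds g) := by
  classical
  have key : ∀ i : Finset X × Finset (X →L[ℝ] ℝ) × ℕ, ∃ P : FiniteRankOp p lam X,
      (∀ e ∈ i.1, ‖P.toCLM e - e‖ ≤ 1 / ((i.2.2 : ℝ) + 1)) ∧
      ∀ g ∈ i.2.1, ‖g ∘L P.toCLM - g‖ ≤ 1 / ((i.2.2 : ℝ) + 1) := by
    rintro ⟨s, t, N⟩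
    obtain ⟨n, r, v, h1, h2, h3, h4⟩ := 𝒞.exists_finiteRank hp1 hp2 hlam
      (fun e : s => (e : X)) (fun g : t => (g : X →L[ℝ] ℝ))
      (Nat.one_div_pos_of_nat (α := ℝ) (n := N))
    let P : FiniteRankOp p lam X := ⟨n, r, v, h1, h2⟩
    refine ⟨P, fun e he => ?_, fun g hg => ?_⟩
    · rw [P.toCLM_apply]
      exact h3 ⟨e, he⟩
    · refine ContinuousLinearMap.opNorm_le_bound _ (by positivity) fun x => ?_
      have := h4 ⟨g, hg⟩ x
      rw [← P.toCLM_apply] at this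
      simpa using this
  choose P hP1 hP2 using key
  have hN : Tendsto (fun i : Finset X × Finset (X →L[ℝ] ℝ) × ℕ => 1 / ((i.2.2 : ℝ) + 1))
      atTop (nhds 0) := by
    refine tendsto_one_div_add_atTop_nhds_zero_nat.comp ?_
    refine tendsto_atTop.2 fun b => ?_
    filter_upwards [eventually_ge_atTop ((∅, ∅, b) : Finset X × Finset (X →L[ℝ] ℝ) × ℕ)]
      with i hi using hi.2.2
  refine ⟨map P atTop, inferInstance, fun e => ?_, fun g => ?_⟩
  · refine tendsto_map'_iff.2 (tendsto_iff_norm_sub_tendsto_zero.2 ?_)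
    refine squeeze_zero' (Eventually.of_forall fun _ => norm_nonneg _) ?_ hN
    filter_upwards [eventually_ge_atTop (({e}, ∅, 0) : Finset X × Finset (X →L[ℝ] ℝ) × ℕ)]
      with i hi using hP1 i e (hi.1 (Finset.mem_singleton_self e))
  · refine tendsto_map'_iff.2 (tendsto_iff_norm_sub_tendsto_zero.2 ?_)
    refine squeeze_zero' (Eventually.of_forall fun _ => norm_nonneg _) ?_ hN
    filter_upwards [eventually_ge_atTop ((∅, {g}, 0) : Finset X × Finset (X →L[ℝ] ℝ) × ℕ)]
      with i hi using hP2 i g (hi.2.1 (Finset.mem_singleton_self g))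

end

section

variable {p : ℝ} {X : Type*} [NormedAddCommGroup X] [NormedSpace ℝ X]

lemma exists_ultrafilter_choice {κ β : Type*} {l : Filter κ} {q : κ → β → Prop}
    (h : ∃ᶠ k in l, ∃ b, q k b) :
    ∃ (U : Ultrafilter κ) (b : κ → β), (U : Filter κ) ≤ l ∧ ∀ᶠ k in (U : Filter κ), q k (b k) := by
  have : (l ⊓ 𝓟 {k | ∃ b, q k b}).NeBot := frequently_mem_iff_neBot.1 h
  obtain ⟨U, hU⟩ := Ultrafilter.exists_le (l ⊓ 𝓟 {k | ∃ b, q k b})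
  obtain ⟨b, hb⟩ := Eventually.choice (l := (U : Filter κ))
    (le_principal_iff.1 (hU.trans inf_le_right))
  exact ⟨U, b, hU.trans inf_le_left, hb⟩

namespace SmoothModel

lemma norm_deriv_le (M : SmoothModel p X) (hp1 : 1 < p) {x : X} {ρ : ℝ} (hx : ‖x‖ ≤ ρ) :
    ‖M.deriv x‖ ≤ |M.bound| * (ρ + 1) ^ p := by
  have hρ : 0 ≤ ρ := (norm_nonneg x).trans hx
  have key : ∀ h : X, ‖h‖ = 1 → M.deriv x h ≤ |M.bound| * (ρ + 1) ^ p := by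
    intro h hh
    have h1 := M.lower x h
    have h2 := M.gap_nonneg x h
    have h3 := M.Φ_nonneg x
    have h4 : ‖x + h‖ ≤ ρ + 1 := (norm_add_le _ _).trans (by rw [hh]; gcongr)
    have h5 : M.Φ (x + h) ≤ |M.bound| * (ρ + 1) ^ p := (M.le_norm _).trans <|
      mul_le_mul (le_abs_self _) (Real.rpow_le_rpow (norm_nonneg _) h4 (by linarith))
        (by positivity) (abs_nonneg _)
    have : 0 ≤ (p - 1) / 2 * M.Ω x h := mul_nonneg (by linarith) h2
    linarith
  refine ContinuousLinearMap.opNorm_le_of_unit_norm (by positivity) fun h hh => ?_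
  rw [Real.norm_eq_abs, abs_le']
  exact ⟨key h hh, by simpa using key (-h) (by rwa [norm_neg])⟩

lemma Φ_sub_le (M : SmoothModel p X) (hp1 : 1 < p) {x y : X} {ρ : ℝ} (hx : ‖x‖ ≤ ρ) :
    M.Φ x - M.Φ y ≤ |M.bound| * (ρ + 1) ^ p * ‖x - y‖ := by
  have h1 := M.lower x (y - x)
  have h2 : 0 ≤ (p - 1) / 2 * M.Ω x (y - x) := mul_nonneg (by linarith) (M.gap_nonneg _ _)
  have h3 := neg_le_of_abs_le ((M.deriv x).le_opNorm (y - x))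
  have h4 := mul_le_mul_of_nonneg_right (M.norm_deriv_le hp1 hx) (norm_nonneg (y - x))
  rw [norm_sub_rev x y]
  rw [add_sub_cancel] at h1
  linarith

/-- Lower `p`-estimate for bounded weakly null nets. -/
theorem eventually_asymptotic_lower (M : SmoothModel p X) [CompleteSpace X] (hp1 : 1 < p)
    {g : ℕ → X →L[ℝ] ℝ} (hg : ∀ x, (∀ j, g j x = 0) → x = 0) {c : ℝ}
    (hc : ∀ (u : X) (y : ℕ → X) (B : ℝ), (∀ n, ‖y n‖ ≤ B) →
      (∀ φ : X →L[ℝ] ℝ, Tendsto (fun n => φ (y n)) atTop (nhds 0)) → ∀ ε > 0,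
        ∀ᶠ n in atTop, M.Φ u + c * ‖y n‖ ^ p - ε ≤ M.Φ (u + y n))
    {ι : Type*} {l : Filter ι} {y : ι → X} {B : ℝ} (hy : ∀ᶠ i in l, ‖y i‖ ≤ B)
    (hy0 : ∀ φ : X →L[ℝ] ℝ, Tendsto (fun i => φ (y i)) l (nhds 0)) (u : X) {ε : ℝ} (hε : 0 < ε) :
    ∀ᶠ i in l, M.Φ u + c * ‖y i‖ ^ p - ε ≤ M.Φ (u + y i) := by
  by_contra hcon
  have hev : ∀ n : ℕ, ∃ i, ‖y i‖ ≤ B ∧ (∀ j ∈ Finset.range (n + 1),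
      |g j (y i)| < 1 / ((n : ℝ) + 1)) ∧ ¬ (M.Φ u + c * ‖y i‖ ^ p - ε ≤ M.Φ (u + y i)) := by
    intro n
    have h1 : ∀ᶠ i in l, ∀ j ∈ Finset.range (n + 1), |g j (y i)| < 1 / ((n : ℝ) + 1) :=
      (Filter.eventually_all_finset _).2 fun j _ => by
        simpa using (Metric.tendsto_nhds.1 (hy0 (g j))) _ Nat.one_div_pos_of_nat
    obtain ⟨i, hi, h2, h3⟩ := ((not_eventually.1 hcon).and_eventually (hy.and h1)).exists
    exact ⟨i, h2, h3, hi⟩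
  choose σ h1 h2 h3 using hev
  have h4 := M.weak_tendsto_of_separating hp1 (Γ := Set.range g)
    (fun x h => hg x fun j => h _ ⟨j, rfl⟩) (x := fun n => y (σ n)) (x₀ := 0) (l := atTop) h1 (by
      rintro _ ⟨j, rfl⟩
      rw [map_zero]
      refine squeeze_zero_norm' ?_ (tendsto_one_div_add_atTop_nhds_zero_nat (𝕜 := ℝ))
      filter_upwards [eventually_ge_atTop j] with n hn
      exact (h2 n j (Finset.mem_range.2 (by omega))).le)
  simp only [map_zero] at h4
  obtain ⟨n, hn⟩ := (hc u (fun n => y (σ n)) B h1 h4 ε hε).exists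
  exact h3 n hn

/-- If `D → 0` strongly together with the adjoints, then `Φ` satisfies an upper estimate along
`y + D u`, uniformly in `y` in a ball of a finite dimensional space. -/
theorem eventually_upper (M : SmoothModel p X) (hp1 : 1 < p)
    {κ : Type*} {l : Filter κ} {D : κ → X →L[ℝ] X} {C : ℝ} (hD : ∀ k, ‖D k‖ ≤ C)
    (hD0 : ∀ φ : X →L[ℝ] ℝ, Tendsto (fun k => φ ∘L D k) l (nhds 0))
    (W : Submodule ℝ X) [FiniteDimensional ℝ W] (ρ : ℝ) {ε : ℝ} (hε : 0 < ε) :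
    ∀ᶠ k in l, ∀ y ∈ W, ‖y‖ ≤ ρ → ∀ u : X, ‖u‖ ≤ 1 →
      M.Φ (y + D k u) ≤ M.Φ y + 2 * M.Φ (D k u) + ε := by
  by_contra hcon
  have hbad := not_eventually.1 hcon
  push Not at hbad
  obtain ⟨U, w, hUl, hw1⟩ := exists_ultrafilter_choice (q := fun k (w : W × X) =>
    ‖w.1‖ ≤ ρ ∧ ‖w.2‖ ≤ 1 ∧ M.Φ w.1 + 2 * M.Φ (D k w.2) + ε < M.Φ (w.1 + D k w.2))
    (hbad.mono fun k ⟨y, hy, hyρ, u, hu, h⟩ => ⟨(⟨y, hy⟩, u), hyρ, hu, h⟩)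
  obtain ⟨y₀, -, hy₀⟩ := (isCompact_closedBall (0 : W) ρ).ultrafilter_le_nhds
    (U.map fun k => (w k).1) (by
      simp only [Ultrafilter.coe_map, le_principal_iff, mem_map]
      filter_upwards [hw1] with k hk
      simpa using hk.1)
  have hy : Tendsto (fun k => ‖((w k).1 : X) - y₀‖) U (nhds 0) := by
    have : Tendsto (fun k => (w k).1) U (nhds y₀) := hy₀
    simpa using tendsto_iff_norm_sub_tendsto_zero.1 this
  have hd : Tendsto (fun k => ‖M.deriv y₀ ∘L D k‖) U (nhds 0) := by
    simpa using ((hD0 (M.deriv y₀)).mono_left hUl).norm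
  set K : ℝ := |M.bound| * (ρ + C + 1 + 1) ^ p
  have hlim : Tendsto (fun k => ‖M.deriv y₀ ∘L D k‖ + 2 * K * ‖((w k).1 : X) - y₀‖) U
      (nhds 0) := by
    simpa using hd.add (hy.const_mul (2 * K))
  obtain ⟨k, hk1, hk2, hk3⟩ :=
    ((hlim.eventually (gt_mem_nhds hε)).and (hw1.and (hy.eventually (gt_mem_nhds one_pos)))).exists
  obtain ⟨h1, h2, h3⟩ := hk2
  have hC : 0 ≤ C := (norm_nonneg _).trans (hD k)
  set y : X := ((w k).1 : X)
  set u : X := (w k).2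
  have hDu : ‖D k u‖ ≤ C := (D k).le_of_opNorm_le_of_le (hD k) h2 |>.trans (by simp)
  have hyρ : ‖y‖ ≤ ρ := h1
  have hy₀ρ : ‖(y₀ : X)‖ ≤ ρ + C + 1 := by
    have := norm_sub_norm_le (y₀ : X) y
    rw [norm_sub_rev] at this
    linarith
  have e1 : M.Φ (y + D k u) - M.Φ (y₀ + D k u) ≤ K * ‖y - y₀‖ := by
    have := M.Φ_sub_le hp1 (x := y + D k u) (y := y₀ + D k u) (ρ := ρ + C + 1)
      ((norm_add_le _ _).trans (by linarith))
    rwa [add_sub_add_right_eq_sub] at this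
  have e2 : M.Φ y₀ - M.Φ y ≤ K * ‖y - y₀‖ := by
    have := M.Φ_sub_le hp1 (y := y) hy₀ρ
    rwa [norm_sub_rev] at this
  have e3 := M.upper y₀ (D k u)
  have e4 : M.deriv y₀ (D k u) ≤ ‖M.deriv y₀ ∘L D k‖ := by
    have := (M.deriv y₀ ∘L D k).le_of_opNorm_le_of_le le_rfl h2
    rw [mul_one] at this
    exact (le_abs_self _).trans this
  linarith

/-- If `D → 0` strongly, then functionals dominated by `Φ` up to a constant satisfy an upper
`q`-estimate along `s + z ∘ D`, uniformly in `s` in a finite dimensional space. -/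
theorem eventually_dual_upper (M : SmoothModel p X) [CompleteSpace X] (hp1 : 1 < p) {q : ℝ}
    (hpq : p.HolderConjugate q)
    {g : ℕ → X →L[ℝ] ℝ} (hg : ∀ x, (∀ j, g j x = 0) → x = 0) {c : ℝ} (hc0 : 0 < c)
    (hc : ∀ (u : X) (y : ℕ → X) (B : ℝ), (∀ n, ‖y n‖ ≤ B) →
      (∀ φ : X →L[ℝ] ℝ, Tendsto (fun n => φ (y n)) atTop (nhds 0)) → ∀ ε > 0,
        ∀ᶠ n in atTop, M.Φ u + c * ‖y n‖ ^ p - ε ≤ M.Φ (u + y n))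
    {κ : Type*} {l : Filter κ} {D : κ → X →L[ℝ] X} {C : ℝ} (hD : ∀ k, ‖D k‖ ≤ C)
    (hD0 : ∀ x, Tendsto (fun k => D k x) l (nhds 0))
    (W : Submodule ℝ (X →L[ℝ] ℝ)) [FiniteDimensional ℝ W] (ρ : ℝ) {ε : ℝ} (hε : 0 < ε) :
    ∀ᶠ k in l, ∀ s ∈ W, ∀ m, 0 ≤ m → m ≤ ρ → (∀ x, s x ≤ M.Φ x + m) →
      ∀ z : X →L[ℝ] ℝ, ‖z‖ ≤ 1 → ∀ x,
        s x + z (D k x) ≤ M.Φ x + (m + (C * c ^ (-(1 / p))) ^ q * ‖z‖ ^ q + ε) := by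
  have hp0 : 0 < p := by linarith
  by_contra hcon
  have hbad := not_eventually.1 hcon
  push Not at hbad
  obtain ⟨U, w, hUl, hw⟩ := exists_ultrafilter_choice
    (q := fun k (w : (W × ℝ) × (X →L[ℝ] ℝ) × X) => 0 ≤ w.1.2 ∧ w.1.2 ≤ ρ ∧
      (∀ x, (w.1.1 : X →L[ℝ] ℝ) x ≤ M.Φ x + w.1.2) ∧ ‖w.2.1‖ ≤ 1 ∧
      M.Φ w.2.2 + (w.1.2 + (C * c ^ (-(1 / p))) ^ q * ‖w.2.1‖ ^ q + ε) <
        (w.1.1 : X →L[ℝ] ℝ) w.2.2 + w.2.1 (D k w.2.2))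
    (hbad.mono fun k ⟨s, hs, m, h1, h2, h3, z, h4, x, h5⟩ =>
      ⟨((⟨s, hs⟩, m), z, x), h1, h2, h3, h4, h5⟩)
  obtain ⟨k₀, hk₀⟩ := hw.exists
  have hρ : 0 ≤ ρ := hk₀.1.trans hk₀.2.1
  have hC : 0 ≤ C := (norm_nonneg _).trans (hD k₀)
  set S : ℝ := |M.bound| + ρ
  have hs : ∀ᶠ k in (U : Filter κ), ‖(w k).1.1‖ ≤ S := by
    filter_upwards [hw] with k hk
    obtain ⟨h1, h2, h3, -⟩ := hk
    have key : ∀ x : X, ‖x‖ = 1 → ((w k).1.1 : X →L[ℝ] ℝ) x ≤ S := fun x hx => by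
      have := M.le_norm x
      rw [hx, Real.one_rpow, mul_one] at this
      linarith [h3 x, le_abs_self M.bound]
    refine ContinuousLinearMap.opNorm_le_of_unit_norm (by positivity) fun x hx => ?_
    rw [Real.norm_eq_abs, abs_le']
    exact ⟨key x hx, by simpa using key (-x) (by rwa [norm_neg])⟩
  set R : ℝ := (S + C) ^ (1 / (p - 1))
  have hx : ∀ᶠ k in (U : Filter κ), ‖(w k).2.2‖ ≤ R := by
    filter_upwards [hw, hs] with k hk h6
    obtain ⟨h1, h2, h3, h4, h5⟩ := hk
    set x := (w k).2.2
    have e1 : ((w k).1.1 : X →L[ℝ] ℝ) x ≤ S * ‖x‖ :=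
      (le_abs_self _).trans (((w k).1.1 : X →L[ℝ] ℝ).le_of_opNorm_le h6 x)
    have e2 : (w k).2.1 (D k x) ≤ 1 * (C * ‖x‖) :=
      (le_abs_self _).trans ((w k).2.1.le_of_opNorm_le_of_le h4 ((D k).le_of_opNorm_le (hD k) x))
    have e3 : 0 ≤ (C * c ^ (-(1 / p))) ^ q * ‖(w k).2.1‖ ^ q := by positivity
    have e4 : ‖x‖ ^ p ≤ (S + C) * ‖x‖ := by linarith [M.norm_le x]
    rcases (norm_nonneg x).eq_or_lt with h0 | h0
    · rw [← h0]; positivity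
    · rw [show R = (S + C) ^ (p - 1)⁻¹ by rw [← one_div],
        Real.le_rpow_inv_iff_of_pos h0.le (by positivity) (by linarith)]
      rw [← sub_add_cancel p 1, Real.rpow_add_one h0.ne'] at e4
      exact le_of_mul_le_mul_right e4 h0
  obtain ⟨x₀, hx₀⟩ := M.exists_weak_limit hp1 U (fun k => (w k).2.2) hx
  obtain ⟨s₀, -, hs₀⟩ := (isCompact_closedBall (0 : W) S).ultrafilter_le_nhds
    (U.map fun k => (w k).1.1) (by
      simp only [Ultrafilter.coe_map, le_principal_iff, mem_map]
      filter_upwards [hs] with k hk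
      exact (dist_zero_right (w k).1.1).trans_le hk)
  have hst : Tendsto (fun k => ‖((w k).1.1 : X →L[ℝ] ℝ) - s₀‖) U (nhds 0) := by
    have : Tendsto (fun k => ((w k).1.1 : X →L[ℝ] ℝ)) U (nhds s₀) :=
      (continuous_subtype_val.tendsto s₀).comp hs₀
    simpa using tendsto_iff_norm_sub_tendsto_zero.1 this
  have hy0 : ∀ φ : X →L[ℝ] ℝ, Tendsto (fun k => φ ((w k).2.2 - x₀)) U (nhds 0) := fun φ => by
    simpa using (hx₀ φ).sub_const (φ x₀)
  have hyB : ∀ᶠ k in (U : Filter κ), ‖(w k).2.2 - x₀‖ ≤ R + ‖x₀‖ := by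
    filter_upwards [hx] with k hk using (norm_sub_le _ _).trans (by gcongr)
  have hlow := M.eventually_asymptotic_lower hp1 hg hc hyB hy0 x₀ (half_pos hε)
  have hDx : Tendsto (fun k => ‖D k x₀‖) U (nhds 0) := by
    simpa using ((hD0 x₀).mono_left hUl).norm
  have hlim : Tendsto (fun k => ‖((w k).1.1 : X →L[ℝ] ℝ) - s₀‖ * (R + ‖x₀‖) +
      (s₀ : X →L[ℝ] ℝ) ((w k).2.2 - x₀) + ‖D k x₀‖) U (nhds 0) := by
    simpa using ((hst.mul_const (R + ‖x₀‖)).add (hy0 s₀)).add hDx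
  obtain ⟨k, hk1, hk2, hk3, hk4⟩ := ((hlim.eventually (gt_mem_nhds (half_pos hε))).and
    (hw.and (hlow.and hyB))).exists
  obtain ⟨h1, h2, h3, h4, h5⟩ := hk2
  set s : X →L[ℝ] ℝ := ((w k).1.1 : X →L[ℝ] ℝ)
  set x := (w k).2.2
  set z := (w k).2.1
  have e1 : s x = s x₀ + (s - s₀) (x - x₀) + (s₀ : X →L[ℝ] ℝ) (x - x₀) := by
    simp only [sub_apply, map_sub]; ring
  have e2 : z (D k x) = z (D k x₀) + z (D k (x - x₀)) := by
    simp only [map_sub]; ring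
  have e3 : (s - s₀) (x - x₀) ≤ ‖s - s₀‖ * (R + ‖x₀‖) :=
    (le_abs_self _).trans ((s - s₀).le_of_opNorm_le_of_le le_rfl hk4)
  have e4 : z (D k x₀) ≤ 1 * ‖D k x₀‖ := (le_abs_self _).trans (z.le_of_opNorm_le h4 _)
  have e5 : z (D k (x - x₀)) ≤ ‖z‖ * (C * ‖x - x₀‖) :=
    (le_abs_self _).trans (z.le_of_opNorm_le_of_le le_rfl ((D k).le_of_opNorm_le (hD k) _))
  have e6 : ‖z‖ * (C * ‖x - x₀‖) ≤
      c * ‖x - x₀‖ ^ p + (C * c ^ (-(1 / p))) ^ q * ‖z‖ ^ q := by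
    have hy := Real.young_inequality_of_nonneg (a := c ^ (1 / p) * ‖x - x₀‖)
      (b := C * c ^ (-(1 / p)) * ‖z‖) (by positivity) (by positivity) hpq
    have f1 : c ^ (1 / p) * c ^ (-(1 / p)) = 1 := by
      rw [← Real.rpow_add hc0, add_neg_cancel, Real.rpow_zero]
    have f2 : (c ^ (1 / p) * ‖x - x₀‖) ^ p = c * ‖x - x₀‖ ^ p := by
      rw [Real.mul_rpow (by positivity) (norm_nonneg _), ← Real.rpow_mul hc0.le,
        one_div_mul_cancel hp0.ne', Real.rpow_one]
    have f3 : c ^ (1 / p) * ‖x - x₀‖ * (C * c ^ (-(1 / p)) * ‖z‖) = ‖z‖ * (C * ‖x - x₀‖) := by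
      linear_combination (C * ‖z‖ * ‖x - x₀‖) * f1
    rw [f2, f3, Real.mul_rpow (by positivity) (norm_nonneg z)] at hy
    refine hy.trans (add_le_add ?_ ?_)
    · exact div_le_self (by positivity) hp1.le
    · exact div_le_self (by positivity) hpq.symm.lt.le
  rw [add_sub_cancel] at hk3
  linarith [h3 x₀]

end SmoothModel

end

section

variable {p : ℝ} {X : Type*} [NormedAddCommGroup X] [NormedSpace ℝ X]

lemma exists_seq_mem_of_history {ι : Type*} {l : Filter ι} [l.NeBot] {A : List ι → Set ι}
    (hA : ∀ t, A t ∈ l) (a : ι) :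
    ∃ (P : ℕ → ι) (L : ℕ → List ι), P 0 = a ∧ (∀ n, (L n).length = n + 1) ∧
      (∀ j n, j ≤ n → P j ∈ L n) ∧ (∀ j n, j ≤ n → L j <:+ L n) ∧
      ∀ n m, n < m → P m ∈ A (L n) := by
  have hex : ∀ t : List ι, ∃ b, ∀ s ∈ t.tails, b ∈ A s := fun t =>
    ((eventually_all_finite t.tails.finite_toSet).2 fun s _ => hA s).exists
  choose nxt hnxt using hex
  let L : ℕ → List ι := fun n => Nat.rec [a] (fun _ t => nxt t :: t) n
  have hL : ∀ n, L (n + 1) = nxt (L n) :: L n := fun _ => rfl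
  let P : ℕ → ι := fun n => Nat.casesOn n a fun k => nxt (L k)
  have hP : ∀ n, P (n + 1) = nxt (L n) := fun _ => rfl
  have hsuf : ∀ j n, j ≤ n → L j <:+ L n := fun j n h => by
    induction n, h using Nat.le_induction with
    | base => exact List.suffix_rfl
    | succ n _ ih => exact ih.trans (hL n ▸ List.suffix_cons _ _)
  have hPL : ∀ n, P n ∈ L n := by
    rintro (_ | n)
    · exact List.mem_singleton_self a
    · rw [hL, hP]
      exact List.mem_cons_self
  refine ⟨P, L, rfl, fun n => ?_, fun j n h => (hsuf j n h).subset (hPL j), hsuf, ?_⟩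
  · induction n with
    | zero => rfl
    | succ n ih => rw [hL, List.length_cons, ih]
  · rintro n (_ | m) h
    · omega
    · rw [hP]
      exact hnxt _ _ ((List.mem_tails _ _).2 (hsuf n m (by omega)))

/-- A sequence of finite rank operators converging to the identity, almost commuting, whose
differences satisfy upper estimates, together with unit vectors `x k` on which the operators
switch from `0` to almost the identity after stage `k`. -/
structure BlockSystem (M : SmoothModel p X) (Λ q K ρ : ℝ) (ε : ℕ → ℝ) where
  P : ℕ → FiniteRankOp p Λ X
  W : ℕ → Submodule ℝ X
  Z : ℕ → Submodule ℝ (X →L[ℝ] ℝ)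
  x : ℕ → X
  P_zero : (P 0).toCLM = 0
  mem_W : ∀ j n, j ≤ n → ∀ u, (P j).toCLM u ∈ W n
  mem_Z : ∀ j n, j ≤ n → ∀ z : X →L[ℝ] ℝ, z ∘L (P j).toCLM ∈ Z n
  upper : ∀ n a b, n < a → n < b → ∀ y ∈ W n, ‖y‖ ≤ ρ → ∀ u : X, ‖u‖ ≤ 1 →
    M.Φ (y + ((P b).toCLM - (P a).toCLM) u) ≤
      M.Φ y + 2 * M.Φ (((P b).toCLM - (P a).toCLM) u) + ε n
  dual_upper : ∀ n a b, n < a → n < b → ∀ s ∈ Z n, ∀ m, 0 ≤ m → m ≤ ρ →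
    (∀ x, s x ≤ M.Φ x + m) → ∀ z : X →L[ℝ] ℝ, ‖z‖ ≤ 1 →
      ∀ x, s x + z (((P b).toCLM - (P a).toCLM) x) ≤ M.Φ x + (m + K * ‖z‖ ^ q + ε n)
  comp_left : ∀ j n m, j ≤ n → n < m → ‖(P m).toCLM ∘L (P j).toCLM - (P j).toCLM‖ ≤ ε n
  comp_right : ∀ j n m, j ≤ n → n < m → ‖(P j).toCLM ∘L (P m).toCLM - (P j).toCLM‖ ≤ ε n
  tendsto : ∀ u, Tendsto (fun n => (P n).toCLM u) atTop (nhds u)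
  norm_x : ∀ k, ‖x k‖ = 1
  map_x_eq_zero : ∀ j k, j ≤ k → (P j).toCLM (x k) = 0
  map_x_near : ∀ k n m, k ≤ n → n < m → ‖(P m).toCLM (x k) - x k‖ ≤ ε n

lemma exists_norm_eq_one_map_eq_zero {Λ : ℝ} (hinf : ¬ FiniteDimensional ℝ X)
    (t : List (FiniteRankOp p Λ X)) : ∃ x : X, ‖x‖ = 1 ∧ ∀ Q ∈ t, Q.toCLM x = 0 := by
  let F : X →ₗ[ℝ] ∀ i : Fin t.length, Fin (t.get i).n → ℝ :=
    LinearMap.pi fun i => LinearMap.pi fun k => ((t.get i).r k : X →ₗ[ℝ] ℝ)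
  have hF : LinearMap.ker F ≠ ⊥ := fun h =>
    hinf (FiniteDimensional.of_injective F (LinearMap.ker_eq_bot.1 h))
  obtain ⟨x, hx, hx0⟩ := Submodule.exists_mem_ne_zero_of_ne_bot hF
  refine ⟨‖x‖⁻¹ • x, norm_smul_inv_norm hx0, fun Q hQ => ?_⟩
  obtain ⟨i, rfl⟩ := List.get_of_mem hQ
  have : ∀ k, (t.get i).r k x = 0 := fun k => congrFun (congrFun (LinearMap.mem_ker.1 hx) i) k
  rw [map_smul, FiniteRankOp.toCLM_apply, Finset.sum_eq_zero fun k _ => by rw [this, zero_smul],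
    smul_zero]

/-- Strong convergence on a dense sequence suffices for uniformly bounded operators. -/
lemma tendsto_apply_of_denseRange {T : ℕ → X →L[ℝ] X} {C : ℝ} (hT : ∀ n, ‖T n‖ ≤ C) {e : ℕ → X}
    (he : DenseRange e) (h : ∀ j, Tendsto (fun n => T n (e j)) atTop (nhds (e j))) (u : X) :
    Tendsto (fun n => T n u) atTop (nhds u) := by
  have hC : 0 ≤ C := (norm_nonneg _).trans (hT 0)
  rw [Metric.tendsto_atTop]
  intro δ hδ
  obtain ⟨j, hj⟩ := Metric.denseRange_iff.1 he u (δ / (2 * (C + 1))) (by positivity)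
  obtain ⟨N, hN⟩ := Metric.tendsto_atTop.1 (h j) (δ / 2) (half_pos hδ)
  refine ⟨N, fun n hn => ?_⟩
  have h1 : T n u - u = T n (u - e j) + (T n (e j) - e j) + (e j - u) := by
    rw [map_sub]; abel
  have h2 := (T n).le_of_opNorm_le (hT n) (u - e j)
  have h3 := hN n hn
  rw [dist_eq_norm] at *
  rw [h1]
  have h4 : (C + 1) * ‖u - e j‖ < δ / 2 := by
    rw [lt_div_iff₀ (by positivity)] at hj
    linarith
  refine (norm_add₃_le).trans_lt ?_
  rw [norm_sub_rev (e j) u]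
  linarith

namespace SmoothModel

theorem exists_blockSystem (M : SmoothModel p X) [CompleteSpace X] (hp1 : 1 < p) {q : ℝ}
    (hpq : p.HolderConjugate q)
    {g : ℕ → X →L[ℝ] ℝ} (hg : ∀ x, (∀ j, g j x = 0) → x = 0) {c : ℝ} (hc0 : 0 < c)
    (hc : ∀ (u : X) (y : ℕ → X) (B : ℝ), (∀ n, ‖y n‖ ≤ B) →
      (∀ φ : X →L[ℝ] ℝ, Tendsto (fun n => φ (y n)) atTop (nhds 0)) → ∀ ε > 0,
        ∀ᶠ n in atTop, M.Φ u + c * ‖y n‖ ^ p - ε ≤ M.Φ (u + y n))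
    (hinf : ¬ FiniteDimensional ℝ X) {Λ : ℝ} (hΛ : 0 ≤ Λ) {𝓕 : Filter (FiniteRankOp p Λ X)}
    [𝓕.NeBot] (h𝓕 : ∀ e, Tendsto (fun P => P.toCLM e) 𝓕 (nhds e))
    (h𝓕' : ∀ g : X →L[ℝ] ℝ, Tendsto (fun P => g ∘L P.toCLM) 𝓕 (nhds g))
    {ε : ℕ → ℝ} (hε : ∀ n, 0 < ε n) (hε0 : Tendsto ε atTop (nhds 0)) (ρ : ℝ) :
    Nonempty (BlockSystem M Λ q ((2 * Λ * c ^ (-(1 / p))) ^ q) ρ ε) := by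
  have hp0 : 0 < p := by linarith
  have := M.separableSpace_of_separating hp1 hg
  set e : ℕ → X := TopologicalSpace.denseSeq X
  choose x hx1 hx0 using exists_norm_eq_one_map_eq_zero (p := p) (Λ := Λ) hinf
  let W : List (FiniteRankOp p Λ X) → Submodule ℝ X := fun t =>
    Submodule.span ℝ (⋃ Q ∈ {Q | Q ∈ t}, Set.range Q.v)
  let Z : List (FiniteRankOp p Λ X) → Submodule ℝ (X →L[ℝ] ℝ) := fun t =>
    Submodule.span ℝ (⋃ Q ∈ {Q | Q ∈ t}, Set.range Q.r)
  have hW : ∀ t, FiniteDimensional ℝ (W t) := fun t => FiniteDimensional.span_of_finite ℝ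
    (t.finite_toSet.biUnion fun Q _ => Set.finite_range _)
  have hZ : ∀ t, FiniteDimensional ℝ (Z t) := fun t => FiniteDimensional.span_of_finite ℝ
    (t.finite_toSet.biUnion fun Q _ => Set.finite_range _)
  let D : FiniteRankOp p Λ X × FiniteRankOp p Λ X → X →L[ℝ] X := fun k => k.2.toCLM - k.1.toCLM
  have hD : ∀ k, ‖D k‖ ≤ 2 * Λ := fun k => by
    have h1 := k.1.norm_toCLM_le hp0 hΛ
    have h2 := k.2.norm_toCLM_le hp0 hΛ
    exact (norm_sub_le _ _).trans (by linarith)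
  have hD1 : ∀ u, Tendsto (fun k => D k u) (𝓕 ×ˢ 𝓕) (nhds 0) := fun u => by
    simpa [D] using ((h𝓕 u).comp tendsto_snd).sub ((h𝓕 u).comp tendsto_fst)
  have hD2 : ∀ φ : X →L[ℝ] ℝ, Tendsto (fun k => φ ∘L D k) (𝓕 ×ˢ 𝓕) (nhds 0) := fun φ => by
    simpa [D] using ((h𝓕' φ).comp tendsto_snd).sub ((h𝓕' φ).comp tendsto_fst)
  have hnear : ∀ {Y : Type _} [NormedAddCommGroup Y] {T : FiniteRankOp p Λ X → Y} {T₀ : Y} {δ : ℝ},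
      0 < δ → Tendsto T 𝓕 (nhds T₀) → ∀ᶠ P in 𝓕, ‖T P - T₀‖ ≤ δ := fun hδ h => by
    filter_upwards [(tendsto_iff_norm_sub_tendsto_zero.1 h).eventually (gt_mem_nhds hδ)]
      with P hP using hP.le
  have key : ∀ t : List (FiniteRankOp p Λ X), ∃ A ∈ 𝓕, ∀ P ∈ A,
      ((∀ Q ∈ t, ‖P.toCLM ∘L Q.toCLM - Q.toCLM‖ ≤ ε (t.length - 1)) ∧
      (∀ Q ∈ t, ‖Q.toCLM ∘L P.toCLM - Q.toCLM‖ ≤ ε (t.length - 1)) ∧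
      (∀ s ∈ t.tails, ‖P.toCLM (x s) - x s‖ ≤ ε (t.length - 1)) ∧
      ∀ j ∈ Finset.range t.length, ‖P.toCLM (e j) - e j‖ ≤ ε (t.length - 1)) ∧
      ∀ P' ∈ A, (∀ y ∈ W t, ‖y‖ ≤ ρ → ∀ u : X, ‖u‖ ≤ 1 →
        M.Φ (y + D (P, P') u) ≤ M.Φ y + 2 * M.Φ (D (P, P') u) + ε (t.length - 1)) ∧
        ∀ s ∈ Z t, ∀ m, 0 ≤ m → m ≤ ρ → (∀ x, s x ≤ M.Φ x + m) →
          ∀ z : X →L[ℝ] ℝ, ‖z‖ ≤ 1 → ∀ x, s x + z (D (P, P') x) ≤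
            M.Φ x + (m + (2 * Λ * c ^ (-(1 / p))) ^ q * ‖z‖ ^ q + ε (t.length - 1)) := by
    intro t
    have hδ := hε (t.length - 1)
    obtain ⟨A, hA, hA'⟩ := eventually_prod_self_iff'.1
      ((M.eventually_upper hp1 hD hD2 (W t) ρ hδ).and
        (M.eventually_dual_upper hp1 hpq hg hc0 hc hD hD1 (Z t) ρ hδ))
    have h1 : ∀ᶠ P in 𝓕, ∀ Q ∈ t, ‖P.toCLM ∘L Q.toCLM - Q.toCLM‖ ≤ ε (t.length - 1) :=
      (eventually_all_finite t.finite_toSet).2 fun Q _ => hnear hδ (Q.tendsto_comp_left h𝓕)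
    have h2 : ∀ᶠ P in 𝓕, ∀ Q ∈ t, ‖Q.toCLM ∘L P.toCLM - Q.toCLM‖ ≤ ε (t.length - 1) :=
      (eventually_all_finite t.finite_toSet).2 fun Q _ => hnear hδ (Q.tendsto_comp_right h𝓕')
    have h3 : ∀ᶠ P in 𝓕, ∀ s ∈ t.tails, ‖P.toCLM (x s) - x s‖ ≤ ε (t.length - 1) :=
      (eventually_all_finite t.tails.finite_toSet).2 fun s _ => hnear hδ (h𝓕 _)
    have h4 : ∀ᶠ P in 𝓕, ∀ j ∈ Finset.range t.length,
        ‖P.toCLM (e j) - e j‖ ≤ ε (t.length - 1) :=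
      (eventually_all_finset _).2 fun j _ => hnear hδ (h𝓕 _)
    refine ⟨_, inter_mem hA (h1.and (h2.and (h3.and h4))), fun P hP => ⟨hP.2, fun P' hP' => ?_⟩⟩
    exact hA' P hP.1 P' hP'.1
  choose A hA hA' using key
  obtain ⟨P, L, hP0, hlen, hPL, hsuf, hPA⟩ :=
    exists_seq_mem_of_history hA (FiniteRankOp.zero hp0 hΛ)
  have hlen' : ∀ n, (L n).length - 1 = n := fun n => by rw [hlen]; rfl
  have mem : ∀ n a, n < a → _ := fun n a h => hA' (L n) (P a) (hPA n a h)
  simp only [hlen'] at mem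
  exact ⟨{
    P := P
    W := fun n => W (L n)
    Z := fun n => Z (L n)
    x := fun n => x (L n)
    P_zero := by rw [hP0, FiniteRankOp.toCLM_zero]
    mem_W := fun j n h u => Submodule.span_mono
      (Set.subset_biUnion_of_mem (u := fun Q : FiniteRankOp p Λ X => Set.range Q.v) (hPL j n h))
      ((P j).toCLM_mem_span u)
    mem_Z := fun j n h z => Submodule.span_mono
      (Set.subset_biUnion_of_mem (u := fun Q : FiniteRankOp p Λ X => Set.range Q.r) (hPL j n h))
      ((P j).comp_toCLM_mem_span z)
    upper := fun n a b ha hb => ((mem n a ha).2 (P b) (hPA n b hb)).1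
    dual_upper := fun n a b ha hb => ((mem n a ha).2 (P b) (hPA n b hb)).2
    comp_left := fun j n m hj hm => (mem n m hm).1.1 _ (hPL j n hj)
    comp_right := fun j n m hj hm => (mem n m hm).1.2.1 _ (hPL j n hj)
    tendsto := tendsto_apply_of_denseRange (fun n => (P n).norm_toCLM_le hp0 hΛ)
      (TopologicalSpace.denseRange_denseSeq X) fun j => by
        rw [tendsto_iff_norm_sub_tendsto_zero, ← tendsto_add_atTop_iff_nat 1]
        refine squeeze_zero' (Eventually.of_forall fun _ => norm_nonneg _) ?_ hε0
        filter_upwards [eventually_ge_atTop j] with n hn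
        refine (mem n (n + 1) n.lt_succ_self).1.2.2.2 j ?_
        rw [hlen, Finset.mem_range]
        omega
    norm_x := fun k => hx1 _
    map_x_eq_zero := fun j k h => hx0 _ _ (hPL j k h)
    map_x_near := fun k n m hk hm => (mem n m hm).1.2.2.1 _
      ((List.mem_tails _ _).2 (hsuf k n hk)) }⟩

end SmoothModel

end

section

variable {p : ℝ} {X : Type*} [NormedAddCommGroup X] [NormedSpace ℝ X]

namespace BlockSystem

variable {M : SmoothModel p X} {Λ q K ρ : ℝ} {ε : ℕ → ℝ}

/-- The difference `P b - P a`. -/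
noncomputable def diff (S : BlockSystem M Λ q K ρ ε) (a b : ℕ) : X →L[ℝ] X :=
  (S.P b).toCLM - (S.P a).toCLM

lemma norm_P_le (S : BlockSystem M Λ q K ρ ε) (hp0 : 0 < p) (hΛ : 0 ≤ Λ) (n : ℕ) :
    ‖(S.P n).toCLM‖ ≤ Λ := (S.P n).norm_toCLM_le hp0 hΛ

lemma norm_diff_le (S : BlockSystem M Λ q K ρ ε) (hp0 : 0 < p) (hΛ : 0 ≤ Λ) (a b : ℕ) :
    ‖S.diff a b‖ ≤ 2 * Λ := by
  have h1 := S.norm_P_le hp0 hΛ a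
  have h2 := S.norm_P_le hp0 hΛ b
  exact (norm_sub_le _ _).trans (by linarith)

lemma Φ_diff_le (S : BlockSystem M Λ q K ρ ε) (hp0 : 0 < p) (hΛ : 0 ≤ Λ) (a b : ℕ) (u : X) :
    M.Φ (S.diff a b u) ≤ |M.bound| * (2 * Λ) ^ p * ‖u‖ ^ p := by
  rw [mul_assoc, ← Real.mul_rpow (by positivity) (norm_nonneg u)]
  exact (M.le_norm _).trans <| mul_le_mul (le_abs_self _) (Real.rpow_le_rpow (norm_nonneg _)
    ((S.diff a b).le_of_opNorm_le (S.norm_diff_le hp0 hΛ a b) u) hp0.le) (by positivity)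
    (abs_nonneg _)

lemma Φ_sum_diff_le (S : BlockSystem M Λ q K ρ ε) (hp1 : 1 < p) (hΛ : 0 ≤ Λ) (hε : ∀ n, 0 ≤ ε n)
    {E : ℝ} (hρ0 : 0 ≤ ρ) (hρ : 2 * (|M.bound| * (2 * Λ) ^ p) + E ≤ ρ ^ p) {a b : ℕ → ℕ}
    (hab : ∀ j, a j ≤ b j) (s : Finset ℕ) (hs : ∀ i ∈ s, ∀ j ∈ s, i < j → b i < a j)
    (hE : ∑ j ∈ s, ε (a j - 1) ≤ E) (y : ℕ → X) (hy : ∑ j ∈ s, ‖y j‖ ^ p ≤ 1) :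
    M.Φ (∑ j ∈ s, S.diff (a j) (b j) (y j)) ≤
      ∑ j ∈ s, (2 * (|M.bound| * (2 * Λ) ^ p) * ‖y j‖ ^ p + ε (a j - 1)) := by
  classical
  have hp0 : 0 < p := by linarith
  induction s using Finset.induction_on_max with
  | empty => simp [M.Φ_zero hp1]
  | insert m s hm ih =>
    have hms : m ∉ s := fun h => (hm m h).false
    rw [Finset.sum_insert hms] at hE hy
    have h1 := ih (fun i hi j hj => hs i (Finset.mem_insert_of_mem hi) j
      (Finset.mem_insert_of_mem hj)) (by linarith [hε (a m - 1)])
      (by linarith [Real.rpow_nonneg (norm_nonneg (y m)) p])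
    rw [Finset.sum_insert hms, Finset.sum_insert hms, add_comm (S.diff _ _ _)]
    have h2 := S.Φ_diff_le hp0 hΛ (a m) (b m) (y m)
    have h3 := M.Φ_nonneg (S.diff (a m) (b m) (y m))
    rcases s.eq_empty_or_nonempty with rfl | ⟨i, hi⟩
    · simp only [Finset.sum_empty, zero_add, add_zero]
      linarith [hε (a m - 1)]
    · have hbm : ∀ j ∈ s, b j < a m := fun j hj =>
        hs j (Finset.mem_insert_of_mem hj) m (Finset.mem_insert_self m s) (hm j hj)
      have him := hbm i hi
      have h4 := S.upper (a m - 1) (a m) (b m) (by omega) (by have := hab m; omega)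
        (∑ j ∈ s, S.diff (a j) (b j) (y j)) (Submodule.sum_mem _ fun j hj => by
          have hj1 := hbm j hj
          have hj2 := hab j
          exact Submodule.sub_mem _ (S.mem_W _ _ (by omega) _) (S.mem_W _ _ (by omega) _)) (by
          rw [← Real.rpow_le_rpow_iff (norm_nonneg _) hρ0 hp0]
          refine (M.norm_le _).trans (h1.trans (le_trans ?_ hρ))
          rw [Finset.sum_add_distrib, ← Finset.mul_sum]
          refine add_le_add ?_ (by linarith [hε (a m - 1)])
          refine mul_le_of_le_one_right (by positivity) ?_
          linarith [Real.rpow_nonneg (norm_nonneg (y m)) p]) (y m) (by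
          have : ‖y m‖ ^ p ≤ 1 := by
            have : 0 ≤ ∑ j ∈ s, ‖y j‖ ^ p := Finset.sum_nonneg fun _ _ => by positivity
            linarith
          rwa [← Real.one_rpow p, Real.rpow_le_rpow_iff (norm_nonneg _) zero_le_one hp0] at this)
      change _ ≤ _ + 2 * M.Φ (S.diff (a m) (b m) (y m)) + _ at h4
      change M.Φ (_ + S.diff (a m) (b m) (y m)) ≤ _ at h4
      linarith

/-- Upper `p`-estimate for separated families of blocks. -/
lemma norm_sum_diff_le (S : BlockSystem M Λ q K ρ ε) (hp1 : 1 < p) (hΛ : 0 ≤ Λ)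
    (hε : ∀ n, 0 ≤ ε n) {E : ℝ} (hρ0 : 0 ≤ ρ) (hρ : 2 * (|M.bound| * (2 * Λ) ^ p) + E ≤ ρ ^ p)
    {a b : ℕ → ℕ} (hab : ∀ j, a j ≤ b j) (s : Finset ℕ)
    (hs : ∀ i ∈ s, ∀ j ∈ s, i < j → b i < a j) (hE : ∑ j ∈ s, ε (a j - 1) ≤ E) (y : ℕ → X) :
    ‖∑ j ∈ s, S.diff (a j) (b j) (y j)‖ ≤ ρ * (∑ j ∈ s, ‖y j‖ ^ p) ^ (1 / p) := by
  have hp0 : 0 < p := by linarith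
  have key : ∀ y : ℕ → X, ∑ j ∈ s, ‖y j‖ ^ p ≤ 1 →
      ‖∑ j ∈ s, S.diff (a j) (b j) (y j)‖ ≤ ρ := fun y hy => by
    rw [← Real.rpow_le_rpow_iff (norm_nonneg _) hρ0 hp0]
    refine (M.norm_le _).trans
      ((S.Φ_sum_diff_le hp1 hΛ hε hρ0 hρ hab s hs hE y hy).trans (le_trans ?_ hρ))
    rw [Finset.sum_add_distrib, ← Finset.mul_sum]
    exact add_le_add (mul_le_of_le_one_right (by positivity) hy) hE
  set T := ∑ j ∈ s, ‖y j‖ ^ p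
  have hT : 0 ≤ T := Finset.sum_nonneg fun _ _ => by positivity
  rcases hT.eq_or_lt with h0 | h0
  · have : ∀ j ∈ s, y j = 0 := fun j hj => by
      have := (Finset.sum_eq_zero_iff_of_nonneg fun _ _ => by positivity).1 h0.symm j hj
      rwa [Real.rpow_eq_zero (norm_nonneg _) hp0.ne', norm_eq_zero] at this
    rw [Finset.sum_eq_zero fun j hj => by rw [this j hj, map_zero], norm_zero]
    positivity
  · set τ := T ^ (1 / p)
    have hτ : 0 < τ := by positivity
    have hτp : τ ^ p = T := by
      rw [← Real.rpow_mul hT, one_div_mul_cancel hp0.ne', Real.rpow_one]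
    have := key (fun j => τ⁻¹ • y j) (by
      simp_rw [norm_smul, norm_inv, Real.norm_of_nonneg hτ.le]
      simp_rw [Real.mul_rpow (inv_nonneg.2 hτ.le) (norm_nonneg _), ← Finset.mul_sum,
        Real.inv_rpow hτ.le, hτp]
      exact (inv_mul_cancel₀ h0.ne').le)
    simp_rw [map_smul, ← Finset.smul_sum] at this
    rw [norm_smul, norm_inv, Real.norm_of_nonneg hτ.le, inv_mul_le_iff₀ hτ] at this
    linarith

lemma dual_sum_diff_le (S : BlockSystem M Λ q K ρ ε) (hp1 : 1 < p) (hpq : p.HolderConjugate q)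
    (hΛ : 0 ≤ Λ) (hK : 0 ≤ K) (hε : ∀ n, 0 ≤ ε n) {E : ℝ} (hρ : (2 * Λ) ^ q + K + E ≤ ρ)
    {a b : ℕ → ℕ} (hab : ∀ j, a j ≤ b j) (s : Finset ℕ)
    (hs : ∀ i ∈ s, ∀ j ∈ s, i < j → b i < a j) (hE : ∑ j ∈ s, ε (a j - 1) ≤ E)
    (z : ℕ → X →L[ℝ] ℝ) (hz : ∑ j ∈ s, ‖z j‖ ^ q ≤ 1) (x : X) :
    ∑ j ∈ s, z j (S.diff (a j) (b j) x) ≤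
      M.Φ x + ∑ j ∈ s, (((2 * Λ) ^ q + K) * ‖z j‖ ^ q + ε (a j - 1)) := by
  classical
  have hp0 : 0 < p := by linarith
  have hq0 : 0 < q := hpq.symm.pos
  induction s using Finset.induction_on_max generalizing x with
  | empty => simpa using M.Φ_nonneg x
  | insert m s hm ih =>
    have hms : m ∉ s := fun h => (hm m h).false
    rw [Finset.sum_insert hms] at hE hz
    have hzs : 0 ≤ ∑ j ∈ s, ‖z j‖ ^ q := Finset.sum_nonneg fun _ _ => by positivity
    have hzm : 0 ≤ ‖z m‖ ^ q := by positivity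
    have h1 := ih (fun i hi j hj => hs i (Finset.mem_insert_of_mem hi) j
      (Finset.mem_insert_of_mem hj)) (by linarith [hε (a m - 1)]) (by linarith)
    rw [Finset.sum_insert hms, Finset.sum_insert hms]
    rcases s.eq_empty_or_nonempty with rfl | ⟨i, hi⟩
    · simp only [Finset.sum_empty, add_zero]
      have h2 : z m (S.diff (a m) (b m) x) ≤ ‖z m‖ * (2 * Λ * ‖x‖) :=
        (le_abs_self _).trans ((z m).le_of_opNorm_le_of_le le_rfl
          ((S.diff _ _).le_of_opNorm_le (S.norm_diff_le hp0 hΛ _ _) x))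
      have h3 := Real.young_inequality_of_nonneg (norm_nonneg x)
        (mul_nonneg (mul_nonneg zero_le_two hΛ) (norm_nonneg (z m))) hpq
      rw [Real.mul_rpow (by positivity) (norm_nonneg _)] at h3
      have h4 : ‖x‖ ^ p / p ≤ M.Φ x := (div_le_self (by positivity) hp1.le).trans (M.norm_le x)
      have h5 : (2 * Λ) ^ q * ‖z m‖ ^ q / q ≤ (2 * Λ) ^ q * ‖z m‖ ^ q :=
        div_le_self (by positivity) hpq.symm.lt.le
      have h6 : 0 ≤ K * ‖z m‖ ^ q := by positivity
      linarith [hε (a m - 1)]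
    · have hbm : ∀ j ∈ s, b j < a m := fun j hj =>
        hs j (Finset.mem_insert_of_mem hj) m (Finset.mem_insert_self m s) (hm j hj)
      have him := hbm i hi
      set m' := ∑ j ∈ s, (((2 * Λ) ^ q + K) * ‖z j‖ ^ q + ε (a j - 1))
      have h4 := S.dual_upper (a m - 1) (a m) (b m) (by omega) (by have := hab m; omega)
        (∑ j ∈ s, z j ∘L S.diff (a j) (b j)) (Submodule.sum_mem _ fun j hj => by
          have hj1 := hbm j hj
          have hj2 := hab j
          rw [diff, ContinuousLinearMap.comp_sub]
          exact Submodule.sub_mem _ (S.mem_Z _ _ (by omega) _) (S.mem_Z _ _ (by omega) _))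
        m' (Finset.sum_nonneg fun j _ => add_nonneg (by positivity) (hε _)) (by
          refine le_trans ?_ hρ
          simp only [m']
          rw [Finset.sum_add_distrib, ← Finset.mul_sum]
          refine add_le_add ?_ (by linarith [hε (a m - 1)])
          exact mul_le_of_le_one_right (by positivity) (by linarith))
        (fun x => by simpa using h1 x) (z m) (by
          have : ‖z m‖ ^ q ≤ 1 := by linarith
          rwa [← Real.one_rpow q, Real.rpow_le_rpow_iff (norm_nonneg _) zero_le_one hq0] at this) x
      change _ + z m (S.diff (a m) (b m) x) ≤ _ at h4
      rw [sum_apply] at h4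
      simp only [ContinuousLinearMap.comp_apply] at h4
      have : 0 ≤ (2 * Λ) ^ q * ‖z m‖ ^ q := by positivity
      linarith

/-- Lower `p`-estimate for separated families of blocks. -/
lemma sum_norm_diff_le (S : BlockSystem M Λ q K ρ ε) (hp1 : 1 < p) (hpq : p.HolderConjugate q)
    (hΛ : 0 ≤ Λ) (hK : 0 ≤ K) (hε : ∀ n, 0 ≤ ε n) {E : ℝ} (hE0 : 0 ≤ E)
    (hρ : (2 * Λ) ^ q + K + E ≤ ρ)
    {a b : ℕ → ℕ} (hab : ∀ j, a j ≤ b j) (s : Finset ℕ)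
    (hs : ∀ i ∈ s, ∀ j ∈ s, i < j → b i < a j) (hE : ∑ j ∈ s, ε (a j - 1) ≤ E) (x : X) :
    ∑ j ∈ s, ‖S.diff (a j) (b j) x‖ ^ p ≤ (|M.bound| + ((2 * Λ) ^ q + K + E)) ^ p * ‖x‖ ^ p := by
  have hp0 : 0 < p := by linarith
  have hq0 : 0 < q := hpq.symm.pos
  set C := |M.bound| + ((2 * Λ) ^ q + K + E)
  have hC : 0 ≤ C := by positivity
  have key : ∀ x : X, ‖x‖ ≤ 1 → ∑ j ∈ s, ‖S.diff (a j) (b j) x‖ ^ p ≤ C ^ p := by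
    intro x hx
    choose f hf1 hf2 using fun j => exists_dual_vector'' ℝ (S.diff (a j) (b j) x)
    have hmul : ∀ t : ℕ → ℝ, ∑ j ∈ s, |t j| ^ q ≤ 1 →
        ∑ j ∈ s, t j * ‖S.diff (a j) (b j) x‖ ≤ C := fun t ht => by
      have h1 : ∀ j, ‖t j • f j‖ ^ q ≤ |t j| ^ q := fun j => by
        rw [norm_smul]
        exact Real.rpow_le_rpow (by positivity)
          (mul_le_of_le_one_right (norm_nonneg _) (hf1 j)) hq0.le
      have h2 : ∑ j ∈ s, ‖t j • f j‖ ^ q ≤ 1 := (Finset.sum_le_sum fun j _ => h1 j).trans ht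
      have h3 := S.dual_sum_diff_le hp1 hpq hΛ hK hε hρ hab s hs hE (fun j => t j • f j) h2 x
      simp only [smul_apply, hf2, smul_eq_mul] at h3
      refine h3.trans (add_le_add ?_ ?_)
      · refine (M.le_norm x).trans ((mul_le_mul_of_nonneg_right (le_abs_self _)
          (by positivity)).trans (mul_le_of_le_one_right (abs_nonneg _) ?_))
        exact Real.rpow_le_one (norm_nonneg _) hx hp0.le
      · rw [Finset.sum_add_distrib, ← Finset.mul_sum]
        exact add_le_add (mul_le_of_le_one_right (by positivity) h2) hE
    have := sum_rpow_le_of_forall_sum_mul_le s hpq.symm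
      (fun j => ‖S.diff (a j) (b j) x‖) hC fun t => by
        set T := ∑ j ∈ s, |t j| ^ q
        have hT : 0 ≤ T := Finset.sum_nonneg fun _ _ => by positivity
        rcases hT.eq_or_lt with h0 | h0
        · have : ∀ j ∈ s, t j = 0 := fun j hj => by
            have := (Finset.sum_eq_zero_iff_of_nonneg fun _ _ => by positivity).1 h0.symm j hj
            rwa [Real.rpow_eq_zero (abs_nonneg _) hq0.ne', abs_eq_zero] at this
          rw [Finset.sum_eq_zero fun j hj => by rw [this j hj, zero_mul]]
          positivity
        · set τ := T ^ (1 / q)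
          have hτ : 0 < τ := by positivity
          have hτq : τ ^ q = T := by
            rw [← Real.rpow_mul hT, one_div_mul_cancel hq0.ne', Real.rpow_one]
          have := hmul (fun j => τ⁻¹ * t j) (by
            simp_rw [abs_mul, abs_inv, abs_of_pos hτ]
            simp_rw [Real.mul_rpow (inv_nonneg.2 hτ.le) (abs_nonneg _), ← Finset.mul_sum,
              Real.inv_rpow hτ.le, hτq]
            exact (inv_mul_cancel₀ h0.ne').le)
          simp_rw [mul_assoc, ← Finset.mul_sum] at this
          rw [inv_mul_le_iff₀ hτ] at this
          linarith
    simpa using this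
  rcases eq_or_ne x 0 with rfl | hx
  · simp [Real.zero_rpow hp0.ne']
  · have hx0 := norm_pos_iff.2 hx
    have := key (‖x‖⁻¹ • x) (norm_smul_inv_norm hx).le
    simp_rw [map_smul, norm_smul, norm_inv, norm_norm] at this
    simp_rw [Real.mul_rpow (inv_nonneg.2 hx0.le) (norm_nonneg _), ← Finset.mul_sum,
      Real.inv_rpow hx0.le] at this
    rw [inv_mul_le_iff₀ (by positivity)] at this
    linarith

end BlockSystem

end

section

/-- The space of `p`-summable sequences in `E`. -/
abbrev SeqLp (p : ℝ) (E : Type*) [NormedAddCommGroup E] : Type _ :=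
  lp (fun _ : ℕ => E) (ENNReal.ofReal p)

namespace SeqLp

variable {p : ℝ} {E : Type*} [NormedAddCommGroup E]

lemma hasSum_norm (hp : 0 < p) (y : SeqLp p E) : HasSum (fun n => ‖y n‖ ^ p) (‖y‖ ^ p) := by
  have := lp.hasSum_norm (by rwa [ENNReal.toReal_ofReal hp.le]) y
  rwa [ENNReal.toReal_ofReal hp.le] at this

lemma sum_norm_le (hp : 0 < p) (y : SeqLp p E) (s : Finset ℕ) :
    ∑ n ∈ s, ‖y n‖ ^ p ≤ ‖y‖ ^ p :=
  sum_le_hasSum s (fun _ _ => by positivity) (hasSum_norm hp y)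

end SeqLp

variable {p : ℝ} [Fact (1 ≤ ENNReal.ofReal p)]
  {X : Type*} [NormedAddCommGroup X] [NormedSpace ℝ X]
  {E : Type*} [NormedAddCommGroup E] [NormedSpace ℝ E]

namespace SeqLp

/-- The coordinate evaluation. -/
noncomputable def eval (n : ℕ) : SeqLp p E →L[ℝ] E :=
  lp.evalCLM ℝ (fun _ : ℕ => E) (ENNReal.ofReal p) n

@[simp] lemma eval_apply (n : ℕ) (y : SeqLp p E) : eval n y = y n := rfl

/-- Families of operators satisfying a lower `p`-estimate assemble to an operator into
`SeqLp p E`. -/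
lemma exists_analysis (hp : 0 < p) {T : ℕ → X →L[ℝ] E} {C : ℝ} (hC : 0 ≤ C)
    (hT : ∀ (s : Finset ℕ) x, ∑ n ∈ s, ‖T n x‖ ^ p ≤ C ^ p * ‖x‖ ^ p) :
    ∃ A : X →L[ℝ] SeqLp p E, (∀ x, ‖A x‖ ≤ C * ‖x‖) ∧ ∀ x n, A x n = T n x := by
  have hp' : (ENNReal.ofReal p).toReal = p := ENNReal.toReal_ofReal hp.le
  let A : X →ₗ[ℝ] SeqLp p E :=
    { toFun := fun x => ⟨fun n => T n x, memℓp_gen' (C := C ^ p * ‖x‖ ^ p) fun s => by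
        rw [hp']; exact hT s x⟩
      map_add' := fun x y => by ext n; exact map_add (T n) x y
      map_smul' := fun t x => by ext n; exact map_smul (T n) t x }
  have hA : ∀ x, ‖A x‖ ≤ C * ‖x‖ := fun x => by
    refine lp.norm_le_of_forall_sum_le (by rwa [hp']) (by positivity) fun s => ?_
    rw [hp', Real.mul_rpow hC (norm_nonneg x)]
    exact hT s x
  exact ⟨A.mkContinuous C hA, hA, fun _ _ => rfl⟩

/-- Families of operators satisfying an upper `p`-estimate assemble to an operator from
`SeqLp p E`. -/
lemma exists_synthesis [CompleteSpace X] (hp : 0 < p) {T : ℕ → E →L[ℝ] X} {C : ℝ} (hC : 0 ≤ C)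
    (hT : ∀ (s : Finset ℕ) (y : ℕ → E),
      ‖∑ n ∈ s, T n (y n)‖ ≤ C * (∑ n ∈ s, ‖y n‖ ^ p) ^ (1 / p)) :
    ∃ B : SeqLp p E →L[ℝ] X, ∀ y, HasSum (fun n => T n (y n)) (B y) := by
  have hsum : ∀ y : SeqLp p E, Summable fun n => T n (y n) := fun y => by
    rw [summable_iff_vanishing_norm]
    intro δ hδ
    have hδ' : 0 < (δ / (C + 1)) ^ p := by positivity
    obtain ⟨s, hs⟩ := summable_iff_vanishing_norm.1 (hasSum_norm hp y).summable _ hδ'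
    refine ⟨s, fun t ht => (hT t y).trans_lt ?_⟩
    have h0 : 0 ≤ ∑ n ∈ t, ‖y n‖ ^ p := Finset.sum_nonneg fun _ _ => by positivity
    have h1 := hs t ht
    rw [Real.norm_of_nonneg h0] at h1
    have h2 : (∑ n ∈ t, ‖y n‖ ^ p) ^ (1 / p) ≤ δ / (C + 1) := by
      rw [one_div, Real.rpow_inv_le_iff_of_pos h0 (by positivity) hp]
      exact h1.le
    calc C * (∑ n ∈ t, ‖y n‖ ^ p) ^ (1 / p) ≤ C * (δ / (C + 1)) := by gcongr
      _ < (C + 1) * (δ / (C + 1)) := by gcongr; linarith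
      _ = δ := mul_div_cancel₀ _ (by positivity)
  let B : SeqLp p E →ₗ[ℝ] X :=
    { toFun := fun y => ∑' n, T n (y n)
      map_add' := fun y z => by
        simp only [lp.coeFn_add, Pi.add_apply, map_add]
        exact (hsum y).tsum_add (hsum z)
      map_smul' := fun t y => by
        simp only [lp.coeFn_smul, Pi.smul_apply, map_smul, RingHom.id_apply]
        exact (hsum y).tsum_const_smul t }
  have hB : ∀ y, ‖B y‖ ≤ C * ‖y‖ := fun y => by
    refine le_of_tendsto' (hsum y).hasSum.norm fun s => (hT s y).trans ?_
    gcongr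
    rw [one_div, Real.rpow_inv_le_iff_of_pos (Finset.sum_nonneg fun _ _ => by positivity)
      (norm_nonneg _) hp]
    exact sum_norm_le hp y s
  exact ⟨B.mkContinuous C hB, fun y => (hsum y).hasSum⟩

/-- `ℓ_p(ℓ_p)` is isomorphic to `ℓ_p`. -/
theorem nonempty_equiv (hp : 0 < p) : Nonempty (SeqLp p (SeqLp p ℝ) ≃L[ℝ] SeqLp p ℝ) := by
  obtain ⟨F, -, hF⟩ := exists_analysis (p := p) (E := ℝ) hp (C := 1) zero_le_one
    (T := fun m => eval (p := p) (E := ℝ) m.unpair.2 ∘L eval (p := p) (E := SeqLp p ℝ) m.unpair.1)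
    fun s y => by
      classical
      have h1 : ∑ m ∈ s, ‖y m.unpair.1 m.unpair.2‖ ^ p =
          ∑ i ∈ s.map Nat.pairEquiv.symm.toEmbedding, ‖y i.1 i.2‖ ^ p := by
        rw [Finset.sum_map]; rfl
      simp only [ContinuousLinearMap.comp_apply, eval_apply, Real.one_rpow, one_mul]
      rw [h1]
      set t := s.map Nat.pairEquiv.symm.toEmbedding
      have h2 : t ⊆ t.image Prod.fst ×ˢ t.image Prod.snd := Finset.subset_product
      refine (Finset.sum_le_sum_of_subset_of_nonneg h2 fun _ _ _ => by positivity).trans ?_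
      rw [Finset.sum_product]
      exact (Finset.sum_le_sum fun n _ => sum_norm_le hp (y n) _).trans (sum_norm_le hp y _)
  have hrow : ∀ n : ℕ, ∃ A : SeqLp p ℝ →L[ℝ] SeqLp p ℝ,
      ∀ x k, A x k = eval (p := p) (E := ℝ) (Nat.pair n k) x := fun n =>
    (exists_analysis hp zero_le_one fun s x => by
      have h := sum_norm_le hp x (s.map ⟨Nat.pair n, fun a b h => (Nat.pair_eq_pair.1 h).2⟩)
      rw [Finset.sum_map] at h
      simp only [eval_apply, Real.one_rpow, one_mul]
      exact h).imp fun _ h => h.2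
  choose A hA using hrow
  obtain ⟨G, -, hG⟩ := exists_analysis (p := p) hp (C := 1) zero_le_one (T := A) fun s x => by
    have hlim : Tendsto (fun t : Finset ℕ => ∑ n ∈ s, ∑ k ∈ t, ‖A n x k‖ ^ p) atTop
        (nhds (∑ n ∈ s, ‖A n x‖ ^ p)) :=
      tendsto_finsetSum _ fun n _ => hasSum_norm hp (A n x)
    refine le_of_tendsto' hlim fun t => ?_
    have h := sum_norm_le hp x ((s ×ˢ t).map Nat.pairEquiv.toEmbedding)
    rw [Finset.sum_map, Finset.sum_product] at h
    simp only [hA, Real.one_rpow, one_mul]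
    exact h
  refine ⟨ContinuousLinearEquiv.equivOfInverse F G (fun y => ?_) fun x => ?_⟩
  · ext n k
    simp [hG, hA, hF]
  · ext m
    simp [hG, hA, hF]

end SeqLp

/-- Factorisation of a finite rank operator through `ℓ_p`. -/
lemma FiniteRankOp.exists_factorization {Λ : ℝ} (P : FiniteRankOp p Λ X) (hp : 0 < p)
    (hΛ : 0 ≤ Λ) : ∃ (R : X →L[ℝ] SeqLp p ℝ) (V : SeqLp p ℝ →L[ℝ] X),
      (∀ x, ‖R x‖ ≤ Λ * ‖x‖) ∧ (∀ y, ‖V y‖ ≤ ‖y‖) ∧ ∀ x, V (R x) = P.toCLM x := by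
  classical
  obtain ⟨R, hR, hR'⟩ := SeqLp.exists_analysis (p := p) (E := ℝ) (X := X) hp hΛ
    (T := fun k => if h : k < P.n then P.r ⟨k, h⟩ else 0) fun s x => by
      refine le_trans ?_ (P.sum_le x)
      set F : ℕ → ℝ := fun k => ‖(if h : k < P.n then P.r ⟨k, h⟩ else 0 : X →L[ℝ] ℝ) x‖ ^ p
      have h1 : ∑ k, |P.r k x| ^ p = ∑ k ∈ Finset.range P.n, F k := by
        rw [← Fin.sum_univ_eq_sum_range]
        exact Finset.sum_congr rfl fun k _ => by simp [F]
      rw [h1, ← Finset.sum_filter_add_sum_filter_not s (· < P.n),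
        Finset.sum_eq_zero (s := s.filter fun k => ¬ k < P.n), add_zero]
      · refine Finset.sum_le_sum_of_subset_of_nonneg (fun k hk => ?_) fun _ _ _ => by positivity
        exact Finset.mem_range.2 (Finset.mem_filter.1 hk).2
      · intro k hk
        simp [(Finset.mem_filter.1 hk).2, Real.zero_rpow hp.ne']
  let V : SeqLp p ℝ →L[ℝ] X := ∑ k : Fin P.n, (SeqLp.eval (k : ℕ)).smulRight (P.v k)
  have hV : ∀ y, V y = ∑ k : Fin P.n, y k • P.v k := fun y => by simp [V]
  refine ⟨R, V, hR, fun y => ?_, fun x => ?_⟩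
  · rw [← Real.rpow_le_rpow_iff (norm_nonneg _) (norm_nonneg _) hp, hV]
    refine (P.norm_le _).trans ?_
    rw [Fin.sum_univ_eq_sum_range (fun k => |y k| ^ p)]
    exact SeqLp.sum_norm_le hp y _
  · rw [hV, P.toCLM_apply]
    exact Finset.sum_congr rfl fun k _ => by simp [hR']

end

section

lemma exists_leftInverse {X Y : Type*} [NormedAddCommGroup X] [NormedSpace ℝ X] [CompleteSpace X]
    [NormedAddCommGroup Y] [NormedSpace ℝ Y] (A : X →L[ℝ] Y) (B : Y →L[ℝ] X) {C : ℝ} (hC : C < 1)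
    (hC0 : 0 ≤ C) (h : ∀ x, ‖x - B (A x)‖ ≤ C * ‖x‖) : ∃ r : Y →L[ℝ] X, ∀ x, r (A x) = x := by
  have h1 : ‖(1 : X →L[ℝ] X) - B ∘L A‖ < 1 :=
    (ContinuousLinearMap.opNorm_le_bound _ hC0 fun x => h x).trans_lt hC
  let u := Units.oneSub _ h1
  have hu : (u : X →L[ℝ] X) = B ∘L A := by simp [u]
  refine ⟨(↑u⁻¹ : X →L[ℝ] X) ∘L B, fun x => ?_⟩
  have h2 := DFunLike.congr_fun (u.inv_mul) x
  rw [hu] at h2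
  exact h2

lemma sum_eq_sum_filter_mod {k : ℕ} (hk : 0 < k) {G : Type*} [AddCommMonoid G] (s : Finset ℕ)
    (f : ℕ → G) : ∑ n ∈ s, f n = ∑ r ∈ Finset.range k, ∑ n ∈ s with n % k = r, f n :=
  (Finset.sum_fiberwise_of_maps_to (fun n _ => Finset.mem_range.2 (Nat.mod_lt n hk)) f).symm

lemma add_le_of_mod_eq {k i j r : ℕ} (hi : i % k = r) (hj : j % k = r) (h : i < j) :
    i + k ≤ j := by
  have h1 : i ≡ j [MOD k] := hi.trans hj.symm
  have := Nat.le_of_dvd (by omega) ((Nat.modEq_iff_dvd' h.le).1 h1)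
  omega

variable {p : ℝ} {X : Type*} [NormedAddCommGroup X] [NormedSpace ℝ X]

namespace BlockSystem

variable {M : SmoothModel p X} {Λ q K ρ : ℝ} {ε : ℕ → ℝ} (S : BlockSystem M Λ q K ρ ε)

/-- Lower `p`-estimate for the sequence of all blocks. -/
lemma sum_norm_block_le (hp1 : 1 < p) (hpq : p.HolderConjugate q)
    (hΛ : 0 ≤ Λ) (hK : 0 ≤ K) (hε : ∀ n, 0 ≤ ε n) {E : ℝ} (hE0 : 0 ≤ E)
    (hρ : (2 * Λ) ^ q + K + E ≤ ρ) (hE : ∀ s : Finset ℕ, ∑ j ∈ s, ε (j - 1) ≤ E)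
    (s : Finset ℕ) (x : X) : ∑ j ∈ s, ‖S.diff j (j + 1) x‖ ^ p ≤
      (2 * (|M.bound| + ((2 * Λ) ^ q + K + E))) ^ p * ‖x‖ ^ p := by
  set C := |M.bound| + ((2 * Λ) ^ q + K + E)
  have hC : 0 ≤ C := by positivity
  have h2 : (2 : ℝ) ≤ 2 ^ p := Real.self_le_rpow_of_one_le one_le_two hp1.le
  calc ∑ j ∈ s, ‖S.diff j (j + 1) x‖ ^ p
      ≤ ∑ _r ∈ Finset.range 2, C ^ p * ‖x‖ ^ p := by
        rw [sum_eq_sum_filter_mod two_pos]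
        refine Finset.sum_le_sum fun r _ => ?_
        refine S.sum_norm_diff_le hp1 hpq hΛ hK hε hE0 hρ (a := fun j => j)
          (fun j => Nat.le_succ j) _ (fun i hi j hj hij => ?_) (hE _) x
        have := add_le_of_mod_eq (Finset.mem_filter.1 hi).2 (Finset.mem_filter.1 hj).2 hij
        omega
    _ = 2 * (C ^ p * ‖x‖ ^ p) := by simp
    _ ≤ (2 * C) ^ p * ‖x‖ ^ p := by
        rw [Real.mul_rpow zero_le_two hC, mul_assoc]
        gcongr

/-- Upper `p`-estimate for the sequence of all enlarged blocks. -/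
lemma norm_sum_enlarged_le (hp1 : 1 < p) (hΛ : 0 ≤ Λ)
    (hε : ∀ n, 0 ≤ ε n) {E : ℝ} (hρ0 : 0 ≤ ρ) (hρ : 2 * (|M.bound| * (2 * Λ) ^ p) + E ≤ ρ ^ p)
    (hE : ∀ s : Finset ℕ, ∑ j ∈ s, ε (j - 1 - 1) ≤ E) (s : Finset ℕ) (y : ℕ → X) :
    ‖∑ j ∈ s, S.diff (j - 1) (j + 2) (y j)‖ ≤ 4 * ρ * (∑ j ∈ s, ‖y j‖ ^ p) ^ (1 / p) := by
  have hp0 : 0 < p := by linarith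
  rw [sum_eq_sum_filter_mod (k := 4) (by norm_num)]
  calc _ ≤ ∑ _r ∈ Finset.range 4, ρ * (∑ j ∈ s, ‖y j‖ ^ p) ^ (1 / p) := by
        refine norm_sum_le_of_le _ fun r _ => ?_
        refine (S.norm_sum_diff_le hp1 hΛ hε hρ0 hρ (a := fun j => j - 1) (b := fun j => j + 2)
          (fun j => by omega) _ (fun i hi j hj hij => ?_) (hE _) y).trans ?_
        · have := add_le_of_mod_eq (Finset.mem_filter.1 hi).2 (Finset.mem_filter.1 hj).2 hij
          omega
        · gcongr
          exact Finset.filter_subset _ _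
    _ = _ := by simp; ring

lemma norm_enlarged_comp_block_le (hp0 : 0 < p) (hΛ : 0 ≤ Λ) (hanti : Antitone ε) (n : ℕ) (x : X) :
    ‖S.diff n (n + 1) x - S.diff (n - 1) (n + 2) ((S.P (n + 2)).toCLM (S.diff n (n + 1) x))‖ ≤
      (4 * Λ + 4) * ε (n - 1 - 1) * ‖x‖ := by
  set D := S.diff n (n + 1)
  set P := fun n => (S.P n).toCLM
  have h1 : ‖P (n + 2) ∘L D - D‖ ≤ 2 * ε (n - 1 - 1) := by
    have e : P (n + 2) ∘L D - D = (P (n + 2) ∘L P (n + 1) - P (n + 1)) -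
        (P (n + 2) ∘L P n - P n) := by
      simp only [D, diff, P, ContinuousLinearMap.comp_sub]
      abel
    have a1 := S.comp_left (n + 1) (n + 1) (n + 2) le_rfl (by omega)
    have a2 := S.comp_left n (n + 1) (n + 2) (by omega) (by omega)
    have a3 := hanti (show n - 1 - 1 ≤ n + 1 by omega)
    rw [e]
    refine (norm_sub_le _ _).trans ?_
    linarith
  have h2 : ‖P (n - 1) ∘L D‖ ≤ 2 * ε (n - 1 - 1) := by
    rcases Nat.eq_zero_or_pos n with rfl | hn
    · have : P (0 - 1) = 0 := S.P_zero
      rw [this, ContinuousLinearMap.zero_comp, norm_zero]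
      have := (norm_nonneg _).trans (S.comp_left 0 0 1 le_rfl one_pos)
      simpa using this
    · have e : P (n - 1) ∘L D = (P (n - 1) ∘L P (n + 1) - P (n - 1)) -
          (P (n - 1) ∘L P n - P (n - 1)) := by
        simp only [D, diff, P, ContinuousLinearMap.comp_sub]
        abel
      have a1 := S.comp_right (n - 1) n (n + 1) (by omega) (by omega)
      have a2 := S.comp_right (n - 1) (n - 1) n le_rfl (by omega)
      have a3 := hanti (show n - 1 - 1 ≤ n by omega)
      have a4 := hanti (show n - 1 - 1 ≤ n - 1 by omega)
      rw [e]
      refine (norm_sub_le _ _).trans ?_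
      linarith
  have h3 : D x - S.diff (n - 1) (n + 2) (P (n + 2) (D x)) =
      -(S.diff (n - 1) (n + 2) ((P (n + 2) ∘L D - D) x)) - (P (n + 2) ∘L D - D) x +
        (P (n - 1) ∘L D) x := by
    simp only [diff, P, sub_apply, ContinuousLinearMap.comp_apply, map_sub]
    abel
  change ‖D x - S.diff (n - 1) (n + 2) (P (n + 2) (D x))‖ ≤ _
  rw [h3]
  have b1 := (P (n + 2) ∘L D - D).le_of_opNorm_le h1 x
  have b2 := (P (n - 1) ∘L D).le_of_opNorm_le h2 x
  have b3 := (S.diff (n - 1) (n + 2)).le_of_opNorm_le_of_le (S.norm_diff_le hp0 hΛ _ _) b1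
  refine (norm_add_le _ _).trans ((add_le_add_left (norm_sub_le _ _) _).trans ?_)
  rw [norm_neg]
  linarith

lemma tendsto_sum_block (x : X) :
    Tendsto (fun N => ∑ n ∈ Finset.range N, S.diff n (n + 1) x) atTop (nhds x) := by
  have h : ∀ N, ∑ n ∈ Finset.range N, S.diff n (n + 1) x = (S.P N).toCLM x := fun N => by
    have := Finset.sum_range_sub (fun n => (S.P n).toCLM x) N
    rw [S.P_zero] at this
    simpa [diff] using this
  simp_rw [h]
  exact S.tendsto x

variable [Fact (1 ≤ ENNReal.ofReal p)] [CompleteSpace X]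

/-- A space with a block system is complemented in `ℓ_p(ℓ_p)`. -/
theorem exists_retract (S : BlockSystem M Λ q K ρ ε) (hp1 : 1 < p) (hpq : p.HolderConjugate q)
    (hΛ : 0 ≤ Λ) (hK : 0 ≤ K) (hε : ∀ n, 0 ≤ ε n) (hanti : Antitone ε) {E : ℝ} (hE0 : 0 ≤ E)
    (hρ : (2 * Λ) ^ q + K + E ≤ ρ) (hρ' : 2 * (|M.bound| * (2 * Λ) ^ p) + E ≤ ρ ^ p)
    (hE : ∀ s : Finset ℕ, ∑ j ∈ s, ε (j - 1 - 1) ≤ E) (hE1 : (4 * Λ + 4) * E < 1) :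
    ∃ (A : X →L[ℝ] SeqLp p (SeqLp p ℝ)) (r : SeqLp p (SeqLp p ℝ) →L[ℝ] X), ∀ x, r (A x) = x := by
  have hp0 : 0 < p := by linarith
  have hρ0 : 0 ≤ ρ := le_trans (by positivity) hρ
  have hE' : ∀ s : Finset ℕ, ∑ j ∈ s, ε (j - 1) ≤ E := fun s =>
    (Finset.sum_le_sum fun j _ => hanti (Nat.sub_le (j - 1) 1)).trans (hE s)
  choose R V hR hV hRV using fun n => (S.P n).exists_factorization hp0 hΛ
  set C := 2 * (|M.bound| + ((2 * Λ) ^ q + K + E))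
  have hC : 0 ≤ C := by positivity
  obtain ⟨A, -, hA⟩ := SeqLp.exists_analysis (p := p) hp0 (C := Λ * C) (by positivity)
    (T := fun n => R (n + 2) ∘L S.diff n (n + 1)) fun s x => by
      calc _ ≤ ∑ n ∈ s, Λ ^ p * ‖S.diff n (n + 1) x‖ ^ p := Finset.sum_le_sum fun n _ => by
            rw [← Real.mul_rpow hΛ (norm_nonneg _)]
            exact Real.rpow_le_rpow (norm_nonneg _) (hR _ _) hp0.le
        _ ≤ Λ ^ p * (C ^ p * ‖x‖ ^ p) := by
            rw [← Finset.mul_sum]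
            gcongr
            exact S.sum_norm_block_le hp1 hpq hΛ hK hε hE0 hρ hE' s x
        _ = _ := by rw [Real.mul_rpow hΛ hC, mul_assoc]
  obtain ⟨B, hB⟩ := SeqLp.exists_synthesis (p := p) hp0 (C := 4 * ρ) (by positivity)
    (T := fun n => S.diff (n - 1) (n + 2) ∘L V (n + 2)) fun s y => by
      refine (S.norm_sum_enlarged_le hp1 hΛ hε hρ0 hρ' hE s fun n => V (n + 2) (y n)).trans ?_
      gcongr with n
      exact hV _ _
  obtain ⟨r, hr⟩ := exists_leftInverse A B hE1 (by positivity) fun x => by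
    have h1 := (S.tendsto_sum_block x).sub (hB (A x)).tendsto_sum_nat
    refine le_of_tendsto' h1.norm fun N => ?_
    rw [← Finset.sum_sub_distrib]
    refine (norm_sum_le_of_le _ fun n _ =>
      (?_ : _ ≤ (4 * Λ + 4) * ε (n - 1 - 1) * ‖x‖)).trans ?_
    · simp only [ContinuousLinearMap.comp_apply, hA, hRV]
      exact S.norm_enlarged_comp_block_le hp0 hΛ hanti n x
    · rw [← Finset.sum_mul, ← Finset.mul_sum]
      gcongr
      exact hE _
  exact ⟨A, r, hr⟩

end BlockSystem

end

section

lemma sum_rpow_le_rpow_sum {p : ℝ} (hp : 1 ≤ p) (s : Finset ℕ) {u : ℕ → ℝ} (hu : ∀ n, 0 ≤ u n) :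
    ∑ n ∈ s, u n ^ p ≤ (∑ n ∈ s, u n) ^ p := by
  classical
  induction s using Finset.induction_on with
  | empty => simpa using by positivity
  | insert a s ha ih =>
    rw [Finset.sum_insert ha, Finset.sum_insert ha]
    have h := NNReal.add_rpow_le_rpow_add ⟨u a, hu a⟩
      ⟨∑ n ∈ s, u n, Finset.sum_nonneg fun n _ => hu n⟩ hp
    have h' : u a ^ p + (∑ n ∈ s, u n) ^ p ≤ (u a + ∑ n ∈ s, u n) ^ p := by exact_mod_cast h
    linarith

variable {p : ℝ} {X : Type*} [NormedAddCommGroup X] [NormedSpace ℝ X]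

namespace BlockSystem

variable {M : SmoothModel p X} {Λ q K ρ : ℝ} {ε : ℕ → ℝ} (S : BlockSystem M Λ q K ρ ε)

lemma norm_enlarged_apply_x_sub (hanti : Antitone ε) (k : ℕ) :
    ‖S.diff (k - 1) (k + 2) (S.x k) - S.x k‖ ≤ ε (k - 1 - 1) := by
  rw [diff, sub_apply, S.map_x_eq_zero (k - 1) k (by omega), sub_zero]
  exact (S.map_x_near k (k + 1) (k + 2) (by omega) (by omega)).trans (hanti (by omega))

lemma block_apply_x_eq_zero {n k : ℕ} (h : n < k) : S.diff n (n + 1) (S.x k) = 0 := by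
  rw [diff, sub_apply, S.map_x_eq_zero _ _ h, S.map_x_eq_zero _ _ h.le, sub_zero]

lemma norm_block_apply_x_le (hanti : Antitone ε) {n k : ℕ} (h : k < n) :
    ‖S.diff n (n + 1) (S.x k)‖ ≤ 2 * ε (n - 1 - 1) := by
  have h1 := S.map_x_near k (n - 1) (n + 1) (by omega) (by omega)
  have h2 := S.map_x_near k (n - 1) n (by omega) (by omega)
  have h3 := hanti (show n - 1 - 1 ≤ n - 1 by omega)
  rw [diff, sub_apply, ← sub_sub_sub_cancel_right _ _ (S.x k)]
  refine (norm_sub_le _ _).trans ?_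
  linarith

lemma norm_block_apply_x_self_sub (hanti : Antitone ε) (n : ℕ) :
    ‖S.diff n (n + 1) (S.x n) - S.x n‖ ≤ ε (n - 1 - 1) := by
  rw [diff, sub_apply, S.map_x_eq_zero _ _ le_rfl, sub_zero]
  exact (S.map_x_near n n (n + 1) le_rfl (by omega)).trans (hanti (by omega))

variable [Fact (1 ≤ ENNReal.ofReal p)] [CompleteSpace X]

/-- A space with a block system contains a complemented copy of `ℓ_p`. -/
theorem exists_section (S : BlockSystem M Λ q K ρ ε) (hp1 : 1 < p) (hpq : p.HolderConjugate q)
    (hΛ : 0 ≤ Λ) (hK : 0 ≤ K) (hε : ∀ n, 0 ≤ ε n) (hanti : Antitone ε) {E : ℝ} (hE0 : 0 ≤ E)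
    (hρ : (2 * Λ) ^ q + K + E ≤ ρ) (hρ' : 2 * (|M.bound| * (2 * Λ) ^ p) + E ≤ ρ ^ p)
    (hE : ∀ s : Finset ℕ, ∑ j ∈ s, (2 * j + 1) * ε (j - 1 - 1) ≤ E) (hE1 : E < 1) :
    ∃ (B : SeqLp p ℝ →L[ℝ] X) (r : X →L[ℝ] SeqLp p ℝ), ∀ t, r (B t) = t := by
  have hp0 : 0 < p := by linarith
  have hρ0 : 0 ≤ ρ := le_trans (by positivity) hρ
  have hE2 : ∀ s : Finset ℕ, ∑ j ∈ s, ε (j - 1 - 1) ≤ E := fun s =>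
    (Finset.sum_le_sum fun j _ => le_mul_of_one_le_left (hε _)
      (by linarith [(Nat.cast_nonneg j : (0 : ℝ) ≤ j)])).trans (hE s)
  have hE' : ∀ s : Finset ℕ, ∑ j ∈ s, ε (j - 1) ≤ E := fun s =>
    (Finset.sum_le_sum fun j _ => hanti (Nat.sub_le (j - 1) 1)).trans (hE2 s)
  choose h hh1 hh2 using fun n => exists_dual_vector'' ℝ (S.x n)
  simp only [S.norm_x] at hh2
  obtain ⟨A, -, hA⟩ := SeqLp.exists_analysis (p := p) hp0
    (C := 2 * (|M.bound| + ((2 * Λ) ^ q + K + E))) (by positivity)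
    (T := fun n => h n ∘L S.diff n (n + 1)) fun s x =>
      (Finset.sum_le_sum fun n _ => Real.rpow_le_rpow (norm_nonneg _)
        (((h n).le_of_opNorm_le (hh1 n) _).trans_eq (one_mul _)) hp0.le).trans
        (S.sum_norm_block_le hp1 hpq hΛ hK hε hE0 hρ hE' s x)
  obtain ⟨B, hB⟩ := SeqLp.exists_synthesis (p := p) (E := ℝ) hp0 (C := 4 * ρ + E) (by positivity)
    (T := fun n => ContinuousLinearMap.toSpanSingleton ℝ (S.x n)) fun s t => by
      set τ := (∑ n ∈ s, ‖t n‖ ^ p) ^ (1 / p)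
      have hτ : ∀ n ∈ s, ‖t n‖ ≤ τ := fun n hn => by
        have := Finset.single_le_sum (f := fun n => ‖t n‖ ^ p) (fun _ _ => by positivity) hn
        rwa [← Real.le_rpow_inv_iff_of_pos (norm_nonneg _)
          (Finset.sum_nonneg fun _ _ => by positivity) hp0, ← one_div] at this
      have h1 := S.norm_sum_enlarged_le hp1 hΛ hε hρ0 hρ' hE2 s fun n => t n • S.x n
      simp only [norm_smul, S.norm_x, mul_one] at h1
      have h2 : ‖∑ n ∈ s, (t n • S.x n - S.diff (n - 1) (n + 2) (t n • S.x n))‖ ≤ E * τ := by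
        refine (norm_sum_le_of_le _ fun n hn => (?_ : _ ≤ ε (n - 1 - 1) * τ)).trans ?_
        · rw [map_smul, ← smul_sub, norm_smul, norm_sub_rev, mul_comm]
          exact mul_le_mul (S.norm_enlarged_apply_x_sub hanti n) (hτ n hn) (norm_nonneg _) (hε _)
        · rw [← Finset.sum_mul]
          gcongr
          exact hE2 s
      rw [Finset.sum_sub_distrib] at h2
      simp only [ContinuousLinearMap.toSpanSingleton_apply]
      calc _ ≤ _ := norm_le_norm_add_norm_sub' _
              (∑ n ∈ s, S.diff (n - 1) (n + 2) (t n • S.x n))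
        _ ≤ 4 * ρ * τ + E * τ := add_le_add h1 h2
        _ = _ := by ring
  obtain ⟨r, hr⟩ := exists_leftInverse B A hE1 hE0 fun t => by
    have hcoord : ∀ n, ‖(t - A (B t)) n‖ ≤ (2 * n + 1) * ε (n - 1 - 1) * ‖t‖ := fun n => by
      have ht : ∀ k, ‖t k‖ ≤ ‖t‖ := lp.norm_apply_le_norm (by simpa using hp0) t
      have h1 := (h n ∘L S.diff n (n + 1)).hasSum (hB t)
      have h2 := hasSum_sum_of_ne_finset_zero (L := .unconditional ℕ) (s := Finset.range (n + 1))
        (f := fun k => (h n ∘L S.diff n (n + 1))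
          (ContinuousLinearMap.toSpanSingleton ℝ (S.x k) (t k))) fun k hk => by
            simp [S.block_apply_x_eq_zero (show n < k by simpa using hk)]
      have h3 : A (B t) n = _ := (hA (B t) n).trans (h1.unique h2)
      rw [lp.coeFn_sub, Pi.sub_apply, h3, Finset.sum_range_succ]
      simp only [ContinuousLinearMap.toSpanSingleton_apply, map_smul, smul_eq_mul,
        ContinuousLinearMap.comp_apply]
      have h4 : |t n * (h n (S.diff n (n + 1) (S.x n) - S.x n))| ≤ ‖t‖ * ε (n - 1 - 1) := by
        rw [abs_mul]
        refine mul_le_mul (ht n) ?_ (abs_nonneg _) (norm_nonneg _)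
        refine ((h n).le_of_opNorm_le (hh1 n) _).trans ?_
        rw [one_mul]
        exact S.norm_block_apply_x_self_sub hanti n
      have h5 : |∑ k ∈ Finset.range n, t k * h n (S.diff n (n + 1) (S.x k))| ≤
          n * (‖t‖ * (2 * ε (n - 1 - 1))) := by
        refine (Finset.abs_sum_le_sum_abs _ _).trans
          ((Finset.sum_le_card_nsmul _ _ _ fun k hk => ?_).trans_eq
            (by rw [Finset.card_range, nsmul_eq_mul]))
        rw [abs_mul]
        refine mul_le_mul (ht k) ?_ (abs_nonneg _) (norm_nonneg _)
        refine ((h n).le_of_opNorm_le (hh1 n) _).trans ?_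
        rw [one_mul]
        exact S.norm_block_apply_x_le hanti (Finset.mem_range.1 hk)
      rw [map_sub, hh2] at h4
      rw [Real.norm_eq_abs, abs_le]
      rw [abs_le] at h4 h5
      simp only [RCLike.ofReal_real_eq_id, id_eq] at h4
      constructor <;> nlinarith
    refine lp.norm_le_of_forall_sum_le (by rwa [ENNReal.toReal_ofReal hp0.le]) (by positivity)
      fun s => ?_
    rw [ENNReal.toReal_ofReal hp0.le]
    refine (sum_rpow_le_rpow_sum hp1.le s fun _ => norm_nonneg _).trans
      (Real.rpow_le_rpow (Finset.sum_nonneg fun _ _ => norm_nonneg _) ?_ hp0.le)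
    refine (Finset.sum_le_sum fun n _ => hcoord n).trans ?_
    rw [← Finset.sum_mul]
    gcongr
    exact hE s
  exact ⟨B, r, hr⟩

end BlockSystem

end

section

lemma exists_rapidly_decreasing {E : ℝ} (hE : 0 < E) : ∃ ε : ℕ → ℝ, (∀ n, 0 < ε n) ∧
    Tendsto ε atTop (nhds 0) ∧ Antitone ε ∧
      ∀ s : Finset ℕ, ∑ j ∈ s, (2 * j + 1) * ε (j - 1 - 1) ≤ E := by
  refine ⟨fun n => E / 64 * (1 / 4) ^ n, fun n => by positivity, ?_, fun m n h => ?_,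
    fun s => ?_⟩
  · simpa using (tendsto_pow_atTop_nhds_zero_of_lt_one (r := (1 / 4 : ℝ)) (by norm_num)
      (by norm_num)).const_mul (E / 64)
  · exact mul_le_mul_of_nonneg_left (pow_le_pow_of_le_one (by norm_num) (by norm_num) h)
      (by positivity)
  · have h1 : ∀ j : ℕ, (2 * j + 1 : ℝ) * (E / 64 * (1 / 4) ^ (j - 1 - 1)) ≤
        E / 2 * (1 / 2) ^ j := fun j => by
      have h2 : (2 * j + 1 : ℝ) ≤ 2 * 2 ^ j := by
        have : (j + 1 : ℝ) ≤ 2 ^ j := by exact_mod_cast Nat.lt_two_pow_self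
        linarith
      have h3 : (1 / 4 : ℝ) ^ (j - 1 - 1) ≤ 16 * (1 / 4) ^ j := by
        rw [show (16 : ℝ) * (1 / 4) ^ j = (1 / 4) ^ j / (1 / 4) ^ 2 by ring,
          le_div_iff₀ (by positivity), ← pow_add]
        exact pow_le_pow_of_le_one (by norm_num) (by norm_num) (by omega)
      calc _ ≤ 2 * 2 ^ j * (E / 64 * (16 * (1 / 4) ^ j)) := by gcongr
        _ = E / 2 * (2 * (1 / 4)) ^ j := by rw [mul_pow]; ring
        _ = _ := by norm_num
    refine (Finset.sum_le_sum fun j _ => h1 j).trans ?_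
    rw [← Finset.mul_sum]
    have := summable_geometric_two.sum_le_tsum s fun _ _ => by positivity
    rw [tsum_geometric_two] at this
    nlinarith

variable {p : ℝ} [Fact (1 ≤ ENNReal.ofReal p)]

namespace SeqLp

variable {E : Type*} [NormedAddCommGroup E] [NormedSpace ℝ E]

lemma exists_diagonal (hp : 0 < p) (W : E →L[ℝ] E) :
    ∃ D : SeqLp p E →L[ℝ] SeqLp p E, ∀ y n, D y n = W (y n) := by
  obtain ⟨D, -, hD⟩ := exists_analysis (p := p) hp (norm_nonneg W)
    (T := fun n => W ∘L eval (p := p) n) fun s y => by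
      calc _ ≤ ∑ n ∈ s, ‖W‖ ^ p * ‖y n‖ ^ p := Finset.sum_le_sum fun n _ => by
            rw [← Real.mul_rpow (norm_nonneg _) (norm_nonneg _)]
            exact Real.rpow_le_rpow (norm_nonneg _) (W.le_opNorm _) hp.le
        _ ≤ _ := by
            rw [← Finset.mul_sum]
            gcongr
            exact sum_norm_le hp y s
  exact ⟨D, hD⟩

lemma exists_leftShift (hp : 0 < p) :
    ∃ D : SeqLp p E →L[ℝ] SeqLp p E, ∀ y n, D y n = y (n + 1) := by
  obtain ⟨D, -, hD⟩ := exists_analysis (p := p) hp zero_le_one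
    (T := fun n => eval (p := p) (E := E) (n + 1)) fun s y => by
      have := sum_norm_le hp y (s.map (addRightEmbedding 1))
      rw [Finset.sum_map] at this
      simpa using this
  exact ⟨D, hD⟩

lemma exists_rightShift (hp : 0 < p) :
    ∃ D : SeqLp p E →L[ℝ] SeqLp p E, ∀ y, D y 0 = 0 ∧ ∀ n, D y (n + 1) = y n := by
  obtain ⟨D, -, hD⟩ := exists_analysis (p := p) (X := SeqLp p E) hp zero_le_one
    (T := fun n => n.casesOn 0 fun k => eval (p := p) (E := E) k) fun s y => by
      obtain ⟨N, hN⟩ := s.exists_nat_subset_range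
      have hN' : s ⊆ Finset.range (N + 1) := hN.trans (Finset.range_mono (Nat.le_succ N))
      refine (Finset.sum_le_sum_of_subset_of_nonneg hN' fun _ _ _ => by positivity).trans ?_
      rw [Finset.sum_range_succ']
      simpa [Real.zero_rpow hp.ne'] using sum_norm_le hp y (Finset.range N)
  exact ⟨D, fun y => ⟨hD y 0, fun n => hD y (n + 1)⟩⟩

lemma exists_single (hp : 0 < p) :
    ∃ D : E →L[ℝ] SeqLp p E, ∀ x, D x 0 = x ∧ ∀ n, D x (n + 1) = 0 := by
  obtain ⟨D, -, hD⟩ := exists_analysis (p := p) (X := E) (E := E) hp zero_le_one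
    (T := fun n => n.casesOn (.id ℝ E) fun _ => 0) fun s y => by
      obtain ⟨N, hN⟩ := s.exists_nat_subset_range
      have hN' : s ⊆ Finset.range (N + 1) := hN.trans (Finset.range_mono (Nat.le_succ N))
      refine (Finset.sum_le_sum_of_subset_of_nonneg hN' fun _ _ _ => by positivity).trans ?_
      rw [Finset.sum_range_succ']
      simp [Real.zero_rpow hp.ne']
  exact ⟨D, fun y => ⟨hD y 0, fun n => hD y (n + 1)⟩⟩

variable {X : Type*} [NormedAddCommGroup X] [NormedSpace ℝ X]

/-- A complemented subspace of `E` is absorbed by `ℓ_p(E)`. -/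
lemma nonempty_prod_equiv (hp : 0 < p) (i : X →L[ℝ] E) (r : E →L[ℝ] X) (h : ∀ x, r (i x) = x) :
    Nonempty ((X × SeqLp p E) ≃L[ℝ] SeqLp p E) := by
  obtain ⟨D, hD⟩ := exists_diagonal hp (i ∘L r)
  obtain ⟨D', hD'⟩ := exists_diagonal hp (.id ℝ E - i ∘L r)
  obtain ⟨σ, hσ⟩ := exists_leftShift (E := E) hp
  obtain ⟨τ, hτ⟩ := exists_rightShift (E := E) hp
  obtain ⟨e, he⟩ := exists_single (E := E) hp
  let F : (X × SeqLp p E) →L[ℝ] SeqLp p E :=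
    e ∘L i ∘L .fst ℝ X (SeqLp p E) + (D' + τ ∘L D) ∘L .snd ℝ X (SeqLp p E)
  let G : SeqLp p E →L[ℝ] X × SeqLp p E := (r ∘L eval 0).prod (σ ∘L D + D')
  have hF0 : ∀ z, F z 0 = i z.1 + (z.2 0 - i (r (z.2 0))) := fun z => by
    simp [F, (he _).1, hD', (hτ _).1]
  have hF1 : ∀ z n, F z (n + 1) = z.2 (n + 1) - i (r (z.2 (n + 1))) + i (r (z.2 n)) :=
    fun z n => by simp [F, (he _).2, hD', (hτ _).2, hD]
  have hG1 : ∀ w, (G w).1 = r (w 0) := fun w => rfl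
  have hG2 : ∀ w n, (G w).2 n = i (r (w (n + 1))) + (w n - i (r (w n))) := fun w n => by
    simp [G, hσ, hD, hD']
  refine ⟨ContinuousLinearEquiv.equivOfInverse F G (fun z => Prod.ext ?_ ?_) fun w => ?_⟩
  · rw [hG1, hF0]
    simp [h]
  · ext n
    rw [hG2, hF1]
    cases n with
    | zero => rw [hF0]; simp [h]
    | succ n => rw [hF1]; simp [h]
  · ext n
    cases n with
    | zero => rw [hF0, hG1, hG2]; simp [h]
    | succ n => rw [hF1, hG2, hG2]; simp [h]

/-- Pełczyński's decomposition method in `ℓ_p`. -/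
theorem nonempty_equiv_of_retracts (hp : 0 < p)
    (i : X →L[ℝ] SeqLp p (SeqLp p ℝ)) (r : SeqLp p (SeqLp p ℝ) →L[ℝ] X) (hr : ∀ x, r (i x) = x)
    (j : SeqLp p ℝ →L[ℝ] X) (s : X →L[ℝ] SeqLp p ℝ) (hs : ∀ t, s (j t) = t) :
    Nonempty (X ≃L[ℝ] SeqLp p ℝ) := by
  obtain ⟨e⟩ := nonempty_equiv (p := p) hp
  obtain ⟨e₁⟩ := nonempty_prod_equiv (p := p) hp (e.toContinuousLinearMap ∘L i)
    (r ∘L e.symm.toContinuousLinearMap) fun x => by simp [hr]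
  obtain ⟨e₂⟩ := nonempty_prod_equiv (p := p) hp (.id ℝ (SeqLp p ℝ)) (.id ℝ (SeqLp p ℝ))
    fun _ => rfl
  let f₁ : (X × SeqLp p ℝ) ≃L[ℝ] SeqLp p ℝ :=
    (((ContinuousLinearEquiv.refl ℝ X).prodCongr e.symm).trans e₁).trans e
  let f₂ : (SeqLp p ℝ × SeqLp p ℝ) ≃L[ℝ] SeqLp p ℝ :=
    (((ContinuousLinearEquiv.refl ℝ (SeqLp p ℝ)).prodCongr e.symm).trans e₂).trans e
  let g : X ≃L[ℝ] SeqLp p ℝ × s.ker := ContinuousLinearEquiv.equivOfRightInverse s j hs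
  exact ⟨g.trans <| (f₂.symm.prodCongr (.refl ℝ _)).trans <|
    (ContinuousLinearEquiv.prodAssoc ℝ _ _ _).trans <|
    (((ContinuousLinearEquiv.refl ℝ _).prodCongr g.symm).trans
      (ContinuousLinearEquiv.prodComm ℝ _ _)).trans f₁⟩

end SeqLp

end

end LpModel

/-- Corollary 1.6(ii): for `p ∈ (1,2)`, if an infinite-dimensional
`𝓛_p`-space `X` admits a weakly sequentially continuous coarse map into `ℓ_p`
satisfying Property (*), then `X` is isomorphic to `ℓ_p`. -/
theorem stmt4 (p : ℝ) (hp1 : 1 < p) (hp2 : p < 2) [Fact (1 ≤ ENNReal.ofReal p)]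
    (X : Type*) [NormedAddCommGroup X] [NormedSpace ℝ X] [CompleteSpace X]
    (hinf : ¬ FiniteDimensional ℝ X)
    (hLp : ∃ lam : ℝ, 1 ≤ lam ∧ ∀ E : Subspace ℝ X, FiniteDimensional ℝ E →
      ∃ F : Subspace ℝ X, FiniteDimensional ℝ F ∧ E ≤ F ∧
        ∃ (n : ℕ) (T : F ≃L[ℝ] PiLp (ENNReal.ofReal p) (fun _ : Fin n => ℝ)),
          ‖(T : F →L[ℝ] PiLp (ENNReal.ofReal p) (fun _ : Fin n => ℝ))‖ *
            ‖(T.symm : PiLp (ENNReal.ofReal p) (fun _ : Fin n => ℝ) →L[ℝ] F)‖ ≤ lam)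
    (f : X → lp (fun _ : ℕ => ℝ) (ENNReal.ofReal p))
    (hwsc : WeakSeqCont f) (hcoarse : Coarse f) (hstar : PropertyStar f) :
    Nonempty (X ≃L[ℝ] lp (fun _ : ℕ => ℝ) (ENNReal.ofReal p)) := by
  have hp0 : 0 < p := by linarith
  obtain ⟨Λ, hΛ1, hLp⟩ := hLp
  have hΛ : 0 ≤ Λ := zero_le_one.trans hΛ1
  have hpq := Real.HolderConjugate.conjExponent hp1
  obtain ⟨𝒞⟩ := LpModel.exists_localCoord hp1 hLp
  let M := 𝒞.smoothModel hp1 hp2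
  obtain ⟨c, hc0, hc⟩ := M.exists_asymptotic_lower hp1 hp2 hwsc hcoarse hstar
  obtain ⟨g, hg⟩ := M.exists_separating_seq hp1 hwsc hstar
  obtain ⟨𝓕, _, h𝓕, h𝓕'⟩ := 𝒞.exists_approximation hp1 hp2 hΛ
  obtain ⟨ε, hε, hε0, hanti, hE⟩ := LpModel.exists_rapidly_decreasing
    (E := 1 / (4 * Λ + 5)) (by positivity)
  have hE0 : 0 ≤ 1 / (4 * Λ + 5) := by positivity
  have hE1 : (4 * Λ + 4) * (1 / (4 * Λ + 5)) < 1 := by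
    rw [mul_one_div, div_lt_one (by positivity)]
    linarith
  have hE2 : 1 / (4 * Λ + 5) < 1 := by
    rw [div_lt_one (by positivity)]
    linarith
  set E := 1 / (4 * Λ + 5)
  set K := (2 * Λ * c ^ (-(1 / p))) ^ p.conjExponent
  have hK : 0 ≤ K := by positivity
  set ρ := 1 + ((2 * Λ) ^ p.conjExponent + K + E) + (2 * (|M.bound| * (2 * Λ) ^ p) + E)
  have h1 : 0 ≤ (2 * Λ) ^ p.conjExponent + K + E := by positivity
  have h2 : 0 ≤ 2 * (|M.bound| * (2 * Λ) ^ p) + E := by positivity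
  have hρ : (2 * Λ) ^ p.conjExponent + K + E ≤ ρ := by linarith
  have hρ' : 2 * (|M.bound| * (2 * Λ) ^ p) + E ≤ ρ ^ p :=
    le_trans (by linarith) (Real.self_le_rpow_of_one_le (by linarith : 1 ≤ ρ) hp1.le)
  obtain ⟨S⟩ := M.exists_blockSystem hp1 hpq hg hc0 hc hinf hΛ h𝓕 h𝓕' hε hε0 ρ
  obtain ⟨i, r, hr⟩ := S.exists_retract hp1 hpq hΛ hK (fun n => (hε n).le) hanti hE0 hρ hρ'
    (fun s => (Finset.sum_le_sum fun j _ => le_mul_of_one_le_left (hε _).le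
      (by linarith [(Nat.cast_nonneg j : (0 : ℝ) ≤ j)])).trans (hE s)) hE1
  obtain ⟨j, s, hs⟩ := S.exists_section hp1 hpq hΛ hK (fun n => (hε n).le) hanti hE0 hρ hρ'
    hE hE2
  exact LpModel.SeqLp.nonempty_equiv_of_retracts hp0 i r hr j s hs
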